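/- Identify each norm on ℝ^3 with its unit ball and endow the space of all norms on ℝ^3 with the topology induced by the Hausdorff distance between unit balls. Then the set of norms ‖·‖ on ℝ^3 failing the following property is meagre: for every ε > 0 there exists n₀ such that for every n > n₀, every set P of n points in ℝ^3 whose affine span is all of ℝ^3 determines at least (2 − ε)·n distinct distances with respect to ‖·‖. -/

import Mathlib

/-- The space of norms on `ℝ^3`, each norm represented by a seminorm that
vanishes only at `0`. -/
def NormOn3 : Type :=
  {N : Seminorm ℝ (EuclideanSpace ℝ (Fin 3)) // ∀ x, N x = 0 → x = 0}

/-- The unit ball of a norm on `ℝ^3`. -/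
def NormOn3.unitBall (N : NormOn3) : Set (EuclideanSpace ℝ (Fin 3)) :=
  {x | N.1 x ≤ 1}

/-- The space of norms on `ℝ^3`, with the topology induced by the Hausdorff
distance between unit balls. -/
noncomputable instance : PseudoEMetricSpace NormOn3 where
  edist N M := EMetric.hausdorffEdist N.unitBall M.unitBall
  edist_self N := EMetric.hausdorffEdist_self
  edist_comm N M := EMetric.hausdorffEdist_comm
  edist_triangle N M K := EMetric.hausdorffEdist_triangle


abbrev E3 : Type := EuclideanSpace ℝ (Fin 3)

section
theorem hit_lemma {ι α : Type*} [DecidableEq α] [DecidableEq ι] (I : Finset ι) (X : Finset α) (F : ι → Finset α) (a : ℕ)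
    (hF : ∀ i ∈ I, F i ⊆ X) (hne : ∀ i ∈ I, (F i).Nonempty)
    (ha : ∀ i ∈ I, X.card ≤ a * (F i).card) (s : ℕ) :
    ∃ S : Finset α, S ⊆ X ∧ S.card ≤ s ∧
      (I.filter (fun i => Disjoint (F i) S)).card * (a + s) ≤ I.card * a := by
  induction s with
  | zero => exact ⟨∅, by simp, by simp, by simp⟩
  | succ s ih =>
    obtain ⟨S, hS, hSc, hu⟩ := ih
    set U := I.filter (fun i => Disjoint (F i) S) with hU
    by_cases hUe : U = ∅
    · refine ⟨S, hS, by omega, ?_⟩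
      rw [← hU, hUe]; simp
    obtain ⟨i0, hi0⟩ := Finset.nonempty_iff_ne_empty.mpr hUe
    have hi0I : i0 ∈ I := (Finset.mem_filter.mp hi0).1
    have hXpos : 0 < X.card := by
      obtain ⟨x, hx⟩ := hne i0 hi0I
      exact Finset.card_pos.mpr ⟨x, hF i0 hi0I hx⟩
    have hdc : ∑ x ∈ X, (U.filter (fun i => x ∈ F i)).card = ∑ i ∈ U, (F i).card := by
      have := Finset.sum_card_bipartiteAbove_eq_sum_card_bipartiteBelow (s := X) (t := U) (fun x i => x ∈ F i)
      simp only [Finset.bipartiteAbove, Finset.bipartiteBelow] at this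
      rw [this]
      refine Finset.sum_congr rfl fun i hi => ?_
      congr 1
      ext x
      simp only [Finset.mem_filter]
      exact ⟨fun h => h.2, fun h => ⟨hF i (Finset.mem_filter.mp hi).1 h, h⟩⟩
    obtain ⟨x, hx, hxc⟩ : ∃ x ∈ X, U.card ≤ a * (U.filter (fun i => x ∈ F i)).card := by
      by_contra hcon
      push Not at hcon
      have h1 : ∑ x ∈ X, a * (U.filter (fun i => x ∈ F i)).card < ∑ x ∈ X, U.card :=
        Finset.sum_lt_sum_of_nonempty (Finset.card_pos.mp hXpos) hcon
      rw [← Finset.mul_sum, hdc, Finset.sum_const, smul_eq_mul, Finset.mul_sum] at h1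
      have h2 : ∑ i ∈ U, X.card ≤ ∑ i ∈ U, a * (F i).card :=
        Finset.sum_le_sum fun i hi => ha i (Finset.mem_filter.mp hi).1
      rw [Finset.sum_const, smul_eq_mul, mul_comm] at h2
      omega
    refine ⟨insert x S, Finset.insert_subset hx hS, (Finset.card_insert_le _ _).trans (by omega), ?_⟩
    set U' := I.filter (fun i => Disjoint (F i) (insert x S)) with hU'
    have hsplit : U'.card + (U.filter (fun i => x ∈ F i)).card ≤ U.card := by
      rw [← Finset.card_union_of_disjoint]
      · apply Finset.card_le_card
        intro i hi
        rcases Finset.mem_union.mp hi with h | h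
        · simp only [hU', Finset.mem_filter, Finset.disjoint_insert_right] at h
          simp only [hU, Finset.mem_filter]; tauto
        · exact (Finset.mem_filter.mp h).1
      · rw [Finset.disjoint_left]
        intro i hi hi'
        simp only [hU', Finset.mem_filter, Finset.disjoint_insert_right] at hi hi'
        tauto
    have h3 : a * U'.card + U.card ≤ a * U.card := by nlinarith
    have ha0 : 0 < a := by
      rcases Nat.eq_zero_or_pos a with h | h
      · subst h; have := ha i0 hi0I; omega
      · exact h
    have h4 : a * (U'.card * (a + (s+1))) ≤ a * (I.card * a) := by
      have hUU : U'.card ≤ U.card := by omega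
      have h5 : a * (U'.card * (a + (s+1))) + U.card * (a + (s+1)) ≤ a * U.card * (a + (s+1)) := by
        nlinarith
      nlinarith
    exact Nat.le_of_mul_le_mul_left h4 ha0
end

section
open scoped Pointwise

theorem pr_bound {G : Type*} [AddCommGroup G] [DecidableEq G] {A : Finset G} (hA : A.Nonempty) (C : ℕ)
    (h : (A - A).card ≤ C * A.card) (m n : ℕ) : (m • A - n • A).card ≤ C ^ (m + n) * A.card := by
  have h1 := Finset.pluennecke_ruzsa_inequality_nsmul_sub_nsmul_sub hA A m n
  have hpos : (0:ℚ≥0) < A.card := by exact_mod_cast hA.card_pos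
  have h2 : ((A - A).card : ℚ≥0) / A.card ≤ C := by
    rw [div_le_iff₀ hpos]; exact_mod_cast h
  have h3 : ((m • A - n • A).card : ℚ≥0) ≤ (C:ℚ≥0) ^ (m+n) * A.card :=
    h1.trans (by gcongr)
  exact_mod_cast h3

theorem ruzsa_nat {G : Type*} [AddCommGroup G] [DecidableEq G] {A B : Finset G} {K : ℕ} (hB : B.Nonempty)
    (h : (A + B).card ≤ K * B.card) : ∃ F : Finset G, F.card ≤ K ∧ A ⊆ F + (B - B) := by
  have h1 : ((A + B).card : ℝ) ≤ (K:ℝ) * (B.card : ℝ) := by exact_mod_cast h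
  obtain ⟨F, -, h2, h3⟩ := Finset.ruzsa_covering_add hB h1
  exact ⟨F, by exact_mod_cast h2, h3⟩

theorem ruzsa_cover_Y {G : Type*} [AddCommGroup G] [DecidableEq G] {A : Finset G} (hA : A.Nonempty) (C : ℕ)
    (h : (A - A).card ≤ C * A.card) :
    ∃ X : Finset G, X.card ≤ C ^ 5 ∧ (A - A) + (A - A) ⊆ X + (A - A) := by
  have h1 : (((A - A) + (A - A)) + A).card ≤ C ^ 5 * A.card := by
    have h2 := pr_bound hA C h 3 2
    have h3 : ((A - A) + (A - A)) + A = 3 • A - 2 • A := by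
      have e3 : 3 • A = A + A + A := by rw [succ_nsmul, two_nsmul]
      rw [e3, two_nsmul, sub_eq_add_neg, sub_eq_add_neg, neg_add]
      ac_rfl
    rw [h3]; exact h2
  obtain ⟨F, h2, h3⟩ := ruzsa_nat hA h1
  exact ⟨F, h2, h3⟩

theorem nsmul_card_le {G : Type*} [AddCommGroup G] [DecidableEq G] (X : Finset G) (j : ℕ) :
    (j • X).card ≤ (j + 1) ^ X.card := by
  classical
  have key : ∀ j : ℕ, ∀ z ∈ j • X, ∃ f : X → ℕ, (∑ x, f x = j) ∧ z = ∑ x : X, f x • (x : G) := by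
    intro j
    induction j with
    | zero =>
      intro z hz
      rw [zero_nsmul, Finset.mem_zero] at hz
      exact ⟨fun _ => 0, by simp, by simp [hz]⟩
    | succ j ih =>
      intro z hz
      rw [succ_nsmul, Finset.mem_add] at hz
      obtain ⟨y, hy, x, hx, rfl⟩ := hz
      obtain ⟨f, hf, rfl⟩ := ih y hy
      refine ⟨fun t => f t + (if t = ⟨x, hx⟩ then 1 else 0), ?_, ?_⟩
      · rw [Finset.sum_add_distrib, hf]; simp
      · simp only [add_smul, Finset.sum_add_distrib, ite_smul, one_smul, zero_smul]
        simp
  have hsub : j • X ⊆ (Fintype.piFinset (fun _ : X => Finset.range (j+1))).image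
      (fun f => ∑ x : X, f x • (x : G)) := by
    intro z hz
    obtain ⟨f, hf, rfl⟩ := key j z hz
    refine Finset.mem_image.mpr ⟨f, ?_, rfl⟩
    rw [Fintype.mem_piFinset]
    intro x
    rw [Finset.mem_range, ← hf]
    exact Nat.lt_succ_of_le (Finset.single_le_sum (f := f) (fun _ _ => Nat.zero_le _) (Finset.mem_univ x))
  refine (Finset.card_le_card hsub).trans (Finset.card_image_le.trans ?_)
  rw [Fintype.card_piFinset]
  simp

theorem nsmul_Y_sub {G : Type*} [AddCommGroup G] [DecidableEq G] (X Y : Finset G)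
    (h : Y + Y ⊆ X + Y) (j : ℕ) : (j + 1) • Y ⊆ j • X + Y := by
  induction j with
  | zero => simp
  | succ j ih =>
    rw [succ_nsmul]
    refine (Finset.add_subset_add_right ih).trans ?_
    rw [add_assoc]
    refine (Finset.add_subset_add_left h).trans ?_
    rw [← add_assoc, succ_nsmul]

theorem nsmul_Y_card {G : Type*} [AddCommGroup G] [DecidableEq G] (X Y : Finset G)
    (h : Y + Y ⊆ X + Y) (j : ℕ) : ((j + 1) • Y).card ≤ (j + 1) ^ X.card * Y.card :=
  (Finset.card_le_card (nsmul_Y_sub X Y h j)).trans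
    (Finset.card_add_le.trans (Nat.mul_le_mul_right _ (nsmul_card_le X j)))

/-- Rank lemma: small doubling in a rational vector space gives bounded rank. -/
theorem rank_lemma {G : Type*} [AddCommGroup G] [Module ℚ G] [DecidableEq G] {A : Finset G} (hA : A.Nonempty) (C : ℕ)
    (h : (A - A).card ≤ C * A.card) :
    ∃ X : Finset G, X.card ≤ C ^ 5 ∧ ∀ a ∈ A, ∀ b ∈ A, a - b ∈ Submodule.span ℚ (X : Set G) := by
  obtain ⟨X, hX, hY⟩ := ruzsa_cover_Y hA C h
  refine ⟨X, hX, ?_⟩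
  set W := Submodule.span ℚ (X : Set G) with hW
  set Y := A - A with hYdef
  have h2 : ∀ y ∈ Y, ∃ y' ∈ Y, (2:ℚ) • y - y' ∈ W := by
    intro y hy
    obtain ⟨x, hx, y', hy', he⟩ := Finset.mem_add.mp (hY (Finset.add_mem_add hy hy))
    refine ⟨y', hy', ?_⟩
    have : (2:ℚ) • y - y' = x := by rw [two_smul, ← he]; abel
    rw [this]; exact Submodule.subset_span hx
  have h3 : ∀ y ∈ Y, ∀ j : ℕ, ∃ y' ∈ Y, ((2:ℚ)^j) • y - y' ∈ W := by
    intro y hy j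
    induction j with
    | zero => exact ⟨y, hy, by simp⟩
    | succ j ih =>
      obtain ⟨y', hy', hm⟩ := ih
      obtain ⟨y'', hy'', hm'⟩ := h2 y' hy'
      refine ⟨y'', hy'', ?_⟩
      have : ((2:ℚ)^(j+1)) • y - y'' = (2:ℚ) • (((2:ℚ)^j) • y - y') + ((2:ℚ) • y' - y'') := by
        rw [smul_sub, smul_smul, pow_succ, mul_comm]; abel
      rw [this]
      exact W.add_mem (W.smul_mem _ hm) hm'
  intro a ha b hb
  have hy : a - b ∈ Y := Finset.sub_mem_sub ha hb
  choose g hg hgW using h3 _ hy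
  obtain ⟨i, -, j, -, hij, he⟩ := Set.infinite_univ.exists_ne_map_eq_of_mapsTo (f := g)
    (t := (Y : Set G)) (fun j _ => hg j) Y.finite_toSet
  have h4 : ((2:ℚ)^i - (2:ℚ)^j) • (a - b) ∈ W := by
    have := W.sub_mem (hgW i) (hgW j)
    rw [he] at this
    rw [sub_smul]
    convert this using 1
    abel
  have hne : (2:ℚ)^i - (2:ℚ)^j ≠ 0 := by
    rw [sub_ne_zero]
    intro h
    exact hij (pow_right_injective₀ (by norm_num) (by norm_num) h)
  have := W.smul_mem ((2:ℚ)^i - (2:ℚ)^j)⁻¹ h4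
  rwa [smul_smul, inv_mul_cancel₀ hne, one_smul] at this

theorem bits_mem {G : Type*} [AddCommGroup G] [DecidableEq G] (Y : Finset G) (h0 : (0:G) ∈ Y) (b : G) (J : ℕ)
    (h : ∀ j < J, (2^j) • b ∈ Y) : ∀ t < 2^J, t • b ∈ J • Y := by
  induction J with
  | zero => intro t ht; simp at ht; simp [ht]
  | succ J ih =>
    intro t ht
    have ih' := ih (fun j hj => h j (by omega))
    rw [succ_nsmul]
    by_cases hlt : t < 2^J
    · have := Finset.add_mem_add (ih' t hlt) h0
      simpa using this
    · have h1 := ih' (t - 2^J) (by rw [pow_succ] at ht; omega)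
      have := Finset.add_mem_add h1 (h J (by omega))
      rw [← add_smul] at this
      rwa [Nat.sub_add_cancel (by omega)] at this

theorem exists_J (c e : ℕ) : ∃ J : ℕ, c * (2 * J + 3) ^ e < 2 ^ (J + 1) := by
  have h1 : Filter.Tendsto (fun n : ℕ => (n:ℝ)^e / (2:ℝ)^n) Filter.atTop (nhds 0) :=
    tendsto_pow_const_div_const_pow_of_one_lt e (by norm_num)
  have h2 : ∀ᶠ n : ℕ in Filter.atTop, (n:ℝ)^e / (2:ℝ)^n < 1 / ((c+1) * 5 ^ e : ℝ) :=
    h1.eventually_lt_const (by positivity)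
  obtain ⟨n, hn, hn1⟩ := (h2.and (Filter.eventually_ge_atTop 1)).exists
  refine ⟨n, ?_⟩
  rw [div_lt_div_iff₀ (by positivity) (by positivity), one_mul] at hn
  have h3 : n^e * ((c+1) * 5^e) < 2^n := by exact_mod_cast hn
  calc c * (2*n+3)^e ≤ (c+1) * (5*n)^e := by
        apply Nat.mul_le_mul (by omega)
        exact Nat.pow_le_pow_left (by omega) e
    _ = n^e * ((c+1) * 5^e) := by rw [mul_pow]; ring
    _ < 2^n := h3
    _ ≤ 2^(n+1) := Nat.pow_le_pow_right (by norm_num) (by omega)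

theorem lemmaZ (C K : ℕ) : ∃ M : ℕ, ∀ (V : Type) [AddCommGroup V] [Module ℝ V] [DecidableEq V] (A : Finset V),
    (A - A).card ≤ C * A.card →
    (∀ v b : V, b ≠ 0 → ∀ B : Finset V, B ⊆ A → (∀ a ∈ B, ∃ t : ℝ, a = v + t • b) → B.card ≤ K) →
    A.card ≤ M := by
  obtain ⟨J, hJ⟩ := exists_J (K * C) (C^5)
  refine ⟨∏ i ∈ Finset.range (J+1), C ^ (2^i + 1), ?_⟩
  intro V _ _ _ A hA hK
  by_contra hcon
  push Not at hcon
  have hne : A.Nonempty := Finset.card_pos.mp (by omega)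
  obtain ⟨X, hX, hY⟩ := ruzsa_cover_Y hne C hA
  set Y := A - A with hYdef
  have hcov : ∀ i : ℕ, ∃ F : Finset V, F.card ≤ C ^ (2^i+1) ∧ ∀ a ∈ A, ∃ x ∈ F, ∃ y ∈ Y, a = x + (2^i : ℕ) • y := by
    intro i
    set B := A.image (fun a => (2^i : ℕ) • a) with hB
    have hinj : Function.Injective (fun a : V => (2^i : ℕ) • a) := by
      intro a b hab
      have hab' : ((2^i : ℕ):ℝ) • a = ((2^i : ℕ):ℝ) • b := by
        simpa only [Nat.cast_smul_eq_nsmul] using hab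
      exact smul_right_injective V (r := ((2^i : ℕ):ℝ)) (by positivity) hab'
    have hBc : B.card = A.card := Finset.card_image_of_injective _ hinj
    have hBsub : B ⊆ (2^i) • A := by
      intro z hz
      obtain ⟨a, ha, rfl⟩ := Finset.mem_image.mp hz
      exact Finset.nsmul_mem_nsmul ha
    have h1 : (A + B).card ≤ C ^ (2^i+1) * B.card := by
      rw [hBc]
      have h2 := pr_bound hne C hA (2^i+1) 0
      simp only [zero_nsmul, sub_zero, add_zero] at h2
      refine (Finset.card_le_card ?_).trans h2
      rw [succ_nsmul, add_comm]
      exact Finset.add_subset_add_right hBsub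
    obtain ⟨F, hF, hc⟩ := ruzsa_nat (hne.image _) h1
    refine ⟨F, hF, fun a ha => ?_⟩
    obtain ⟨x, hx, z, hz, rfl⟩ := Finset.mem_add.mp (hc ha)
    obtain ⟨b1, hb1, b2, hb2, rfl⟩ := Finset.mem_sub.mp hz
    obtain ⟨a1, ha1, rfl⟩ := Finset.mem_image.mp hb1
    obtain ⟨a2, ha2, rfl⟩ := Finset.mem_image.mp hb2
    exact ⟨x, hx, a1 - a2, Finset.sub_mem_sub ha1 ha2, by simp [smul_sub]⟩
  choose F hFc hF using hcov
  choose x hx y hy he using hF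
  -- pigeonhole
  have hpig : ∃ a, ∃ ha : a ∈ A, ∃ a', ∃ ha' : a' ∈ A, a ≠ a' ∧ ∀ i < J+1, x i a ha = x i a' ha' := by
    let T := (Finset.range (J+1)).pi F
    have hT : T.card < A.attach.card := by
      rw [Finset.card_pi, Finset.card_attach]
      exact (Finset.prod_le_prod' (fun i _ => hFc i)).trans_lt hcon
    obtain ⟨⟨a, ha⟩, -, ⟨a', ha'⟩, -, hne', h⟩ := Finset.exists_ne_map_eq_of_card_lt_of_maps_to (t := T) hT
      (f := fun a => fun i _ => x i a.1 a.2) (by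
        intro a _
        refine Finset.mem_coe.mpr (Finset.mem_pi.mpr ?_)
        intro i _
        exact hx i a.1 a.2)
    refine ⟨a, ha, a', ha', fun h => hne' (by simp [h]), fun i hi => ?_⟩
    exact congrFun (congrFun h i) (Finset.mem_range.mpr hi)
  obtain ⟨a, ha, a', ha', hne', hxe⟩ := hpig
  set b : V := ((2:ℝ)^J)⁻¹ • (a - a') with hb
  have hb0 : b ≠ 0 := by
    rw [hb]; exact smul_ne_zero (by positivity) (sub_ne_zero.mpr hne')
  have h0Y : (0:V) ∈ Y := by
    obtain ⟨z, hz⟩ := hne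
    rw [← sub_self z]; exact Finset.sub_mem_sub hz hz
  have hnegY : ∀ y ∈ Y, -y ∈ Y := by
    intro y hy
    obtain ⟨p, hp, q, hq, rfl⟩ := Finset.mem_sub.mp hy
    rw [neg_sub]; exact Finset.sub_mem_sub hq hp
  have hbits : ∀ j < J+1, (2^j) • b ∈ 2 • Y := by
    intro j hj
    have h1 : a - a' = (2^(J-j) : ℕ) • (y (J-j) a ha - y (J-j) a' ha') := by
      conv_lhs => rw [he (J-j) a ha, he (J-j) a' ha', hxe (J-j) (by omega)]
      rw [smul_sub]; abel
    have h2 : (2^j) • b = y (J-j) a ha - y (J-j) a' ha' := by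
      rw [hb, h1, ← Nat.cast_smul_eq_nsmul ℝ (2^j), ← Nat.cast_smul_eq_nsmul ℝ (2^(J-j)), smul_smul, smul_smul]
      have : (((2^j : ℕ):ℝ) * ((2^J)⁻¹)) * ((2^(J-j) : ℕ):ℝ) = 1 := by
        push_cast
        have : (2:ℝ)^J = 2^j * 2^(J-j) := by rw [← pow_add]; congr 1; omega
        rw [this]; field_simp
      rw [this, one_smul]
    rw [h2, two_nsmul, sub_eq_add_neg]
    exact Finset.add_mem_add (hy _ _ _) (hnegY _ (hy _ _ _))
  have h02Y : (0:V) ∈ 2 • Y := by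
    rw [two_nsmul]; simpa using Finset.add_mem_add h0Y h0Y
  have hmem := bits_mem (2 • Y) h02Y b (J+1) hbits
  rw [smul_smul] at hmem
  -- counting
  have hmaps : ∀ p ∈ A ×ˢ Finset.range (2^(J+1)), p.1 - a + p.2 • b ∈ ((J+1)*2+1) • Y := by
    rintro ⟨p, t⟩ hp
    rw [Finset.mem_product, Finset.mem_range] at hp
    rw [succ_nsmul]
    show p - a + t • b ∈ _
    rw [add_comm (p - a)]
    exact Finset.add_mem_add (hmem t hp.2) (Finset.sub_mem_sub hp.1 ha)
  have hcount := Finset.card_le_mul_card_image_of_maps_to hmaps K (by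
    intro z hz
    have hinj : Set.InjOn Prod.fst (((A ×ˢ Finset.range (2^(J+1))).filter (fun p => p.1 - a + p.2 • b = z) : Finset (V × ℕ)) : Set (V × ℕ)) := by
      rintro ⟨p, t⟩ hp ⟨p', t'⟩ hp' hpp
      simp only [Finset.coe_filter, Set.mem_ofPred_eq] at hp hp' hpp
      subst hpp
      have : t • b = t' • b := by
        have := hp.2.trans hp'.2.symm
        exact add_left_cancel this
      rw [← Nat.cast_smul_eq_nsmul ℝ t, ← Nat.cast_smul_eq_nsmul ℝ t'] at this
      have := smul_left_injective ℝ hb0 this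
      rw [Prod.mk.injEq]; exact ⟨rfl, by exact_mod_cast this⟩
    rw [← Finset.card_image_of_injOn hinj]
    apply hK (z + a) b hb0
    · intro p hp
      obtain ⟨q, hq, rfl⟩ := Finset.mem_image.mp hp
      exact (Finset.mem_product.mp (Finset.mem_filter.mp hq).1).1
    · intro p hp
      obtain ⟨q, hq, rfl⟩ := Finset.mem_image.mp hp
      refine ⟨-(q.2:ℝ), ?_⟩
      rw [← (Finset.mem_filter.mp hq).2, neg_smul, Nat.cast_smul_eq_nsmul]; abel)
  rw [Finset.card_product, Finset.card_range] at hcount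
  have h5 := nsmul_Y_card X Y hY ((J+1)*2)
  have h6 : (((J+1)*2+1) • Y).card ≤ (2*J+3)^(C^5) * (C * A.card) := by
    refine h5.trans (Nat.mul_le_mul ?_ hA)
    have : (J+1)*2+1 = 2*J+3 := by ring
    rw [this]
    exact Nat.pow_le_pow_right (by omega) hX
  have h7 : A.card * 2^(J+1) ≤ A.card * (K * C * (2*J+3)^(C^5)) := by
    calc _ ≤ _ := hcount
      _ ≤ K * ((2*J+3)^(C^5) * (C * A.card)) := Nat.mul_le_mul_left _ h6
      _ = _ := by ring
  have := Nat.le_of_mul_le_mul_left h7 hne.card_pos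
  omega
end

section
open scoped Pointwise

theorem ungar_arith (d : ℕ → ℕ) (k h : ℕ)
    (hcons : ∀ i i', i < i' → i' < k → 0 < d i → 0 < d i' → (∀ j, i < j → j < i' → d j = 0) → d i + d i' ≤ i' - i)
    (hwrap : ∀ i i', i < i' → i' < k → 0 < d i → 0 < d i' → (∀ j, j < i → d j = 0) → (∀ j, i' < j → j < k → d j = 0) →
      d i + d i' + (i' - i) ≤ k)
    (hsum : h ≤ ∑ i ∈ Finset.range k, d i)
    (htwo : ∃ i i', i < i' ∧ i' < k ∧ 0 < d i ∧ 0 < d i') : 2 * h ≤ k := by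
  classical
  obtain ⟨a, b, hab, hbk, hda, hdb⟩ := htwo
  let S := (Finset.range k).filter (fun i => 0 < d i)
  have haS : a ∈ S := by simp [S]; omega
  have hbS : b ∈ S := by simp [S]; omega
  obtain ⟨i0, hi0, hmin⟩ := S.exists_minimal ⟨a, haS⟩
  obtain ⟨i1, hi1, hmax⟩ := S.exists_maximal ⟨a, haS⟩
  have hlo : ∀ j ∈ S, i0 ≤ j := fun j hj => by
    by_contra h; push Not at h; have := hmin hj h.le; omega
  have hhi : ∀ j ∈ S, j ≤ i1 := fun j hj => by
    by_contra h; push Not at h; have := hmax hj h.le; omega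
  have hS : ∀ j, j ∈ S ↔ j < k ∧ 0 < d j := by intro j; simp [S]
  have claim : ∀ n, n ∈ S → 2 * (∑ j ∈ Finset.range (n+1), d j) + i0 ≤ n + d i0 + d n := by
    intro n
    induction n using Nat.strong_induction_on with
    | _ n ih =>
      intro hn
      by_cases hn0 : n = i0
      · subst hn0
        rw [Finset.sum_range_succ]
        have : ∑ j ∈ Finset.range n, d j = 0 := by
          apply Finset.sum_eq_zero
          intro j hj
          by_contra hne
          have := hlo j ((hS j).mpr ⟨by have := (hS n).mp hn; simp at hj; omega, by omega⟩)
          simp at hj; omega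
        omega
      · have hlt : i0 < n := lt_of_le_of_ne (hlo n hn) (Ne.symm hn0)
        let S' := S.filter (· < n)
        have : i0 ∈ S' := by simp [S', hi0, hlt]
        obtain ⟨m, hm, hmm⟩ := S'.exists_maximal ⟨i0, this⟩
        have hmS : m ∈ S := (Finset.mem_filter.mp hm).1
        have hmn : m < n := (Finset.mem_filter.mp hm).2
        have hz : ∀ j, m < j → j < n → d j = 0 := by
          intro j hj hjn
          by_contra hne
          have hjS : j ∈ S' := by
            rw [Finset.mem_filter, hS]; have := (hS n).mp hn; omega
          have := hmm hjS hj.le; omega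
        have h1 := ih m hmn hmS
        have h2 := hcons m n hmn ((hS n).mp hn).1 ((hS m).mp hmS).2 ((hS n).mp hn).2 hz
        have h3 : ∑ j ∈ Finset.range (n+1), d j = ∑ j ∈ Finset.range (m+1), d j + d n := by
          rw [Finset.sum_range_succ]
          congr 1
          symm
          apply Finset.sum_subset
          · intro j hj; simp at *; omega
          · intro j hj hj'; simp at *; exact hz j (by omega) hj
        omega
  have hc := claim i1 hi1
  have h01 : i0 < i1 := by have := hlo a haS; have := hhi b hbS; omega
  have hw := hwrap i0 i1 h01 ((hS i1).mp hi1).1 ((hS i0).mp hi0).2 ((hS i1).mp hi1).2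
    (by
      intro j hj; by_contra hne
      have := hlo j ((hS j).mpr ⟨by have := (hS i0).mp hi0; omega, by omega⟩); omega)
    (by
      intro j hj hjk; by_contra hne
      have := hhi j ((hS j).mpr ⟨hjk, by omega⟩); omega)
  have htot : ∑ i ∈ Finset.range k, d i = ∑ j ∈ Finset.range (i1+1), d j := by
    symm
    apply Finset.sum_subset
    · intro j hj; have := (hS i1).mp hi1; simp at *; omega
    · intro j hj hj'; simp at *
      by_contra hne
      have := hhi j ((hS j).mpr ⟨hj, by omega⟩); omega
  omega

theorem exists_samples (S : Finset ℝ) : ∃ t s : ℕ → ℝ, (∀ i < S.card, s i < t i ∧ t i < s (i+1)) ∧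
    (∀ σ, σ ∈ S ↔ ∃ i < S.card, t i = σ) := by
  classical
  induction S using Finset.induction_on_max with
  | empty => exact ⟨fun _ => 0, fun _ => 0, by simp, by simp⟩
  | insert a S ha ih =>
    obtain ⟨t, s, h1, h2⟩ := ih
    have haS : a ∉ S := fun h => lt_irrefl _ (ha a h)
    rw [Finset.card_insert_of_notMem haS]
    set k := S.card
    refine ⟨fun i => if i < k then t i else a, fun i => if i < k then s i else if i = k then
      (if k = 0 then a - 1 else (t (k-1) + a)/2) else a + 1, ?_, ?_⟩
    · intro i hi
      by_cases hik : i < k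
      · have h3 := h1 i hik
        have hta : t i < a := ha _ ((h2 _).mpr ⟨i, hik, rfl⟩)
        by_cases hik' : i + 1 < k
        · simp only [hik, hik', if_true]; exact h3
        · have hk : i + 1 = k := by omega
          have hk0 : k ≠ 0 := by omega
          have hk1 : k - 1 = i := by omega
          simp only [hik, hik', if_true, if_false, hk, hk0, hk1, lt_irrefl]
          exact ⟨h3.1, by linarith⟩
      · have hk : i = k := by omega
        rw [hk]
        have e1 : ¬ (k + 1 < k) := by omega
        have e2 : ¬ (k + 1 = k) := by omega
        simp only [lt_irrefl, if_true, if_false, e1, e2]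
        refine ⟨?_, by linarith⟩
        split_ifs with h0
        · linarith
        · have : t (k-1) < a := ha _ ((h2 _).mpr ⟨k-1, by omega, rfl⟩)
          linarith
    · intro σ
      rw [Finset.mem_insert, h2]
      constructor
      · rintro (rfl | ⟨i, hi, rfl⟩)
        · exact ⟨k, by omega, by simp⟩
        · exact ⟨i, by omega, by simp [hi]⟩
      · rintro ⟨i, hi, rfl⟩
        by_cases hik : i < k
        · right; exact ⟨i, hik, by simp [hik]⟩
        · left; simp [hik]

theorem exists_top {α : Type*} [DecidableEq α] (A : Finset α) (f : α → ℝ) (hf : Set.InjOn f A) (h : ℕ) (hh : h ≤ A.card) :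
    ∃ U ⊆ A, U.card = h ∧ ∀ p ∈ U, ∀ q ∈ A, q ∉ U → f q < f p := by
  induction h with
  | zero => exact ⟨∅, by simp, by simp, by simp⟩
  | succ h ih =>
    obtain ⟨U, hU, hc, hp⟩ := ih (by omega)
    have hne : (A \ U).Nonempty := by
      rw [← Finset.card_pos, Finset.card_sdiff_of_subset hU]; omega
    obtain ⟨m, hm, hmax⟩ := Finset.exists_max_image (A \ U) f hne
    rw [Finset.mem_sdiff] at hm
    refine ⟨insert m U, Finset.insert_subset hm.1 hU, by rw [Finset.card_insert_of_notMem hm.2, hc], ?_⟩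
    intro p hpU q hq hqU
    rw [Finset.mem_insert, not_or] at hqU
    rcases Finset.mem_insert.mp hpU with rfl | hpU
    · refine lt_of_le_of_ne (hmax q (Finset.mem_sdiff.mpr ⟨hq, hqU.2⟩)) ?_
      intro he; exact hqU.1 (hf hq hm.1 he)
    · exact hp p hpU q hq hqU.2

theorem cross_count (a b ε : ℝ) (hab : a ≠ b) (hε : ε = 1 ∨ ε = -1) (E L Sg : Finset ℝ) (hE : E.Nonempty) (hL : L.Nonempty)
    (hs : ∀ α ∈ E, ∀ β ∈ L, 0 < ε * (α * β)) (hmem : ∀ α ∈ E, ∀ β ∈ L, α ≠ β ∧ (β * b - α * a) / (β - α) ∈ Sg) :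
    E.card + L.card ≤ Sg.card + 1 := by
  classical
  have hε0 : ε ≠ 0 := by rcases hε with h | h <;> simp [h]
  have hεε : ε * ε = 1 := by rcases hε with h | h <;> simp [h]
  obtain ⟨α0, hα0⟩ := hE
  obtain ⟨β0, hβ0⟩ := hL
  have hEn : ∀ α ∈ E, α ≠ 0 := fun α hα h => by have := hs α hα β0 hβ0; simp [h] at this
  have hLn : ∀ β ∈ L, β ≠ 0 := fun β hβ h => by have := hs α0 hα0 β hβ; simp [h] at this
  have samesign : ∀ x y z : ℝ, 0 < ε * (x * z) → 0 < ε * (y * z) → Real.log x = Real.log y → x = y := by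
    intro x y z hx hy hl
    have hz : z ≠ 0 := by rintro rfl; simp at hx
    have hxn : x ≠ 0 := by rintro rfl; simp at hx
    have hyn : y ≠ 0 := by rintro rfl; simp at hy
    have h1 : Real.log (ε * (x*z)) = Real.log (ε * (y * z)) := by
      rw [Real.log_mul hε0 (mul_ne_zero hxn hz), Real.log_mul hε0 (mul_ne_zero hyn hz), Real.log_mul hxn hz,
        Real.log_mul hyn hz, hl]
    have h2 := Real.log_injOn_pos (Set.mem_Ioi.mpr hx) (Set.mem_Ioi.mpr hy) h1
    exact mul_right_cancel₀ hz (mul_left_cancel₀ hε0 h2)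
  have hEc : (E.image Real.log).card = E.card := Finset.card_image_of_injOn (by
    intro x hx y hy h; exact samesign x y β0 (hs x hx β0 hβ0) (hs y hy β0 hβ0) h)
  have hLc : (L.image (fun β => - Real.log β)).card = L.card := Finset.card_image_of_injOn (by
    intro x hx y hy h
    refine samesign x y α0 ?_ ?_ (neg_injective h)
    · rw [mul_comm x]; exact hs α0 hα0 x hx
    · rw [mul_comm y]; exact hs α0 hα0 y hy)
  have hcd := cauchy_davenport_add_of_linearOrder_isCancelAdd (s := E.image Real.log)
    (t := L.image (fun β => - Real.log β)) (⟨_, Finset.mem_image_of_mem _ hα0⟩) (⟨_, Finset.mem_image_of_mem _ hβ0⟩)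
  rw [hEc, hLc] at hcd
  have hr : ∀ α ∈ E, ∀ β ∈ L, α / β = ε * Real.exp (Real.log α + - Real.log β) := by
    intro α hα β hβ
    have h1 := hs α hα β hβ
    have h2 : 0 < ε * (α / β) := by
      have : ε * (α / β) = ε * (α * β) / (β * β) := by field_simp [hLn β hβ]
      rw [this]; exact div_pos h1 (mul_self_pos.mpr (hLn β hβ))
    have h3 : Real.log (ε * (α/β)) = Real.log α + - Real.log β := by
      rw [Real.log_mul hε0 (div_ne_zero (hEn α hα) (hLn β hβ)), Real.log_div (hEn α hα) (hLn β hβ)]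
      rcases hε with h | h <;> simp [h] <;> ring
    rw [← h3, Real.exp_log h2, ← mul_assoc, hεε, one_mul]
  have hle : (E.image Real.log + L.image (fun β => - Real.log β)).card ≤ Sg.card := by
    apply Finset.card_le_card_of_injOn (fun w => (b - (ε * Real.exp w) * a) / (1 - ε * Real.exp w))
    · intro w hw
      obtain ⟨u, hu, v, hv, rfl⟩ := Finset.mem_add.mp hw
      obtain ⟨α, hα, rfl⟩ := Finset.mem_image.mp hu
      obtain ⟨β, hβ, rfl⟩ := Finset.mem_image.mp hv
      simp only
      rw [← hr α hα β hβ]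
      have hm := hmem α hα β hβ
      have hb := hLn β hβ
      have : (b - α / β * a) / (1 - α / β) = (β * b - α * a) / (β - α) := by
        have : β - α ≠ 0 := sub_ne_zero.mpr hm.1.symm
        have h2 : 1 - α / β = (β - α) / β := by field_simp
        rw [h2]; field_simp
      rw [this]; exact hm.2
    · have hne1 : ∀ w ∈ E.image Real.log + L.image (fun β => - Real.log β), 1 - ε * Real.exp w ≠ 0 := by
        intro w hw
        obtain ⟨u, hu, v, hv, rfl⟩ := Finset.mem_add.mp hw
        obtain ⟨α, hα, rfl⟩ := Finset.mem_image.mp hu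
        obtain ⟨β, hβ, rfl⟩ := Finset.mem_image.mp hv
        rw [← hr α hα β hβ]
        have hb := hLn β hβ
        intro h0
        have : α / β = 1 := by linarith
        rw [div_eq_one_iff_eq hb] at this
        exact (hmem α hα β hβ).1 this
      intro w hw w' hw' he
      have h1 := hne1 w hw
      have h2 := hne1 w' hw'
      simp only at he
      rw [div_eq_div_iff h1 h2] at he
      have h3 : (b - a) * (ε * (Real.exp w - Real.exp w')) = 0 := by linarith
      have h4 : b - a ≠ 0 := sub_ne_zero.mpr hab.symm
      have h5 := (mul_eq_zero.mp h3).resolve_left h4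
      have h6 := (mul_eq_zero.mp h5).resolve_left hε0
      exact Real.exp_injective (by linarith)
  omega
end

section
open scoped Pointwise

theorem ungar_core {ι : Type*} (x y : ι → ℝ) (a b c c' X ε : ℝ) (hab : a < b) (hε : ε = 1 ∨ ε = -1)
    (hX : c + a * X = c' + b * X)
    (E L : Finset ι) (hE : E.Nonempty) (hL : L.Nonempty) (Sg : Finset ℝ)
    (hxE : Set.InjOn x E) (hxL : Set.InjOn x L)
    (hyE : ∀ e ∈ E, y e = c + a * x e) (hyL : ∀ l ∈ L, y l = c' + b * x l)
    (hs : ∀ e ∈ E, ∀ l ∈ L, 0 < ε * ((x e - X) * (x l - X)))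
    (hmem : ∀ e ∈ E, ∀ l ∈ L, x e ≠ x l ∧ (y e - y l) / (x e - x l) ∈ Sg) :
    E.card + L.card ≤ Sg.card + 1 := by
  classical
  have h := cross_count a b ε hab.ne hε (E.image (fun p => x p - X)) (L.image (fun p => x p - X)) Sg
    (hE.image _) (hL.image _) (by
      intro α hα β hβ
      obtain ⟨e, he, rfl⟩ := Finset.mem_image.mp hα
      obtain ⟨l, hl, rfl⟩ := Finset.mem_image.mp hβ
      exact hs e he l hl) (by
      intro α hα β hβ
      obtain ⟨e, he, rfl⟩ := Finset.mem_image.mp hα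
      obtain ⟨l, hl, rfl⟩ := Finset.mem_image.mp hβ
      obtain ⟨h1, h2⟩ := hmem e he l hl
      refine ⟨fun h => h1 (by linarith), ?_⟩
      convert h2 using 1
      rw [hyE e he, hyL l hl]
      have h3 : x e - x l ≠ 0 := sub_ne_zero.mpr h1
      have h4 : x l - X - (x e - X) ≠ 0 := by
        intro h; exact h3 (by linarith)
      rw [div_eq_div_iff h4 h3]
      have : c' = c + a * X - b * X := by linarith
      rw [this]; ring)
  rwa [Finset.card_image_of_injOn, Finset.card_image_of_injOn] at h
  · intro p hp q hq h; exact hxL hp hq (by simpa using h)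
  · intro p hp q hq h; exact hxE hp hq (by simpa using h)

theorem slope_between (a b c c' X xe xl ye yl : ℝ) (hab : a < b) (hX : c + a * X = c' + b * X)
    (hye : ye = c + a * xe) (hyl : yl = c' + b * xl) (h : (xe - X) * (xl - X) < 0) :
    xe ≠ xl ∧ a < (ye - yl) / (xe - xl) ∧ (ye - yl) / (xe - xl) < b := by
  have hne : xe ≠ xl := by rintro rfl; nlinarith [mul_self_nonneg (xe - X)]
  refine ⟨hne, ?_⟩
  have hc : c' = c + a * X - b * X := by linarith
  subst hye hyl hc
  rcases lt_or_gt_of_ne hne with h1 | h1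
  · have h2 : xe < X := by by_contra hc; push Not at hc; nlinarith
    have h3 : X < xl := by by_contra hc; push Not at hc; nlinarith
    rw [lt_div_iff_of_neg (by linarith), div_lt_iff_of_neg (by linarith)]
    constructor <;> nlinarith
  · have h2 : X < xe := by by_contra hc; push Not at hc; nlinarith
    have h3 : xl < X := by by_contra hc; push Not at hc; nlinarith
    rw [lt_div_iff₀ (by linarith), div_lt_iff₀ (by linarith)]
    constructor <;> nlinarith

theorem slope_outside (a b c c' X xe xl ye yl : ℝ) (hab : a < b) (hX : c + a * X = c' + b * X)
    (hye : ye = c + a * xe) (hyl : yl = c' + b * xl) (h : 0 < (xe - X) * (xl - X)) (hne : xe ≠ xl) :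
    (ye - yl) / (xe - xl) < a ∨ b < (ye - yl) / (xe - xl) := by
  have hc : c' = c + a * X - b * X := by linarith
  subst hye hyl hc
  by_contra hcon
  push Not at hcon
  obtain ⟨h1, h2⟩ := hcon
  rcases lt_or_gt_of_ne hne with h3 | h3
  · rw [le_div_iff_of_neg (by linarith)] at h1
    rw [div_le_iff_of_neg (by linarith)] at h2
    have h4 : 0 ≤ (b - a) * (xl - X) := by linarith
    have h5 : 0 ≤ (b - a) * (X - xe) := by linarith
    have h6 : 0 ≤ xl - X := by by_contra hc; push Not at hc; nlinarith
    have h7 : 0 ≤ X - xe := by by_contra hc; push Not at hc; nlinarith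
    nlinarith
  · rw [le_div_iff₀ (by linarith)] at h1
    rw [div_le_iff₀ (by linarith)] at h2
    have h4 : 0 ≤ (b - a) * (X - xl) := by linarith
    have h5 : 0 ≤ (b - a) * (xe - X) := by linarith
    have h6 : 0 ≤ X - xl := by by_contra hc; push Not at hc; nlinarith
    have h7 : 0 ≤ xe - X := by by_contra hc; push Not at hc; nlinarith
    nlinarith

theorem ungar_even {ι : Type*} [DecidableEq ι] (A : Finset ι) (x y : ι → ℝ) (hx : Set.InjOn x A) (h : ℕ)
    (hcard : A.card = 2 * h) (hnc : ∀ a c : ℝ, ∃ p ∈ A, y p ≠ c + a * x p) (Sl : Finset ℝ)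
    (hSl : ∀ p ∈ A, ∀ q ∈ A, p ≠ q → (y p - y q) / (x p - x q) ∈ Sl) : 2 * h ≤ Sl.card := by
  obtain ⟨t, s, hts, hmemS⟩ := exists_samples Sl
  set k := Sl.card with hk
  have smono : ∀ j ≤ k, ∀ i ≤ j, s i ≤ s j := by
    intro j
    induction j with
    | zero => intro _ i hi; rw [Nat.le_zero.mp hi]
    | succ j ih =>
      intro hj i hi
      rcases Nat.lt_or_ge i (j+1) with h1 | h1
      · have := hts j (by omega)
        have := ih (by omega) i (by omega)
        linarith
      · have : i = j+1 := by omega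
        rw [this]
  have tmono : ∀ i j, i < j → j < k → t i < t j := by
    intro i j hij hj
    have h1 := hts i (by omega)
    have h2 := hts j hj
    have h3 := smono j (by omega) (i+1) (by omega)
    linarith
  -- no slope strictly inside, other than t i
  have huniq : ∀ σ ∈ Sl, ∀ i < k, s i < σ → σ < s (i+1) → σ = t i := by
    intro σ hσ i hi h1 h2
    obtain ⟨m, hm, rfl⟩ := (hmemS σ).mp hσ
    rcases lt_trichotomy m i with h3 | h3 | h3
    · have := smono i (by omega) (m+1) (by omega)
      have := hts m hm; linarith
    · rw [h3]
    · have := smono m (by omega) (i+1) (by omega)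
      have := hts m hm; linarith
  have hns : ∀ σ ∈ Sl, ∀ i ≤ k, σ ≠ s i := by
    intro σ hσ i hi he
    obtain ⟨m, hm, rfl⟩ := (hmemS σ).mp hσ
    have h4 := hts m hm
    rcases Nat.lt_or_ge m i with h3 | h3
    · have := smono i (by omega) (m+1) (by omega); linarith
    · have := smono m (by omega) i h3; linarith
  have hfid : ∀ p ∈ A, ∀ q ∈ A, p ≠ q → ∃ σ ∈ Sl, x p - x q ≠ 0 ∧
      ∀ τ, (y p - τ * x p) - (y q - τ * x q) = (σ - τ) * (x p - x q) := by
    intro p hp q hq hpq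
    have hne : x p - x q ≠ 0 := sub_ne_zero.mpr (fun he => hpq (hx hp hq he))
    refine ⟨_, hSl p hp q hq hpq, hne, fun τ => ?_⟩
    field_simp
    ring
  have hUex : ∀ i, ∃ U ⊆ A, i ≤ k → U.card = h ∧ ∀ p ∈ U, ∀ q ∈ A, q ∉ U → y q - s i * x q < y p - s i * x p := by
    intro i
    by_cases hi : i ≤ k
    · obtain ⟨U, h1, h2, h3⟩ := exists_top A (fun p => y p - s i * x p) (by
        intro p hp q hq he
        by_contra hpq
        obtain ⟨σ, hσ, hne, hf⟩ := hfid p hp q hq hpq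
        have h1 := hf (s i)
        simp only at he
        rw [he, sub_self] at h1
        rcases mul_eq_zero.mp h1.symm with h2 | h2
        · exact hns σ hσ i hi (by linarith)
        · exact hne h2) h (by omega)
      exact ⟨U, h1, fun _ => ⟨h2, h3⟩⟩
    · exact ⟨∅, by simp, fun h => absurd h hi⟩
  choose U hUA hU using hUex
  set d : ℕ → ℕ := fun i => (U i \ U (i+1)).card with hd
  have hdp : ∀ i < k, (U (i+1) \ U i).card = d i := by
    intro i hi
    have h1 := (hU i (by omega)).1
    have h2 := (hU (i+1) (by omega)).1
    simp only [hd]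
    have e1 := Finset.card_sdiff_add_card_inter (U (i+1)) (U i)
    have e2 := Finset.card_sdiff_add_card_inter (U i) (U (i+1))
    rw [Finset.inter_comm] at e1
    omega
  have heq0 : ∀ i < k, d i = 0 → U i = U (i+1) := by
    intro i hi h0
    have h1 := hdp i hi
    rw [h0] at h1
    simp only [hd] at h0
    rw [Finset.card_eq_zero, Finset.sdiff_eq_empty_iff_subset] at h0 h1
    exact Finset.Subset.antisymm h0 h1
  have heqr : ∀ i j, i ≤ j → j ≤ k → (∀ m, i ≤ m → m < j → d m = 0) → U i = U j := by
    intro i j hij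
    induction j, hij using Nat.le_induction with
    | base => intro _ _; rfl
    | succ j hij ih =>
      intro hj hm
      rw [ih (by omega) (fun m h1 h2 => hm m h1 (by omega))]
      exact heq0 j (by omega) (hm j hij (by omega))
  -- weak threshold facts
  have hF2a : ∀ i < k, ∀ p ∈ U (i+1), ∀ q ∈ A, q ∉ U (i+1) → y q - t i * x q ≤ y p - t i * x p := by
    intro i hi p hp q hq hqU
    have h1 := (hU (i+1) (by omega)).2 p hp q hq hqU
    by_contra hcon
    push Not at hcon
    have hpq : p ≠ q := by rintro rfl; exact hqU hp
    obtain ⟨σ, hσ, hne, hf⟩ := hfid p (hUA _ hp) q hq hpq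
    have e1 := hf (t i)
    have e2 := hf (s (i+1))
    have h3 := hts i hi
    have hlt : t i < σ ∧ σ < s (i+1) := by
      rcases lt_or_gt_of_ne hne with h4 | h4
      · constructor <;> by_contra hc <;> push Not at hc <;> nlinarith
      · constructor <;> by_contra hc <;> push Not at hc <;> nlinarith
    have := huniq σ hσ i hi (by linarith) hlt.2
    linarith
  have hF2b : ∀ i < k, ∀ p ∈ U i, ∀ q ∈ A, q ∉ U i → y q - t i * x q ≤ y p - t i * x p := by
    intro i hi p hp q hq hqU
    have h1 := (hU i (by omega)).2 p hp q hq hqU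
    by_contra hcon
    push Not at hcon
    have hpq : p ≠ q := by rintro rfl; exact hqU hp
    obtain ⟨σ, hσ, hne, hf⟩ := hfid p (hUA _ hp) q hq hpq
    have e1 := hf (t i)
    have e2 := hf (s i)
    have h3 := hts i hi
    have hlt : s i < σ ∧ σ < t i := by
      rcases lt_or_gt_of_ne hne with h4 | h4
      · constructor <;> by_contra hc <;> push Not at hc <;> nlinarith
      · constructor <;> by_contra hc <;> push Not at hc <;> nlinarith
    have := huniq σ hσ i hi hlt.1 (by linarith)
    linarith
  -- the crossing line
  have hline : ∀ i < k, 0 < d i → ∃ c, (∀ p ∈ U i \ U (i+1), y p = c + t i * x p) ∧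
      (∀ p ∈ U (i+1) \ U i, y p = c + t i * x p) ∧ (U i \ U (i+1)).Nonempty ∧ (U (i+1) \ U i).Nonempty := by
    intro i hi hdi
    have hn1 : (U i \ U (i+1)).Nonempty := Finset.card_pos.mp hdi
    have hn2 : (U (i+1) \ U i).Nonempty := Finset.card_pos.mp (by rw [hdp i hi]; exact hdi)
    have hpq : ∀ p ∈ U i \ U (i+1), ∀ q ∈ U (i+1) \ U i, y p - t i * x p = y q - t i * x q := by
      intro p hp q hq
      rw [Finset.mem_sdiff] at hp hq
      exact le_antisymm (hF2a i hi q hq.1 p (hUA _ hp.1) hp.2) (hF2b i hi p hp.1 q (hUA _ hq.1) hq.2)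
    obtain ⟨p0, hp0⟩ := hn1
    obtain ⟨q0, hq0⟩ := hn2
    refine ⟨y q0 - t i * x q0, ?_, ?_, ⟨p0, hp0⟩, ⟨q0, hq0⟩⟩
    · intro p hp; have := hpq p hp q0 hq0; linarith
    · intro q hq; have := hpq p0 hp0 q hq; have := hpq p0 hp0 q0 hq0; linarith
  have hUk : ∀ p ∈ A, (p ∈ U k ↔ p ∉ U 0) := by
    have c0 := hU 0 (by omega)
    have ck := hU k le_rfl
    have hsign : ∀ p ∈ U k, ∀ q ∈ A, q ∉ U k → p ∈ U 0 → q ∉ U 0 → False := by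
      intro p hp q hq hqk hp0 hq0
      have h1 := c0.2 p hp0 q hq hq0
      have h2 := ck.2 p hp q hq hqk
      have hpq : p ≠ q := by rintro rfl; exact hqk hp
      obtain ⟨σ, hσ, hne, hf⟩ := hfid p (hUA _ hp) q hq hpq
      have e1 := hf (s 0)
      have e2 := hf (s k)
      obtain ⟨m, hm, hmσ⟩ := (hmemS σ).mp hσ
      have h3 := hts m hm
      have h4 := smono m (by omega) 0 (by omega)
      have h5 := smono k (by omega) (m+1) (by omega)
      rcases lt_or_gt_of_ne hne with h6 | h6 <;> nlinarith
    have hdisj : Disjoint (U k) (U 0) := by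
      rw [Finset.disjoint_left]
      intro p hpk hp0
      have hlt : (U k ∪ U 0).card < A.card := by
        have := Finset.card_union_add_card_inter (U k) (U 0)
        have h2 : 0 < (U k ∩ U 0).card := Finset.card_pos.mpr ⟨p, Finset.mem_inter.mpr ⟨hpk, hp0⟩⟩
        rw [c0.1, ck.1] at this
        omega
      obtain ⟨q, hq, hqn⟩ := Finset.exists_mem_notMem_of_card_lt_card hlt
      rw [Finset.mem_union, not_or] at hqn
      exact hsign p hpk q hq hqn.1 hp0 hqn.2
    have hun : U k ∪ U 0 = A := by
      apply Finset.eq_of_subset_of_card_le (Finset.union_subset (hUA _) (hUA _))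
      rw [Finset.card_union_of_disjoint hdisj, c0.1, ck.1]; omega
    intro p hp
    constructor
    · intro h1 h2; exact Finset.disjoint_left.mp hdisj h1 h2
    · intro h1
      rw [← hun, Finset.mem_union] at hp
      tauto
  have hXex : ∀ a b c c' : ℝ, a < b → ∃ X, c + a * X = c' + b * X := by
    intro a b c c' hab
    refine ⟨(c - c')/(b-a), ?_⟩
    have : b - a ≠ 0 := by linarith
    field_simp; ring
  have hh : 0 < h := by
    obtain ⟨p, hp, -⟩ := hnc 0 0
    have := Finset.card_pos.mpr ⟨p, hp⟩; omega
  have hinjU : ∀ i j, Set.InjOn x ((U i \ U j : Finset ι) : Set ι) := fun i j p hp q hq he =>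
    hx (hUA _ (Finset.mem_sdiff.mp hp).1) (hUA _ (Finset.mem_sdiff.mp hq).1) he
  have hSlmem : ∀ p ∈ A, ∀ q ∈ A, x p ≠ x q → (y p - y q) / (x p - x q) ∈ Sl := fun p hp q hq hne =>
    hSl p hp q hq (fun he => hne (by rw [he]))
  apply ungar_arith d k h
  · -- consecutive crossings
    intro i i' hii hi'k hdi hdi' hz
    obtain ⟨c, hm, hp, hmn, hpn⟩ := hline i (by omega) hdi
    obtain ⟨c', hm', hp', hmn', hpn'⟩ := hline i' hi'k hdi'
    have hab := tmono i i' hii hi'k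
    obtain ⟨X, hX⟩ := hXex (t i) (t i') c c' hab
    have hUU : U (i+1) = U i' := heqr (i+1) i' hii (by omega) (fun m h1 h2 => hz m (by omega) h2)
    have hSg : (Sl.filter (fun σ => t i < σ ∧ σ < t i')).card ≤ i' - i - 1 := by
      have : Sl.filter (fun σ => t i < σ ∧ σ < t i') ⊆ (Finset.Ioo i i').image t := by
        intro σ hσ
        rw [Finset.mem_filter, hmemS] at hσ
        obtain ⟨⟨m, hmk, rfl⟩, h1, h2⟩ := hσ
        refine Finset.mem_image.mpr ⟨m, Finset.mem_Ioo.mpr ⟨?_, ?_⟩, rfl⟩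
        · by_contra hc; push Not at hc
          rcases Nat.lt_or_ge m i with h3 | h3
          · have := tmono m i h3 (by omega); linarith
          · have : m = i := by omega
            rw [this] at h1; linarith
        · by_contra hc; push Not at hc
          rcases Nat.lt_or_ge i' m with h3 | h3
          · have := tmono i' m h3 hmk; linarith
          · have : m = i' := by omega
            rw [this] at h2; linarith
      refine (Finset.card_le_card this).trans (Finset.card_image_le.trans ?_)
      rw [Nat.card_Ioo]
    obtain ⟨pm, hpm⟩ := hmn
    obtain ⟨pp, hpp⟩ := hpn
    obtain ⟨pm', hpm'⟩ := hmn'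
    obtain ⟨pp', hpp'⟩ := hpn'
    have key : d i + d i' ≤ (Sl.filter (fun σ => t i < σ ∧ σ < t i')).card + 1 := by
      by_cases hzU : ∃ p ∈ U i', x p = X ∧ y p = c + t i * X
      · obtain ⟨p, hpU, hpx, hpy⟩ := hzU
        rw [← hdp i' hi'k]
        have sE : ∀ e ∈ U i \ U (i+1), 0 < x e - X := by
          intro e he
          have h1 := hm e he
          rw [Finset.mem_sdiff] at he
          have h2 := hF2b i' hi'k pm' (Finset.mem_sdiff.mp hpm').1 e (hUA _ he.1) (hUU ▸ he.2)
          have h3 := hm' pm' hpm'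
          have h4 : 0 ≤ x e - X := by by_contra hc; push Not at hc; nlinarith
          refine lt_of_le_of_ne h4 fun h5 => ?_
          have : p = e := hx (hUA _ hpU) (hUA _ he.1) (by linarith)
          exact he.2 (hUU ▸ this ▸ hpU)
        have sL : ∀ l ∈ U (i'+1) \ U i', x l - X < 0 := by
          intro l hl
          have h1 := hp' l hl
          rw [Finset.mem_sdiff] at hl
          have h2 := hF2a i (by omega) pp (Finset.mem_sdiff.mp hpp).1 l (hUA _ hl.1) (hUU.symm ▸ hl.2)
          have h3 := hp pp hpp
          have h4 : x l - X ≤ 0 := by by_contra hc; push Not at hc; nlinarith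
          refine lt_of_le_of_ne h4 fun h5 => ?_
          have : p = l := hx (hUA _ hpU) (hUA _ hl.1) (by linarith)
          exact hl.2 (this ▸ hpU)
        refine ungar_core x y (t i) (t i') c c' X (-1) hab (Or.inr rfl) hX _ _ ⟨pm, hpm⟩ ⟨pp', hpp'⟩ _
          (hinjU _ _) (hinjU _ _) hm hp' (fun e he l hl => ?_) (fun e he l hl => ?_)
        · have := mul_neg_of_pos_of_neg (sE e he) (sL l hl); linarith
        · have h1 := slope_between _ _ _ _ X _ _ _ _ hab hX (hm e he) (hp' l hl) (mul_neg_of_pos_of_neg (sE e he) (sL l hl))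
          exact ⟨h1.1, Finset.mem_filter.mpr ⟨hSlmem e (hUA _ (Finset.mem_sdiff.mp he).1) l (hUA _ (Finset.mem_sdiff.mp hl).1) h1.1, h1.2⟩⟩
      · push Not at hzU
        rw [← hdp i (by omega)]
        have sE : ∀ e ∈ U (i+1) \ U i, x e - X < 0 := by
          intro e he
          have h1 := hp e he
          rw [Finset.mem_sdiff] at he
          have h2 := hF2b i' hi'k e (hUU ▸ he.1) pp' (hUA _ (Finset.mem_sdiff.mp hpp').1) (Finset.mem_sdiff.mp hpp').2
          have h3 := hp' pp' hpp'
          have h4 : x e - X ≤ 0 := by by_contra hc; push Not at hc; nlinarith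
          refine lt_of_le_of_ne h4 fun h5 => ?_
          have hxe : x e = X := by linarith
          exact hzU e (hUU ▸ he.1) hxe (by rw [h1, hxe])
        have sL : ∀ l ∈ U i' \ U (i'+1), 0 < x l - X := by
          intro l hl
          have h1 := hm' l hl
          rw [Finset.mem_sdiff] at hl
          have h2 := hF2a i (by omega) l (hUU.symm ▸ hl.1) pm (hUA _ (Finset.mem_sdiff.mp hpm).1) (Finset.mem_sdiff.mp hpm).2
          have h3 := hm pm hpm
          have h4 : 0 ≤ x l - X := by by_contra hc; push Not at hc; nlinarith
          refine lt_of_le_of_ne h4 fun h5 => ?_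
          have hxe : x l = X := by linarith
          exact hzU l hl.1 hxe (by rw [h1, hxe, hX])
        refine ungar_core x y (t i) (t i') c c' X (-1) hab (Or.inr rfl) hX _ _ ⟨pp, hpp⟩ ⟨pm', hpm'⟩ _
          (hinjU _ _) (hinjU _ _) hp hm' (fun e he l hl => ?_) (fun e he l hl => ?_)
        · have := mul_neg_of_neg_of_pos (sE e he) (sL l hl); linarith
        · have h1 := slope_between _ _ _ _ X _ _ _ _ hab hX (hp e he) (hm' l hl) (mul_neg_of_neg_of_pos (sE e he) (sL l hl))
          exact ⟨h1.1, Finset.mem_filter.mpr ⟨hSlmem e (hUA _ (Finset.mem_sdiff.mp he).1) l (hUA _ (Finset.mem_sdiff.mp hl).1) h1.1, h1.2⟩⟩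
    omega
  · -- wrap
    intro i i' hii hi'k hdi hdi' hz0 hzk
    obtain ⟨c, hm, hp, hmn, hpn⟩ := hline i (by omega) hdi
    obtain ⟨c', hm', hp', hmn', hpn'⟩ := hline i' hi'k hdi'
    have hab := tmono i i' hii hi'k
    obtain ⟨X, hX⟩ := hXex (t i) (t i') c c' hab
    have hU0 : U 0 = U i := heqr 0 i (by omega) (by omega) (fun m h1 h2 => hz0 m h2)
    have hUk' : U (i'+1) = U k := heqr (i'+1) k (by omega) le_rfl (fun m h1 h2 => hzk m (by omega) h2)
    have hcomp : ∀ p ∈ A, (p ∈ U (i'+1) ↔ p ∉ U i) := by rw [hUk', ← hU0]; exact hUk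
    have hSg : (Sl.filter (fun σ => σ < t i ∨ t i' < σ)).card + (i' - i + 1) ≤ k := by
      have : Sl.filter (fun σ => σ < t i ∨ t i' < σ) ⊆ (Finset.range k \ Finset.Icc i i').image t := by
        intro σ hσ
        rw [Finset.mem_filter, hmemS] at hσ
        obtain ⟨⟨m, hmk, rfl⟩, h1⟩ := hσ
        refine Finset.mem_image.mpr ⟨m, Finset.mem_sdiff.mpr ⟨Finset.mem_range.mpr hmk, ?_⟩, rfl⟩
        rw [Finset.mem_Icc]
        rintro ⟨h2, h3⟩
        rcases h1 with h1 | h1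
        · rcases Nat.lt_or_ge i m with h4 | h4
          · have := tmono i m h4 (by omega); linarith
          · have : m = i := by omega
            rw [this] at h1; linarith
        · rcases Nat.lt_or_ge m i' with h4 | h4
          · have := tmono m i' h4 (by omega); linarith
          · have : m = i' := by omega
            rw [this] at h1; linarith
      have h2 := (Finset.card_le_card this).trans Finset.card_image_le
      rw [Finset.card_sdiff_of_subset (by intro m hm; rw [Finset.mem_Icc] at hm; rw [Finset.mem_range]; omega),
        Finset.card_range, Nat.card_Icc] at h2
      omega
    obtain ⟨pm, hpm⟩ := hmn
    obtain ⟨pp, hpp⟩ := hpn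
    obtain ⟨pm', hpm'⟩ := hmn'
    obtain ⟨pp', hpp'⟩ := hpn'
    have key : d i + d i' ≤ (Sl.filter (fun σ => σ < t i ∨ t i' < σ)).card + 1 := by
      have hneq : ∀ xe xl : ℝ, ∀ e ∈ A, ∀ l ∈ A, y e = c + t i * x e → y l = c' + t i' * x l → x e - X ≠ 0 → x e ≠ x l := by
        intro _ _ e he l hl h1 h2 h3 h4
        have h5 : e = l := hx he hl h4
        subst h5
        apply h3
        have h6 : (t i' - t i) * (x e - X) = 0 := by linarith
        exact (mul_eq_zero.mp h6).resolve_left (by linarith)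
      by_cases hzU : ∃ p ∈ U (i'+1), x p = X ∧ y p = c + t i * X
      · obtain ⟨p, hpU, hpx, hpy⟩ := hzU
        have sE : ∀ e ∈ U i \ U (i+1), 0 < x e - X := by
          intro e he
          have h1 := hm e he
          rw [Finset.mem_sdiff] at he
          have hnk : e ∉ U (i'+1) := fun h => (hcomp e (hUA _ he.1)).mp h he.1
          have h2 := hF2a i' hi'k pp' (Finset.mem_sdiff.mp hpp').1 e (hUA _ he.1) hnk
          have h3 := hp' pp' hpp'
          have h4 : 0 ≤ x e - X := by by_contra hc; push Not at hc; nlinarith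
          refine lt_of_le_of_ne h4 fun h5 => ?_
          have : p = e := hx (hUA _ hpU) (hUA _ he.1) (by linarith)
          exact hnk (this ▸ hpU)
        have sL : ∀ l ∈ U i' \ U (i'+1), 0 < x l - X := by
          intro l hl
          have h1 := hm' l hl
          rw [Finset.mem_sdiff] at hl
          have hl0 : l ∈ U i := by by_contra hc; exact hl.2 ((hcomp l (hUA _ hl.1)).mpr hc)
          have h2 := hF2b i (by omega) l hl0 pp (hUA _ (Finset.mem_sdiff.mp hpp).1) (Finset.mem_sdiff.mp hpp).2
          have h3 := hp pp hpp
          have h4 : 0 ≤ x l - X := by by_contra hc; push Not at hc; nlinarith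
          refine lt_of_le_of_ne h4 fun h5 => ?_
          have : p = l := hx (hUA _ hpU) (hUA _ hl.1) (by linarith)
          exact hl.2 (this ▸ hpU)
        refine ungar_core x y (t i) (t i') c c' X 1 hab (Or.inl rfl) hX _ _ ⟨pm, hpm⟩ ⟨pm', hpm'⟩ _
          (hinjU _ _) (hinjU _ _) hm hm' (fun e he l hl => ?_) (fun e he l hl => ?_)
        · have := mul_pos (sE e he) (sL l hl); linarith
        · have heA := hUA _ (Finset.mem_sdiff.mp he).1
          have hlA := hUA _ (Finset.mem_sdiff.mp hl).1
          have hne := hneq 0 0 e heA l hlA (hm e he) (hm' l hl) (sE e he).ne'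
          have h1 := slope_outside _ _ _ _ X _ _ _ _ hab hX (hm e he) (hm' l hl) (mul_pos (sE e he) (sL l hl)) hne
          exact ⟨hne, Finset.mem_filter.mpr ⟨hSlmem e heA l hlA hne, h1⟩⟩
      · push Not at hzU
        rw [← hdp i (by omega), ← hdp i' hi'k]
        have sE : ∀ e ∈ U (i+1) \ U i, x e - X < 0 := by
          intro e he
          have h1 := hp e he
          rw [Finset.mem_sdiff] at he
          have hek := (hcomp e (hUA _ he.1)).mpr he.2
          have h2 := hF2a i' hi'k e hek pm' (hUA _ (Finset.mem_sdiff.mp hpm').1) (Finset.mem_sdiff.mp hpm').2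
          have h3 := hm' pm' hpm'
          have h4 : x e - X ≤ 0 := by by_contra hc; push Not at hc; nlinarith
          refine lt_of_le_of_ne h4 fun h5 => ?_
          have hxe : x e = X := by linarith
          exact hzU e hek hxe (by rw [h1, hxe])
        have sL : ∀ l ∈ U (i'+1) \ U i', x l - X < 0 := by
          intro l hl
          have h1 := hp' l hl
          rw [Finset.mem_sdiff] at hl
          have hl0 := (hcomp l (hUA _ hl.1)).mp hl.1
          have h2 := hF2b i (by omega) pm (Finset.mem_sdiff.mp hpm).1 l (hUA _ hl.1) hl0
          have h3 := hm pm hpm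
          have h4 : x l - X ≤ 0 := by by_contra hc; push Not at hc; nlinarith
          refine lt_of_le_of_ne h4 fun h5 => ?_
          have hxe : x l = X := by linarith
          exact hzU l hl.1 hxe (by rw [h1, hxe, hX])
        refine ungar_core x y (t i) (t i') c c' X 1 hab (Or.inl rfl) hX _ _ ⟨pp, hpp⟩ ⟨pp', hpp'⟩ _
          (hinjU _ _) (hinjU _ _) hp hp' (fun e he l hl => ?_) (fun e he l hl => ?_)
        · have := mul_pos_of_neg_of_neg (sE e he) (sL l hl); linarith
        · have heA := hUA _ (Finset.mem_sdiff.mp he).1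
          have hlA := hUA _ (Finset.mem_sdiff.mp hl).1
          have hne := hneq 0 0 e heA l hlA (hp e he) (hp' l hl) (sE e he).ne
          have h1 := slope_outside _ _ _ _ X _ _ _ _ hab hX (hp e he) (hp' l hl) (mul_pos_of_neg_of_neg (sE e he) (sL l hl)) hne
          exact ⟨hne, Finset.mem_filter.mpr ⟨hSlmem e heA l hlA hne, h1⟩⟩
    omega
  · -- total
    have hsub : U 0 ⊆ (Finset.range k).biUnion (fun i => U i \ U (i+1)) := by
      intro p hp
      by_contra hcon
      have hall : ∀ j ≤ k, p ∈ U j := by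
        intro j
        induction j with
        | zero => intro _; exact hp
        | succ j ih =>
          intro hj
          by_contra hn
          exact hcon (Finset.mem_biUnion.mpr ⟨j, Finset.mem_range.mpr (by omega), Finset.mem_sdiff.mpr ⟨ih (by omega), hn⟩⟩)
      exact (hUk p (hUA _ hp)).mp (hall k le_rfl) hp
    have := (Finset.card_le_card hsub).trans Finset.card_biUnion_le
    rw [(hU 0 (by omega)).1] at this
    exact this
  · -- two crossings
    by_contra hcon
    push Not at hcon
    have hex : ∃ i < k, 0 < d i := by
      by_contra hc
      push Not at hc
      have h1 : U 0 = U k := heqr 0 k (by omega) le_rfl (fun m _ h2 => Nat.le_zero.mp (hc m h2))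
      have hc0 := (hU 0 (by omega)).1
      obtain ⟨p, hp⟩ := Finset.card_pos.mp (by rw [hc0]; exact hh : 0 < (U 0).card)
      exact (hUk p (hUA _ hp)).mp (h1 ▸ hp) hp
    obtain ⟨i, hi, hdi⟩ := hex
    have h0 : U 0 = U i := heqr 0 i (by omega) (by omega) (fun m _ h2 => by
      by_contra hne
      have := hcon m i h2 hi (by omega); omega)
    have h1 : U (i+1) = U k := heqr (i+1) k (by omega) le_rfl (fun m h1 h2 => by
      by_contra hne
      have := hcon i m (by omega) h2 hdi; omega)
    obtain ⟨c, hm, hp, -, -⟩ := hline i hi hdi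
    obtain ⟨p, hpA, hpy⟩ := hnc (t i) c
    apply hpy
    by_cases hpU : p ∈ U 0
    · apply hm
      rw [Finset.mem_sdiff, ← h0, h1]
      exact ⟨hpU, fun h => (hUk p hpA).mp h hpU⟩
    · apply hp
      rw [Finset.mem_sdiff, ← h0, h1]
      exact ⟨(hUk p hpA).mpr hpU, hpU⟩

theorem ungar {ι : Type*} [DecidableEq ι] (A : Finset ι) (x y : ι → ℝ) (hx : Set.InjOn x A)
    (hnc : ∀ a c : ℝ, ∃ p ∈ A, y p ≠ c + a * x p) (Sl : Finset ℝ)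
    (hSl : ∀ p ∈ A, ∀ q ∈ A, p ≠ q → (y p - y q) / (x p - x q) ∈ Sl) : A.card ≤ Sl.card + 1 := by
  rcases Nat.even_or_odd' A.card with ⟨h, hh | hh⟩
  · have := ungar_even A x y hx h hh hnc Sl hSl; omega
  · -- odd: find a noncollinear triple
    obtain ⟨p0, hp0, -⟩ := hnc 0 0
    obtain ⟨p1, hp1, h1⟩ := hnc 0 (y p0)
    have hp01 : p1 ≠ p0 := by rintro rfl; simp at h1
    have hx01 : x p1 - x p0 ≠ 0 := sub_ne_zero.mpr fun he => hp01 (hx hp1 hp0 he)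
    set a := (y p1 - y p0) / (x p1 - x p0) with ha
    obtain ⟨p2, hp2, h2⟩ := hnc a (y p0 - a * x p0)
    have hp02 : p2 ≠ p0 := by rintro rfl; apply h2; ring
    have hp12 : p2 ≠ p1 := by
      rintro rfl; apply h2
      have : a * (x p2 - x p0) = y p2 - y p0 := by rw [ha]; field_simp
      linarith
    by_cases h3 : A.card ≤ 3
    · have hm1 := hSl p1 hp1 p0 hp0 hp01
      have hm2 := hSl p2 hp2 p0 hp0 hp02
      have hx02 : x p2 - x p0 ≠ 0 := sub_ne_zero.mpr fun he => hp02 (hx hp2 hp0 he)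
      have hne : a ≠ (y p2 - y p0) / (x p2 - x p0) := by
        intro he
        apply h2
        have : a * (x p2 - x p0) = y p2 - y p0 := by rw [he]; field_simp
        linarith
      have : 1 < Sl.card := Finset.one_lt_card.mpr ⟨_, hm1, _, hm2, hne⟩
      omega
    · have hlt : ({p0, p1, p2} : Finset ι).card < A.card :=
        lt_of_le_of_lt Finset.card_le_three (by omega)
      obtain ⟨r, hr, hrn⟩ := Finset.exists_mem_notMem_of_card_lt_card hlt
      simp only [Finset.mem_insert, Finset.mem_singleton, not_or] at hrn
      have := ungar_even (A.erase r) x y (hx.mono (by simp)) h (by rw [Finset.card_erase_of_mem hr]; omega) (by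
        intro a' c'
        by_contra hcon
        push Not at hcon
        have e0 := hcon p0 (Finset.mem_erase.mpr ⟨Ne.symm hrn.1, hp0⟩)
        have e1 := hcon p1 (Finset.mem_erase.mpr ⟨Ne.symm hrn.2.1, hp1⟩)
        have e2 := hcon p2 (Finset.mem_erase.mpr ⟨Ne.symm hrn.2.2, hp2⟩)
        apply h2
        have : a = a' := by rw [ha, e0, e1]; field_simp; ring
        rw [this, e0, e2]; ring) Sl (fun p hp q hq => hSl p (Finset.mem_erase.mp hp).2 q (Finset.mem_erase.mp hq).2)
      omega
end

section
theorem NormOn3.upper (N : NormOn3) : ∃ C : ℝ, 0 < C ∧ ∀ w, N.1 w ≤ C * ‖w‖ := by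
  refine ⟨∑ i, N.1 (EuclideanSpace.single i (1:ℝ)) + 1, by positivity, fun w => ?_⟩
  have hw : w = ∑ i, w i • EuclideanSpace.single i (1:ℝ) := by
    ext j
    simp [Fin.sum_univ_three]
    fin_cases j <;> simp
  have h1 : N.1 w ≤ ∑ i, |w i| * N.1 (EuclideanSpace.single i (1:ℝ)) := by
    conv_lhs => rw [hw]
    refine (Finset.le_sum_of_subadditive N.1 ?_ ?_ _ _).trans ?_
    · exact (map_zero N.1).le
    · exact fun a b => map_add_le_add _ a b
    · apply Finset.sum_le_sum
      intro i _
      rw [map_smul_eq_mul, Real.norm_eq_abs]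
  have h2 : ∀ i, |w i| ≤ ‖w‖ := fun i => by
    have := PiLp.norm_apply_le w i
    simpa using this
  calc N.1 w ≤ _ := h1
    _ ≤ ∑ i, ‖w‖ * N.1 (EuclideanSpace.single i (1:ℝ)) := by
        apply Finset.sum_le_sum; intro i _
        exact mul_le_mul_of_nonneg_right (h2 i) (apply_nonneg _ _)
    _ ≤ _ := by rw [← Finset.mul_sum]; nlinarith [norm_nonneg w]

theorem NormOn3.cont (N : NormOn3) : Continuous N.1 := by
  obtain ⟨C, hC, h⟩ := N.upper
  have : LipschitzWith ⟨C, hC.le⟩ N.1 := by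
    apply LipschitzWith.of_dist_le_mul
    intro x y
    rw [dist_eq_norm, Real.norm_eq_abs]
    refine (abs_sub_map_le_sub N.1 x y).trans ?_
    rw [dist_eq_norm]; exact h _
  exact this.continuous

theorem NormOn3.pos (N : NormOn3) {w : E3} (hw : w ≠ 0) : 0 < N.1 w :=
  lt_of_le_of_ne (apply_nonneg _ _) (fun h => hw (N.2 w h.symm))

theorem NormOn3.lower (N : NormOn3) : ∃ c : ℝ, 0 < c ∧ ∀ w, c * ‖w‖ ≤ N.1 w := by
  obtain ⟨w0, hw0, hmin⟩ := (isCompact_sphere (0:E3) 1).exists_isMinOn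
    (NormedSpace.sphere_nonempty.mpr zero_le_one) N.cont.continuousOn
  have hw0' : ‖w0‖ = 1 := by simpa using hw0
  refine ⟨N.1 w0, N.pos (by rintro rfl; simp at hw0'), fun w => ?_⟩
  by_cases hw : w = 0
  · simp [hw]
  have hn : ‖w‖ ≠ 0 := norm_ne_zero_iff.mpr hw
  have h1 : N.1 w0 ≤ N.1 (‖w‖⁻¹ • w) := hmin (by simp [norm_smul, hn])
  rw [map_smul_eq_mul, norm_inv, norm_norm] at h1
  rw [inv_mul_eq_div, le_div_iff₀ (by positivity)] at h1
  exact h1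

/-- Nearby norms are uniformly close. -/
theorem NormOn3.near (N : NormOn3) (η : ℝ) (hη : 0 < η) : ∃ r : ENNReal, 0 < r ∧ ∀ M : NormOn3, edist N M < r →
    ∀ w, |M.1 w - N.1 w| ≤ η * ‖w‖ := by
  obtain ⟨C, hC, hNC⟩ := N.upper
  -- radius
  obtain ⟨r, hr, hr1, hr2⟩ : ∃ r : ℝ, 0 < r ∧ r * C ≤ 1/2 ∧ r * (4 * C * C) ≤ η := by
    refine ⟨min (1/(2*C)) (η/(4*C*C)), by positivity, ?_, ?_⟩
    · calc _ ≤ (1/(2*C)) * C := by gcongr; exact min_le_left _ _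
        _ = 1/2 := by field_simp
    · calc _ ≤ (η/(4*C*C)) * (4*C*C) := by gcongr; exact min_le_right _ _
        _ = η := by field_simp
  refine ⟨ENNReal.ofReal r, by simpa using hr, fun M hM => ?_⟩
  have hNM : ∀ w, N.1 w ≤ (1 + r * C) * M.1 w := by
    intro w
    by_cases hw : w = 0
    · simp [hw]
    have hp := M.pos hw
    have hwb : (M.1 w)⁻¹ • w ∈ M.unitBall := by
      show M.1 _ ≤ 1
      rw [map_smul_eq_mul, norm_inv, Real.norm_of_nonneg hp.le, inv_mul_cancel₀ hp.ne']
    obtain ⟨w', hw', hd⟩ := Metric.exists_edist_lt_of_hausdorffEDist_lt hwb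
      (show Metric.hausdorffEDist M.unitBall N.unitBall < _ from (by rw [Metric.hausdorffEDist_comm]; exact hM : Metric.hausdorffEDist M.unitBall N.unitBall < ENNReal.ofReal r))
    rw [edist_lt_ofReal, dist_eq_norm] at hd
    have h1 : N.1 ((M.1 w)⁻¹ • w) ≤ 1 + r * C := by
      have h2 : (M.1 w)⁻¹ • w = w' + ((M.1 w)⁻¹ • w - w') := by abel
      rw [h2]
      refine (map_add_le_add _ _ _).trans (add_le_add hw' ((hNC _).trans ?_))
      rw [mul_comm]; gcongr
    rw [map_smul_eq_mul, norm_inv, Real.norm_of_nonneg hp.le, inv_mul_eq_div, div_le_iff₀ hp] at h1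
    exact h1
  obtain ⟨w0, hw0, hmax⟩ := (isCompact_sphere (0:E3) 1).exists_isMaxOn
    (NormedSpace.sphere_nonempty.mpr zero_le_one) M.cont.continuousOn
  set S := M.1 w0 with hS
  have hw0' : ‖w0‖ = 1 := by simpa using hw0
  have hw00 : w0 ≠ 0 := by rintro rfl; simp at hw0'
  have hSb : ∀ w, M.1 w ≤ S * ‖w‖ := by
    intro w
    by_cases hw : w = 0
    · simp [hw]
    have hn : ‖w‖ ≠ 0 := norm_ne_zero_iff.mpr hw
    have h1 : M.1 (‖w‖⁻¹ • w) ≤ M.1 w0 := hmax (by simp [norm_smul, hn])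
    rw [map_smul_eq_mul, norm_inv, norm_norm] at h1
    rw [inv_mul_eq_div, div_le_iff₀ (by positivity)] at h1
    exact h1
  have hMN' : ∀ w, M.1 w ≤ (1 + r * S) * N.1 w := by
    intro w
    by_cases hw : w = 0
    · simp [hw]
    have hp := N.pos hw
    have hwb : (N.1 w)⁻¹ • w ∈ N.unitBall := by
      show N.1 _ ≤ 1
      rw [map_smul_eq_mul, norm_inv, Real.norm_of_nonneg hp.le, inv_mul_cancel₀ hp.ne']
    obtain ⟨w', hw', hd⟩ := Metric.exists_edist_lt_of_hausdorffEDist_lt hwb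
      (show Metric.hausdorffEDist N.unitBall M.unitBall < _ from hM)
    rw [edist_lt_ofReal, dist_eq_norm] at hd
    have hS0 : 0 ≤ S := apply_nonneg _ _
    have h1 : M.1 ((N.1 w)⁻¹ • w) ≤ 1 + r * S := by
      have h2 : (N.1 w)⁻¹ • w = w' + ((N.1 w)⁻¹ • w - w') := by abel
      rw [h2]
      refine (map_add_le_add _ _ _).trans (add_le_add hw' ((hSb _).trans ?_))
      rw [mul_comm]; gcongr
    rw [map_smul_eq_mul, norm_inv, Real.norm_of_nonneg hp.le, inv_mul_eq_div, div_le_iff₀ hp] at h1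
    exact h1
  have hS0 : 0 ≤ S := apply_nonneg _ _
  have hS2 : S ≤ 2 * C := by
    have h1 := hMN' w0
    have h2 := hNC w0
    rw [hw0', mul_one] at h2
    have h3 : S ≤ (1 + r * S) * C := h1.trans (by gcongr)
    nlinarith
  intro w
  have hn := norm_nonneg w
  have hC1 := hNC w
  have hM1 := hSb w
  have hM0 : 0 ≤ M.1 w := apply_nonneg _ _
  have hN0 : 0 ≤ N.1 w := apply_nonneg _ _
  have e1 := hNM w
  have e2 := hMN' w
  have hMw : M.1 w ≤ 2 * C * ‖w‖ := hM1.trans (by gcongr)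
  have k1 : r * C * M.1 w ≤ r * C * (2 * C * ‖w‖) := by gcongr
  have k2 : r * S * N.1 w ≤ r * (2 * C) * (C * ‖w‖) := by gcongr
  have k3 : r * (4 * C * C) * ‖w‖ ≤ η * ‖w‖ := by gcongr
  have k4 : 0 ≤ r * C * C * ‖w‖ := by positivity
  rw [abs_le]
  constructor <;> nlinarith

/-- Multiplicatively close norms are close in Hausdorff distance. -/
theorem NormOn3.near' (N : NormOn3) (r : ENNReal) (hr : 0 < r) : ∃ ε : ℝ, 0 < ε ∧ ∀ M : NormOn3,
    (∀ w, N.1 w ≤ M.1 w) → (∀ w, M.1 w ≤ (1 + ε) * N.1 w) → edist M N < r := by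
  obtain ⟨c, hc, hNc⟩ := N.lower
  obtain ⟨r', hr', hrr⟩ : ∃ r' : ℝ, 0 < r' ∧ ENNReal.ofReal r' < r := by
    obtain ⟨q, hq, hqr⟩ := ENNReal.lt_iff_exists_real_btwn.mp hr
    refine ⟨q, ?_, hqr.2⟩
    simpa using hqr.1
  refine ⟨r' * c, by positivity, fun M h1 h2 => lt_of_le_of_lt ?_ hrr⟩
  show Metric.hausdorffEDist M.unitBall N.unitBall ≤ _
  apply Metric.hausdorffEDist_le_of_mem_edist
  · intro x hx
    exact ⟨x, (h1 x).trans hx, by simp⟩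
  · intro x hx
    have hx' : N.1 x ≤ 1 := hx
    have hpos : 0 < 1 + r' * c := by positivity
    refine ⟨(1 + r' * c)⁻¹ • x, ?_, ?_⟩
    · show M.1 _ ≤ 1
      rw [map_smul_eq_mul, norm_inv, Real.norm_of_nonneg hpos.le, inv_mul_eq_div, div_le_one hpos]
      refine (h2 x).trans ?_
      nlinarith
    · rw [edist_dist]
      apply ENNReal.ofReal_le_ofReal
      rw [dist_eq_norm]
      have : x - (1 + r' * c)⁻¹ • x = (r' * c / (1 + r' * c)) • x := by
        have e : r' * c / (1 + r' * c) = 1 - (1 + r' * c)⁻¹ := by field_simp; ring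
        rw [e, sub_smul, one_smul]
      rw [this, norm_smul, Real.norm_of_nonneg (by positivity)]
      have h3 := hNc x
      rw [div_mul_eq_mul_div, div_le_iff₀ hpos]
      have : c * ‖x‖ ≤ 1 := h3.trans hx'
      have h5 : r' * (c * ‖x‖) ≤ r' * 1 := by gcongr
      have h6 : 0 ≤ r' * (r' * c) := by positivity
      linarith
end

section
open scoped Topology

theorem bad_closed {T k : ℕ} (v : Fin k → (Fin T → ℝ) → E3) (ρ : Fin k → (Fin T → ℝ) → ℝ)
    (hv : ∀ i, Continuous (v i)) (hρ : ∀ i, Continuous (ρ i)) (K : Set (Fin T → ℝ)) (hK : IsCompact K) :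
    IsClosed {N : NormOn3 | ∃ x ∈ K, ∀ i, N.1 (v i x) = ρ i x} := by
  rw [← isOpen_compl_iff, EMetric.isOpen_iff]
  intro N hN
  by_cases hKe : K.Nonempty
  swap
  · refine ⟨1, one_pos, fun M _ => ?_⟩
    rintro ⟨x, hx, -⟩
    exact hKe ⟨x, hx⟩
  have hcont : Continuous (fun x => ∑ i, |N.1 (v i x) - ρ i x|) := by
    have := N.cont
    fun_prop
  obtain ⟨x0, hx0, hmin⟩ := hK.exists_isMinOn hKe hcont.continuousOn
  set δ := ∑ i, |N.1 (v i x0) - ρ i x0| with hδ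
  have hδpos : 0 < δ := by
    rcases (Finset.sum_nonneg (fun i _ => abs_nonneg _) : 0 ≤ δ).lt_or_eq with h | h
    · exact h
    · exfalso; apply hN
      refine ⟨x0, hx0, fun i => ?_⟩
      have := (Finset.sum_eq_zero_iff_of_nonneg (fun i _ => abs_nonneg (N.1 (v i x0) - ρ i x0))).mp h.symm i (Finset.mem_univ i)
      rw [abs_eq_zero] at this; linarith
  have hcont2 : Continuous (fun x => ∑ i, ‖v i x‖) := by fun_prop
  obtain ⟨x1, hx1, hmax⟩ := hK.exists_isMaxOn hKe hcont2.continuousOn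
  set R := ∑ i, ‖v i x1‖ with hR
  have hR0 : 0 ≤ R := Finset.sum_nonneg (fun i _ => norm_nonneg _)
  obtain ⟨r, hr, hM⟩ := N.near (δ / (2 * (R + 1))) (by positivity)
  refine ⟨r, hr, fun M hMr => ?_⟩
  rintro ⟨x, hx, hbad⟩
  have h1 : δ ≤ ∑ i, |N.1 (v i x) - ρ i x| := hmin hx
  have h2 : ∑ i, |N.1 (v i x) - ρ i x| ≤ ∑ i, δ / (2 * (R + 1)) * ‖v i x‖ := by
    apply Finset.sum_le_sum
    intro i _
    rw [← hbad i, abs_sub_comm]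
    exact hM M (by rw [edist_comm]; exact hMr) _
  rw [← Finset.mul_sum] at h2
  have h3 : ∑ i, ‖v i x‖ ≤ R := hmax hx
  have h4 : δ / (2 * (R + 1)) * ∑ i, ‖v i x‖ ≤ δ / (2 * (R + 1)) * R := by gcongr
  have h5 : δ / (2 * (R + 1)) * R < δ := by
    rw [div_mul_eq_mul_div, div_lt_iff₀ (by positivity)]
    nlinarith
  linarith

/-- the functional `|⟪u, ·⟫|` as a seminorm -/
noncomputable def innSemi (u : E3) : Seminorm ℝ E3 :=
  Seminorm.of (fun w => |inner ℝ u w|) (fun x y => by rw [inner_add_right]; exact abs_add_le _ _)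
    (fun c x => by rw [inner_smul_right, abs_mul, Real.norm_eq_abs])

theorem innSemi_apply (u w : E3) : innSemi u w = |inner ℝ u w| := rfl

/-- the perturbed norm -/
theorem perturb {T k : ℕ} (N0 : NormOn3) (v : Fin k → (Fin T → ℝ) → E3) (K : Set (Fin T → ℝ)) (hKe : K.Nonempty) (hk : 0 < k)
    (H1 : ∀ i, ∀ x ∈ K, v i x ≠ 0) (c0 : ℝ)
    (H2 : ∀ i j, i ≠ j → ∀ x ∈ K, ∀ y ∈ K, |inner ℝ (v i x) (v j y)| ≤ c0 * (‖v i x‖ * ‖v j y‖))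
    (η a0 C : ℝ) (hη : 0 < η) (ha0 : 0 ≤ a0) (hC : ∀ w, N0.1 w ≤ C * ‖w‖) (hc0 : c0 ≤ 1)
    (hsmall : a0 * (C + η) ≤ η * (1 - c0)) (a : Fin k → ℝ) (ha : ∀ i, 0 ≤ a i ∧ a i ≤ a0) :
    ∃ M : NormOn3, (∀ w, N0.1 w ≤ M.1 w) ∧ (∀ w, M.1 w ≤ (1 + a0) * (N0.1 w + η * ‖w‖)) ∧
      ∀ i, ∀ x ∈ K, M.1 (v i x) = (1 + a i) * (N0.1 (v i x) + η * ‖v i x‖) := by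
  let u : Fin k → (Fin T → ℝ) → E3 := fun i x => (‖v i x‖)⁻¹ • v i x
  let p : (Fin k × K) → Seminorm ℝ E3 := fun z =>
    (Real.toNNReal (1 + a z.1)) • (N0.1 + (Real.toNNReal η) • innSemi (u z.1 z.2))
  have hp : ∀ z w, p z w = (1 + a z.1) * (N0.1 w + η * |inner ℝ (u z.1 z.2) w|) := by
    intro z w
    show ((Real.toNNReal (1 + a z.1) : NNReal) : ℝ) * (N0.1 w + ((Real.toNNReal η : NNReal) : ℝ) * |inner ℝ (u z.1 z.2) w|) = _
    rw [Real.coe_toNNReal _ (by linarith [(ha z.1).1]), Real.coe_toNNReal _ hη.le]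
  have hu : ∀ i, ∀ x ∈ K, ‖u i x‖ = 1 := by
    intro i x hx
    have := norm_ne_zero_iff.mpr (H1 i x hx)
    simp [u, norm_smul, this]
  have hub : ∀ z w, p z w ≤ (1 + a0) * (N0.1 w + η * ‖w‖) := by
    intro z w
    rw [hp]
    have h1 : |inner ℝ (u z.1 z.2) w| ≤ ‖w‖ := by
      have := abs_real_inner_le_norm (u z.1 z.2) w
      rwa [hu _ _ z.2.2, one_mul] at this
    have h0 : 0 ≤ N0.1 w := apply_nonneg _ _
    have := ha z.1
    gcongr
    · linarith
  have hbdd : BddAbove (Set.range p) := by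
    refine ⟨(Real.toNNReal (1 + a0)) • (N0.1 + (Real.toNNReal η) • normSeminorm ℝ E3), ?_⟩
    rintro _ ⟨z, rfl⟩ w
    show _ ≤ ((Real.toNNReal (1 + a0) : NNReal) : ℝ) * (N0.1 w + ((Real.toNNReal η : NNReal) : ℝ) * ‖w‖)
    rw [Real.coe_toNNReal _ (by linarith), Real.coe_toNNReal _ hη.le]
    exact hub z w
  have happ : ∀ w, (⨆ z, p z) w = ⨆ z, p z w := fun w => Seminorm.iSup_apply hbdd
  obtain ⟨x0, hx0⟩ := hKe
  have : Nonempty (Fin k × K) := ⟨(⟨0, hk⟩, ⟨x0, hx0⟩)⟩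
  have hle : ∀ w z, p z w ≤ (⨆ z, p z) w := by
    intro w z
    rw [happ]
    exact le_ciSup (f := fun z => p z w) ⟨_, by rintro _ ⟨z, rfl⟩; exact hub z w⟩ z
  have hlow : ∀ w, N0.1 w ≤ (⨆ z, p z) w := by
    intro w
    refine le_trans ?_ (hle w (⟨0, hk⟩, ⟨x0, hx0⟩))
    rw [hp]
    have h0 : 0 ≤ N0.1 w := apply_nonneg _ _
    have h1 : 0 ≤ η * |inner ℝ (u ⟨0, hk⟩ x0) w| := by positivity
    have := (ha ⟨0, hk⟩).1
    nlinarith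
  refine ⟨⟨⨆ z, p z, fun w hw => N0.2 w (le_antisymm ((hlow w).trans hw.le) (apply_nonneg _ _))⟩, hlow, ?_, ?_⟩
  · intro w
    show (⨆ z, p z) w ≤ _
    rw [happ]
    exact ciSup_le fun z => hub z w
  · intro i x hx
    show (⨆ z, p z) (v i x) = _
    set w := v i x with hw
    have hwn : 0 < ‖w‖ := norm_pos_iff.mpr (H1 i x hx)
    have hN0 : 0 ≤ N0.1 w := apply_nonneg _ _
    apply le_antisymm
    · rw [happ]
      apply ciSup_le
      rintro ⟨j, y⟩
      rw [hp]
      simp only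
      by_cases hij : j = i
      · subst hij
        have h1 : |inner ℝ (u j y) w| ≤ ‖w‖ := by
          have := abs_real_inner_le_norm (u j y) w
          rwa [hu _ _ y.2, one_mul] at this
        have := (ha j).1
        gcongr
      · have h1 : |inner ℝ (u j y) w| ≤ c0 * ‖w‖ := by
          have h2 := H2 j i hij y y.2 x hx
          have hvn : 0 < ‖v j y‖ := norm_pos_iff.mpr (H1 j y y.2)
          simp only [u]
          rw [real_inner_smul_left, abs_mul, abs_inv, abs_norm, inv_mul_eq_div, div_le_iff₀ hvn]
          rw [← hw] at h2
          linarith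
        have hj := ha j
        have hi := (ha i).1
        calc (1 + a j) * (N0.1 w + η * |inner ℝ (u j y) w|) ≤ (1 + a j) * (N0.1 w + η * (c0 * ‖w‖)) := by
              have := hj.1
              gcongr
          _ ≤ N0.1 w + η * ‖w‖ := by
              have e1 : a j * (N0.1 w + η * (c0 * ‖w‖)) ≤ a0 * (C + η) * ‖w‖ := by
                have e2 : N0.1 w + η * (c0 * ‖w‖) ≤ (C + η) * ‖w‖ := by
                  have := hC w
                  have : η * (c0 * ‖w‖) ≤ η * (1 * ‖w‖) := by gcongr
                  linarith
                have e3 : 0 ≤ (C + η) * ‖w‖ := by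
                  have := hC w
                  have : 0 ≤ η * ‖w‖ := by positivity
                  nlinarith
                calc a j * (N0.1 w + η * (c0 * ‖w‖)) ≤ a j * ((C + η) * ‖w‖) := by
                      have := hj.1
                      gcongr
                  _ ≤ a0 * ((C + η) * ‖w‖) := by
                      have := hj.2
                      gcongr
                  _ = _ := by ring
              have e4 : a0 * (C + η) * ‖w‖ ≤ η * (1 - c0) * ‖w‖ := by gcongr
              nlinarith
          _ ≤ (1 + a i) * (N0.1 w + η * ‖w‖) := by
              have : 0 ≤ N0.1 w + η * ‖w‖ := by positivity
              nlinarith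
    · refine le_trans (le_of_eq ?_) (hle w (i, ⟨x, hx⟩))
      rw [hp]
      simp only [u]
      rw [← hw, real_inner_smul_left, real_inner_self_eq_norm_sq, abs_of_nonneg (by positivity)]
      congr 3
      field_simp

theorem lip_div_aux {T : ℕ} (v : (Fin T → ℝ) → E3) (ρ : (Fin T → ℝ) → ℝ)
    (hv : ContDiff ℝ 1 v) (hρ : ContDiff ℝ 1 ρ) (M : E3 → ℝ) (CM : NNReal) (hM : LipschitzWith CM M) (x : Fin T → ℝ)
    (hx : M (v x) ≠ 0) : ∃ C : NNReal, ∃ t ∈ 𝓝 x, LipschitzOnWith C (fun x => ρ x / M (v x) - 1) t := by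
  obtain ⟨C1, t1, ht1, hL1⟩ := hv.contDiffAt (x := x) |>.exists_lipschitzOnWith
  obtain ⟨C2, t2, ht2, hL2⟩ := hρ.contDiffAt (x := x) |>.exists_lipschitzOnWith
  have hdiv : ContDiffAt ℝ 1 (fun z : ℝ × ℝ => z.1 / z.2 - 1) (ρ x, M (v x)) :=
    (contDiffAt_fst.div contDiffAt_snd hx).sub contDiffAt_const
  obtain ⟨C3, t3, ht3, hL3⟩ := hdiv.exists_lipschitzOnWith
  have hpair : LipschitzOnWith (max C2 (CM * C1)) (fun x => (ρ x, M (v x))) (t1 ∩ t2) :=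
    (hL2.mono Set.inter_subset_right).prodMk
      ((hM.comp_lipschitzOnWith hL1).mono Set.inter_subset_left)
  have hcont : Continuous (fun x => (ρ x, M (v x))) :=
    hρ.continuous.prodMk (hM.continuous.comp hv.continuous)
  refine ⟨C3 * max C2 (CM * C1), (t1 ∩ t2) ∩ (fun x => (ρ x, M (v x))) ⁻¹' t3,
    Filter.inter_mem (Filter.inter_mem ht1 ht2) (hcont.continuousAt.preimage_mem_nhds ht3), ?_⟩
  exact hL3.comp (hpair.mono Set.inter_subset_left) (fun x hx => hx.2)

theorem bad_nowhereDense {T k : ℕ} (hTk : T < k) (v : Fin k → (Fin T → ℝ) → E3) (ρ : Fin k → (Fin T → ℝ) → ℝ)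
    (hv : ∀ i, ContDiff ℝ 1 (v i)) (hρ : ∀ i, ContDiff ℝ 1 (ρ i)) (K : Set (Fin T → ℝ)) (hK : IsCompact K)
    (H1 : ∀ i, ∀ x ∈ K, v i x ≠ 0) (c0 : ℝ) (hc0 : c0 < 1)
    (H2 : ∀ i j, i ≠ j → ∀ x ∈ K, ∀ y ∈ K, |inner ℝ (v i x) (v j y)| ≤ c0 * (‖v i x‖ * ‖v j y‖)) :
    IsNowhereDense {N : NormOn3 | ∃ x ∈ K, ∀ i, N.1 (v i x) = ρ i x} := by
  rw [(bad_closed v ρ (fun i => (hv i).continuous) (fun i => (hρ i).continuous) K hK).isNowhereDense_iff]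
  by_contra hne
  obtain ⟨N0, hN0⟩ := Set.nonempty_iff_ne_empty.mpr hne
  have hKe : K.Nonempty := by
    obtain ⟨x, hx, -⟩ := interior_subset hN0
    exact ⟨x, hx⟩
  obtain ⟨r, hr, hball⟩ := EMetric.isOpen_iff.mp isOpen_interior N0 hN0
  obtain ⟨ε, hε, hnear⟩ := N0.near' r hr
  obtain ⟨c, hc, hlow⟩ := N0.lower
  obtain ⟨C, hC, hup⟩ := N0.upper
  set e := min ε 1 with he
  have he0 : 0 < e := lt_min hε one_pos
  have he1 : e ≤ 1 := min_le_right _ _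
  set η := c * e / 3 with hη
  have hη0 : 0 < η := by positivity
  set a0 := min (e / 3) (η * (1 - c0) / (C + η)) with ha0
  have h1c : 0 < 1 - c0 := by linarith
  have ha00 : 0 < a0 := by positivity
  have hsmall : a0 * (C + η) ≤ η * (1 - c0) := by
    calc a0 * (C + η) ≤ (η * (1 - c0) / (C + η)) * (C + η) := by gcongr; exact min_le_right _ _
      _ = _ := by field_simp
  let M0 : E3 → ℝ := fun w => N0.1 w + η * ‖w‖
  have hM0pos : ∀ w, w ≠ 0 → 0 < M0 w := fun w hw => by
    have := N0.pos hw
    have := norm_nonneg w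
    simp only [M0]; positivity
  have hM0L : LipschitzWith (Real.toNNReal (C + η)) M0 := by
    apply LipschitzWith.of_dist_le_mul
    intro x y
    rw [dist_eq_norm, Real.norm_eq_abs, dist_eq_norm]
    rw [Real.coe_toNNReal _ (by positivity)]
    simp only [M0]
    have e1 := (abs_sub_map_le_sub N0.1 x y).trans (hup _)
    have e2 := abs_norm_sub_norm_le x y
    calc |N0.1 x + η * ‖x‖ - (N0.1 y + η * ‖y‖)| = |(N0.1 x - N0.1 y) + η * (‖x‖ - ‖y‖)| := by congr 1; ring
      _ ≤ |N0.1 x - N0.1 y| + |η * (‖x‖ - ‖y‖)| := abs_add_le _ _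
      _ ≤ C * ‖x - y‖ + η * ‖x - y‖ := by
          rw [abs_mul, abs_of_pos hη0]; gcongr
      _ = _ := by ring
  let Φ : (Fin T → ℝ) → (Fin k → ℝ) := fun x i => ρ i x / M0 (v i x) - 1
  have hcube : Set.Icc (0 : Fin k → ℝ) (fun _ => a0) ⊆ Φ '' K := by
    intro a ha
    have ha' : ∀ i, 0 ≤ a i ∧ a i ≤ a0 := fun i => ⟨ha.1 i, ha.2 i⟩
    obtain ⟨M, h1, h2, h3⟩ := perturb N0 v K hKe (by omega) H1 c0 H2 η a0 C hη0 ha00.le hup hc0.le hsmall a ha'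
    have hMr : edist M N0 < r := by
      apply hnear M h1
      intro w
      refine (h2 w).trans ?_
      have hl := hlow w
      have hn : 0 ≤ N0.1 w := apply_nonneg _ _
      have e1 : η * ‖w‖ ≤ e / 3 * N0.1 w := by
        rw [hη]; nlinarith
      have e2 : a0 ≤ e / 3 := min_le_left _ _
      have e3 : e ≤ ε := min_le_left _ _
      calc (1 + a0) * (N0.1 w + η * ‖w‖) ≤ (1 + e/3) * (N0.1 w + e / 3 * N0.1 w) := by gcongr
        _ = (1 + e/3) * (1 + e/3) * N0.1 w := by ring
        _ ≤ (1 + ε) * N0.1 w := by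
            gcongr
            nlinarith
    obtain ⟨x, hx, hbad⟩ := interior_subset (hball (show M ∈ Metric.eball N0 r from hMr))
    refine ⟨x, hx, ?_⟩
    ext i
    have hp := hM0pos _ (H1 i x hx)
    have := h3 i x hx
    rw [hbad i] at this
    simp only [Φ]
    rw [this]
    show (1 + a i) * M0 (v i x) / M0 (v i x) - 1 = a i
    rw [mul_div_cancel_right₀ _ hp.ne']; ring
  have hdim1 : dimH (Set.Icc (0 : Fin k → ℝ) (fun _ => a0)) = k := by
    have := Real.dimH_of_nonempty_interior (E := Fin k → ℝ) (s := Set.Icc (0 : Fin k → ℝ) (fun _ => a0)) (by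
      rw [← Set.pi_univ_Icc, interior_pi_set Set.finite_univ]
      refine ⟨fun _ => a0/2, fun i _ => ?_⟩
      show a0 / 2 ∈ interior (Set.Icc (0:ℝ) a0)
      rw [interior_Icc]
      exact ⟨by linarith, by linarith⟩)
    rw [this]; simp
  have hdim2 : dimH (Φ '' K) ≤ dimH K := by
    apply dimH_image_le_of_locally_lipschitzOn
    intro x hx
    have hi : ∀ i, ∃ C : NNReal, ∃ t ∈ 𝓝 x, LipschitzOnWith C (fun x => Φ x i) t := fun i =>
      lip_div_aux (v i) (ρ i) (hv i) (hρ i) M0 _ hM0L x (hM0pos _ (H1 i x hx)).ne'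
    choose Ci t ht hL using hi
    refine ⟨Finset.univ.sup Ci, ⋂ i, t i, mem_nhdsWithin_of_mem_nhds (Filter.iInter_mem.mpr ht), ?_⟩
    intro y hy z hz
    rw [edist_pi_le_iff]
    intro i
    refine (hL i (Set.mem_iInter.mp hy i) (Set.mem_iInter.mp hz i)).trans ?_
    gcongr
    exact Finset.le_sup (f := Ci) (Finset.mem_univ i)
  have hdim3 : dimH K ≤ T := by
    rw [← Real.dimH_univ_pi_fin T]; exact dimH_mono (Set.subset_univ _)
  have : (k : ENNReal) ≤ T := by
    rw [← hdim1]; exact (dimH_mono hcube).trans (hdim2.trans hdim3)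
  have : k ≤ T := by exact_mod_cast this
  omega
end

section
open scoped Topology

/-- algebraic genericity of a norm -/
def GoodN (N : NormOn3) : Prop := ∀ (X : Finset ℝ) (W : Finset E3), (∀ w ∈ W, w ≠ 0) →
  (∀ w ∈ W, ∀ w' ∈ W, w ≠ w' → ∀ c : ℝ, w' ≠ c • w) →
  (∀ w ∈ W, (∀ j, w j ∈ Subfield.closure (X : Set ℝ)) ∧ N.1 w ∈ Subfield.closure (X : Set ℝ)) → W.card ≤ X.card

/-- evaluation of a vector of integer polynomials -/
noncomputable def pvec {T : ℕ} (V : Fin 3 → MvPolynomial (Fin T) ℤ) (x : Fin T → ℝ) : E3 :=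
  WithLp.toLp 2 (fun j => MvPolynomial.aeval x (V j))

theorem mvpoly_contDiff {T : ℕ} (p : MvPolynomial (Fin T) ℤ) :
    ContDiff ℝ 1 (fun x : Fin T → ℝ => MvPolynomial.aeval x p) := by
  induction p using MvPolynomial.induction_on with
  | C a => simpa using contDiff_const
  | add p q hp hq => simpa using hp.add hq
  | mul_X p i hp => simpa using hp.mul (contDiff_apply ℝ ℝ i)

theorem pvec_contDiff {T : ℕ} (V : Fin 3 → MvPolynomial (Fin T) ℤ) : ContDiff ℝ 1 (pvec V) := by
  rw [contDiff_euclidean]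
  intro j
  exact mvpoly_contDiff (V j)

theorem mem_subring_closure_poly {T : ℕ} (x : Fin T → ℝ) (a : ℝ) (ha : a ∈ Subring.closure (Set.range x)) :
    ∃ p : MvPolynomial (Fin T) ℤ, MvPolynomial.aeval x p = a := by
  have : Subring.closure (Set.range x) ≤ (MvPolynomial.aeval (R := ℤ) x).range.toSubring := by
    rw [Subring.closure_le]
    rintro _ ⟨i, rfl⟩
    exact ⟨MvPolynomial.X i, by simp⟩
  exact this ha

theorem clear_denoms (X : Set ℝ) (f : Fin 4 → ℝ) (hf : ∀ j, f j ∈ Subfield.closure X) :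
    ∃ b : ℝ, b ≠ 0 ∧ ∀ j, b * f j ∈ Subring.closure X := by
  have : ∀ j, ∃ y z, y ∈ Subring.closure X ∧ z ∈ Subring.closure X ∧ z ≠ 0 ∧ f j * z = y := by
    intro j
    obtain ⟨y, hy, z, hz, h⟩ := Subfield.mem_closure_iff.mp (hf j)
    by_cases hz0 : z = 0
    · exact ⟨0, 1, Subring.zero_mem _, Subring.one_mem _, one_ne_zero, by rw [← h, hz0]; simp⟩
    · exact ⟨y, z, hy, hz, hz0, by rw [← h]; field_simp⟩
  choose y z hy hz hz0 h using this
  refine ⟨∏ j, z j, Finset.prod_ne_zero_iff.mpr fun j _ => hz0 j, fun j => ?_⟩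
  rw [← Finset.mul_prod_erase _ _ (Finset.mem_univ j), mul_comm, ← mul_assoc, h]
  exact Subring.mul_mem _ (hy j) (Subring.prod_mem _ fun i _ => hz i)

/-- the bad set attached to countable data -/
def badSet (T k : ℕ) (V : Fin k → Fin 3 → MvPolynomial (Fin T) ℤ) (R : Fin k → MvPolynomial (Fin T) ℤ)
    (q : Fin T → ℚ) (r c0 : ℚ) : Set NormOn3 :=
  {N | (T < k ∧ (c0 : ℝ) < 1 ∧
    (∀ i, ∀ x ∈ Metric.closedBall (fun j => (q j : ℝ)) (r : ℝ), pvec (V i) x ≠ 0) ∧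
    (∀ i j, i ≠ j → ∀ x ∈ Metric.closedBall (fun j => (q j : ℝ)) (r : ℝ), ∀ y ∈ Metric.closedBall (fun j => (q j : ℝ)) (r : ℝ),
      |inner ℝ (pvec (V i) x) (pvec (V j) y)| ≤ c0 * (‖pvec (V i) x‖ * ‖pvec (V j) y‖))) ∧
    ∃ x ∈ Metric.closedBall (fun j => (q j : ℝ)) (r : ℝ), ∀ i, N.1 (pvec (V i) x) = MvPolynomial.aeval x (R i)}

theorem badSet_meagre (T k : ℕ) (V : Fin k → Fin 3 → MvPolynomial (Fin T) ℤ) (R : Fin k → MvPolynomial (Fin T) ℤ)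
    (q : Fin T → ℚ) (r c0 : ℚ) : IsMeagre (badSet T k V R q r c0) := by
  by_cases h : (T < k ∧ (c0 : ℝ) < 1 ∧
    (∀ i, ∀ x ∈ Metric.closedBall (fun j => (q j : ℝ)) (r : ℝ), pvec (V i) x ≠ 0) ∧
    (∀ i j, i ≠ j → ∀ x ∈ Metric.closedBall (fun j => (q j : ℝ)) (r : ℝ), ∀ y ∈ Metric.closedBall (fun j => (q j : ℝ)) (r : ℝ),
      |inner ℝ (pvec (V i) x) (pvec (V j) y)| ≤ c0 * (‖pvec (V i) x‖ * ‖pvec (V j) y‖)))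
  · have := (bad_nowhereDense h.1 (fun i => pvec (V i)) (fun i x => MvPolynomial.aeval x (R i))
      (fun i => pvec_contDiff _) (fun i => mvpoly_contDiff _) _ (isCompact_closedBall _ _) h.2.2.1 c0 h.2.1 h.2.2.2).isMeagre
    exact this.mono (fun N hN => hN.2)
  · exact IsMeagre.empty.mono (fun N hN => (h hN.1).elim)

theorem exists_small_ball {T k : ℕ} (v : Fin k → (Fin T → ℝ) → E3) (hv : ∀ i, Continuous (v i)) (x : Fin T → ℝ)
    (h0 : ∀ i, v i x ≠ 0) (hpar : ∀ i j, i ≠ j → ∀ c : ℝ, v j x ≠ c • v i x) :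
    ∃ (c0 : ℚ) (δ : ℝ), 0 < δ ∧ (c0 : ℝ) < 1 ∧ ∀ y ∈ Metric.ball x δ, ∀ z ∈ Metric.ball x δ,
      (∀ i, v i y ≠ 0) ∧ ∀ i j, i ≠ j → |inner ℝ (v i y) (v j z)| ≤ c0 * (‖v i y‖ * ‖v j z‖) := by
  have h1 : ∀ z : Fin k × Fin k, ∃ c : ℝ, c < 1 ∧ (z.1 ≠ z.2 → |inner ℝ (v z.1 x) (v z.2 x)| < c * (‖v z.1 x‖ * ‖v z.2 x‖)) := by
    rintro ⟨i, j⟩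
    by_cases hij : i = j
    · exact ⟨0, one_pos, fun h => (h hij).elim⟩
    have hlt : |inner ℝ (v i x) (v j x)| < 1 * (‖v i x‖ * ‖v j x‖) := by
      rw [one_mul]
      refine lt_of_le_of_ne (abs_real_inner_le_norm _ _) fun he => ?_
      have := (abs_real_inner_div_norm_mul_norm_eq_one_iff (v i x) (v j x)).mp (by
        rw [abs_div, he, abs_of_nonneg (by positivity), div_self]
        have := norm_ne_zero_iff.mpr (h0 i)
        have := norm_ne_zero_iff.mpr (h0 j)
        positivity)
      obtain ⟨-, c, -, hc⟩ := this
      exact hpar i j hij c hc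
    have hp : 0 < ‖v i x‖ * ‖v j x‖ := mul_pos (norm_pos_iff.mpr (h0 i)) (norm_pos_iff.mpr (h0 j))
    rw [← div_lt_iff₀ hp] at hlt
    obtain ⟨c, hc1, hc2⟩ := exists_between hlt
    exact ⟨c, hc2, fun _ => by rwa [div_lt_iff₀ hp] at hc1⟩
  choose c hc1 hc2 using h1
  obtain ⟨c', hc', hcc⟩ : ∃ c' : ℝ, c' < 1 ∧ ∀ z, c z ≤ c' := by
    by_cases hne : Nonempty (Fin k × Fin k)
    · obtain ⟨z, hz⟩ := Finite.exists_max c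
      exact ⟨c z, hc1 z, hz⟩
    · exact ⟨0, one_pos, fun z => (hne ⟨z⟩).elim⟩
  obtain ⟨c0, hc01, hc02⟩ := exists_rat_btwn hc'
  have hev : ∀ᶠ p : (Fin T → ℝ) × (Fin T → ℝ) in 𝓝 (x, x), (∀ i, v i p.1 ≠ 0) ∧
      ∀ i j, i ≠ j → |inner ℝ (v i p.1) (v j p.2)| ≤ c0 * (‖v i p.1‖ * ‖v j p.2‖) := by
    apply Filter.Eventually.and
    · rw [Filter.eventually_all]
      intro i
      exact ((hv i).comp continuous_fst).continuousAt.eventually_ne (h0 i)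
    · rw [Filter.eventually_all]
      intro i
      rw [Filter.eventually_all]
      intro j
      by_cases hij : i = j
      · exact Filter.Eventually.of_forall fun _ h => (h hij).elim
      have hlt : |inner ℝ (v i x) (v j x)| < c0 * (‖v i x‖ * ‖v j x‖) := by
        refine (hc2 (i, j) hij).trans_le ?_
        have := hcc (i, j)
        gcongr
        linarith
      have ca : ContinuousAt (fun p : (Fin T → ℝ) × (Fin T → ℝ) => |inner ℝ (v i p.1) (v j p.2)|) (x, x) := by
        have := hv i
        have := hv j
        apply Continuous.continuousAt
        fun_prop
      have cb : ContinuousAt (fun p : (Fin T → ℝ) × (Fin T → ℝ) => (c0 : ℝ) * (‖v i p.1‖ * ‖v j p.2‖)) (x, x) := by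
        have := hv i
        have := hv j
        apply Continuous.continuousAt
        fun_prop
      filter_upwards [ca.eventually_lt cb hlt] with p hp _
      exact hp.le
  obtain ⟨δ, hδ, hb⟩ := Metric.eventually_nhds_iff_ball.mp hev
  refine ⟨c0, δ, hδ, hc02, fun y hy z hz => hb (y, z) ?_⟩
  rw [← ball_prod_same]
  exact ⟨hy, hz⟩

theorem exists_rat_ball {T : ℕ} (x : Fin T → ℝ) (δ : ℝ) (hδ : 0 < δ) :
    ∃ (q : Fin T → ℚ) (r : ℚ), x ∈ Metric.closedBall (fun j => (q j : ℝ)) (r : ℝ) ∧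
      Metric.closedBall (fun j => (q j : ℝ)) (r : ℝ) ⊆ Metric.ball x δ := by
  obtain ⟨r, hr0, hr1⟩ := exists_rat_btwn (show (0 : ℝ) < δ / 2 by positivity)
  have : ∀ j, ∃ q : ℚ, |x j - q| < r := fun j => exists_rat_near (x j) hr0
  choose q hq using this
  have hx : dist x (fun j => (q j : ℝ)) ≤ r := by
    rw [dist_pi_le_iff hr0.le]
    intro j
    rw [Real.dist_eq]
    exact (hq j).le
  refine ⟨q, r, hx, fun y hy => ?_⟩
  have h1 := dist_triangle_right y x (fun j => (q j : ℝ))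
  have h2 : dist y (fun j => (q j : ℝ)) ≤ r := hy
  show dist y x < δ
  linarith

theorem goodN_meagre : IsMeagre {N : NormOn3 | ¬ GoodN N} := by
  let J := Σ (T : ℕ) (k : ℕ), (Fin k → Fin 3 → MvPolynomial (Fin T) ℤ) × (Fin k → MvPolynomial (Fin T) ℤ) × (Fin T → ℚ) × ℚ × ℚ
  have hcp : ∀ T, Countable (MvPolynomial (Fin T) ℤ) := fun T => by
    show Countable (AddMonoidAlgebra ℤ (Fin T →₀ ℕ))
    exact (AddMonoidAlgebra.coeffEquiv.injective).countable
  have hJ : Countable J := inferInstance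
  have hm := isMeagre_iUnion (f := fun j : J => badSet j.1 j.2.1 j.2.2.1 j.2.2.2.1 j.2.2.2.2.1 j.2.2.2.2.2.1 j.2.2.2.2.2.2)
    (fun j => badSet_meagre _ _ _ _ _ _ _)
  refine hm.mono ?_
  intro N hN
  simp only [GoodN, Set.mem_ofPred_eq] at hN
  push Not at hN
  obtain ⟨X, W, hW0, hWp, hWF, hcard⟩ := hN
  let T := X.card
  let k := W.card
  let x : Fin T → ℝ := fun i => (X.equivFin.symm i : ℝ)
  have hx : Set.range x = X := by
    ext y; constructor
    · rintro ⟨i, rfl⟩; exact (X.equivFin.symm i).2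
    · intro hy; exact ⟨X.equivFin ⟨y, hy⟩, by simp [x]⟩
  let w : Fin k → E3 := fun i => (W.equivFin.symm i : E3)
  have hwW : ∀ i, w i ∈ W := fun i => (W.equivFin.symm i).2
  have hwinj : ∀ i j, i ≠ j → w i ≠ w j := fun i j hij h => hij (W.equivFin.symm.injective (Subtype.ext h))
  have key : ∀ i, ∃ (b : ℝ) (V : Fin 3 → MvPolynomial (Fin T) ℤ) (R : MvPolynomial (Fin T) ℤ), b ≠ 0 ∧
      pvec V x = b • w i ∧ N.1 (pvec V x) = MvPolynomial.aeval x R := by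
    intro i
    obtain ⟨hF, hNF⟩ := hWF _ (hwW i)
    obtain ⟨b, hb, hbm⟩ := clear_denoms X (Fin.cons (N.1 (w i)) (fun j : Fin 3 => w i j)) (by
      intro j
      refine Fin.cases ?_ (fun j => ?_) j
      · exact hNF
      · exact hF j)
    rw [← hx] at hbm
    have hV : ∀ j : Fin 3, ∃ p : MvPolynomial (Fin T) ℤ, MvPolynomial.aeval x p = b * w i j :=
      fun j => mem_subring_closure_poly x _ (hbm j.succ)
    choose V hV using hV
    have hR : ∃ p : MvPolynomial (Fin T) ℤ, MvPolynomial.aeval x p = |b| * N.1 (w i) := by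
      apply mem_subring_closure_poly
      have h0 := hbm 0
      rcases abs_choice b with h | h <;> rw [h]
      · exact h0
      · rw [neg_mul]; exact Subring.neg_mem _ h0
    obtain ⟨R, hR⟩ := hR
    have hpv : pvec V x = b • w i := by
      ext j
      simp [pvec, hV]
    exact ⟨b, V, R, hb, hpv, by rw [hpv, hR, map_smul_eq_mul, Real.norm_eq_abs]⟩
  choose b V R hb hV hR using key
  obtain ⟨c0, δ, hδ, hc0, hball⟩ := exists_small_ball (fun i => pvec (V i)) (fun i => (pvec_contDiff _).continuous) x
    (fun i => by
      show pvec (V i) x ≠ 0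
      rw [hV]; exact smul_ne_zero (hb i) (hW0 _ (hwW i)))
    (fun i j hij c h => by
      have h' : pvec (V j) x = c • pvec (V i) x := h
      rw [hV, hV] at h'
      apply hWp _ (hwW i) _ (hwW j) (hwinj i j hij) ((b j)⁻¹ * (c * b i))
      rw [mul_smul, mul_smul, ← h', smul_smul, inv_mul_cancel₀ (hb j), one_smul])
  obtain ⟨q, r, hxq, hsub⟩ := exists_rat_ball x δ hδ
  refine Set.mem_iUnion.mpr ⟨(⟨T, k, V, R, q, r, c0⟩ : J), ?_⟩
  refine ⟨⟨hcard, hc0, fun i y hy => (hball y (hsub hy) y (hsub hy)).1 i,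
    fun i j hij y hy z hz => (hball y (hsub hy) z (hsub hz)).2 i j hij⟩, x, hxq, hR⟩
end

section
open scoped Classical

/-- the line directions determined by `P` -/
noncomputable def dirs (P : Finset E3) : Finset (Submodule ℝ E3) :=
  P.offDiag.image (fun z => Submodule.span ℝ {z.1 - z.2})

/-- the distances determined by `P` -/
noncomputable def dsts (N : NormOn3) (P : Finset E3) : Finset ℝ :=
  P.offDiag.image (fun z => N.1 (z.1 - z.2))

/-- the distances in direction `U` -/
noncomputable def lset (N : NormOn3) (P : Finset E3) (U : Submodule ℝ E3) : Finset ℝ :=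
  (P.offDiag.filter (fun z => Submodule.span ℝ {z.1 - z.2} = U)).image (fun z => N.1 (z.1 - z.2))

theorem mem_dirs {P : Finset E3} {U} : U ∈ dirs P ↔ ∃ p ∈ P, ∃ q ∈ P, p ≠ q ∧ Submodule.span ℝ {p - q} = U := by
  simp only [dirs, Finset.mem_image, Finset.mem_offDiag, Prod.exists]
  constructor
  · rintro ⟨p, q, ⟨hp, hq, hne⟩, rfl⟩; exact ⟨p, hp, q, hq, hne, rfl⟩
  · rintro ⟨p, hp, q, hq, hne, rfl⟩; exact ⟨p, q, ⟨hp, hq, hne⟩, rfl⟩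

theorem mem_dsts {N : NormOn3} {P : Finset E3} {r} : r ∈ dsts N P ↔ ∃ p ∈ P, ∃ q ∈ P, p ≠ q ∧ N.1 (p - q) = r := by
  simp only [dsts, Finset.mem_image, Finset.mem_offDiag, Prod.exists]
  constructor
  · rintro ⟨p, q, ⟨hp, hq, hne⟩, rfl⟩; exact ⟨p, hp, q, hq, hne, rfl⟩
  · rintro ⟨p, hp, q, hq, hne, rfl⟩; exact ⟨p, q, ⟨hp, hq, hne⟩, rfl⟩

theorem mem_lset {N : NormOn3} {P : Finset E3} {U r} : r ∈ lset N P U ↔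
    ∃ p ∈ P, ∃ q ∈ P, p ≠ q ∧ Submodule.span ℝ {p - q} = U ∧ N.1 (p - q) = r := by
  simp only [lset, Finset.mem_image, Finset.mem_filter, Finset.mem_offDiag, Prod.exists]
  constructor
  · rintro ⟨p, q, ⟨⟨hp, hq, hne⟩, h⟩, rfl⟩; exact ⟨p, hp, q, hq, hne, h, rfl⟩
  · rintro ⟨p, hp, q, hq, hne, h, rfl⟩; exact ⟨p, q, ⟨⟨hp, hq, hne⟩, h⟩, rfl⟩

theorem lset_subset {N : NormOn3} {P : Finset E3} {U} : lset N P U ⊆ dsts N P := by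
  intro r hr
  obtain ⟨p, hp, q, hq, hne, -, h⟩ := mem_lset.mp hr
  exact mem_dsts.mpr ⟨p, hp, q, hq, hne, h⟩

theorem span_eq_iff {V : Type*} [AddCommGroup V] [Module ℝ V] {w w' : V} (h : Submodule.span ℝ {w} = Submodule.span ℝ {w'}) :
    ∃ t : ℝ, t ≠ 0 ∧ w' = t • w := by
  obtain ⟨z, hz⟩ := (Submodule.span_singleton_eq_span_singleton).mp h
  exact ⟨z, z.ne_zero, hz.symm⟩

theorem span_smul_eq {V : Type*} [AddCommGroup V] [Module ℝ V] {w : V} {t : ℝ} (ht : t ≠ 0) :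
    Submodule.span ℝ {t • w} = Submodule.span ℝ {w} :=
  Submodule.span_singleton_smul_eq (IsUnit.mk0 t ht) w

theorem scalar_mem (F : Subfield ℝ) (w w' : E3) (hw : w ≠ 0) (h : ∀ j, w j ∈ F) (h' : ∀ j, w' j ∈ F) (t : ℝ)
    (ht : w' = t • w) : t ∈ F := by
  obtain ⟨j, hj⟩ : ∃ j, w j ≠ 0 := by
    by_contra hc
    push Not at hc
    exact hw (by ext j; exact hc j)
  have : t = w' j / w j := by
    rw [ht]
    have : (t • w) j = t * w j := by simp
    rw [this]; field_simp
  rw [this]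
  exact F.div_mem (h' j) (h j)

theorem abs_memF (F : Subfield ℝ) {t : ℝ} (h : t ∈ F) : |t| ∈ F := by
  rcases abs_choice t with h' | h' <;> rw [h']
  · exact h
  · exact F.neg_mem h

theorem N_abs (N : NormOn3) (t : ℝ) (w : E3) : N.1 (t • w) = |t| * N.1 w := by
  rw [map_smul_eq_mul, Real.norm_eq_abs]

theorem good_dirs {N : NormOn3} (hN : GoodN N) (D : Finset (Submodule ℝ E3)) (w : Submodule ℝ E3 → E3)
    (hw0 : ∀ U ∈ D, w U ≠ 0) (hw : ∀ U ∈ D, Submodule.span ℝ {w U} = U) (X : Finset ℝ)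
    (hF : ∀ U ∈ D, (∀ j, w U j ∈ Subfield.closure (X : Set ℝ)) ∧ N.1 (w U) ∈ Subfield.closure (X : Set ℝ)) :
    D.card ≤ X.card := by
  have hinj : Set.InjOn w D := by
    intro U hU U' hU' h
    rw [← hw U hU, ← hw U' hU', h]
  rw [← Finset.card_image_of_injOn hinj]
  apply hN
  · simpa using hw0
  · intro a ha b hb hab c hc
    obtain ⟨U, hU, rfl⟩ := Finset.mem_image.mp ha
    obtain ⟨U', hU', rfl⟩ := Finset.mem_image.mp hb
    apply hab
    have hc0 : c ≠ 0 := by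
      rintro rfl
      exact hw0 U' hU' (by rw [hc, zero_smul])
    have : U = U' := by rw [← hw U hU, ← hw U' hU', hc, span_smul_eq hc0]
    rw [this]
  · simpa using hF

theorem GP {N : NormOn3} (hN : GoodN N) (P : Finset E3) (X : Finset ℝ)
    (hX : ∀ p ∈ P, ∀ q ∈ P, ∀ j, (p - q) j ∈ Subfield.closure (X : Set ℝ))
    (f : Submodule ℝ E3 → ℕ) (B : ℕ) (U0 : Submodule ℝ E3) (hf : ∀ U ∈ dirs P, f U ≤ (lset N P U).card)
    (hB : ∀ U ∈ dirs P, U ≠ U0 → f U ≤ B) : ∑ U ∈ dirs P, f U ≤ (dsts N P).card + B * X.card := by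
  set F := Subfield.closure (X : Set ℝ) with hFdef
  have hex : ∀ U : Submodule ℝ E3, ∃ w : E3, U ∈ dirs P → w ≠ 0 ∧ Submodule.span ℝ {w} = U ∧ ∀ j, w j ∈ F := by
    intro U
    by_cases hU : U ∈ dirs P
    · obtain ⟨p, hp, q, hq, hne, h⟩ := mem_dirs.mp hU
      exact ⟨p - q, fun _ => ⟨sub_ne_zero.mpr hne, h, hX p hp q hq⟩⟩
    · exact ⟨0, fun h => (hU h).elim⟩
  choose w hw using hex
  have hNpos : ∀ U ∈ dirs P, 0 < N.1 (w U) := fun U hU => N.pos (hw U hU).1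
  let R : Submodule ℝ E3 → Submodule ℝ E3 → Prop := fun U U' => N.1 (w U) / N.1 (w U') ∈ F
  have hRsymm : ∀ U U', R U U' → R U' U := fun U U' h => by
    show N.1 (w U') / N.1 (w U) ∈ F
    rw [← inv_div]; exact F.inv_mem h
  -- a maximal inequivalent family
  let fam := (dirs P).powerset.filter (fun D' => (U0 ∈ dirs P → U0 ∈ D') ∧ ∀ U ∈ D', ∀ U' ∈ D', U ≠ U' → ¬ R U U')
  have hfam : fam.Nonempty := by
    refine ⟨(dirs P).filter (fun U => U = U0), ?_⟩
    simp only [fam, Finset.mem_filter, Finset.mem_powerset]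
    refine ⟨Finset.filter_subset _ _, fun h => ⟨h, trivial⟩, ?_⟩
    rintro U ⟨-, hU⟩ U' ⟨-, hU'⟩ h
    exact (h (hU.trans hU'.symm)).elim
  obtain ⟨D', hD', hmax⟩ := Finset.exists_max_image fam Finset.card hfam
  simp only [fam, Finset.mem_filter, Finset.mem_powerset] at hD' hmax
  obtain ⟨hsub, hU0, hineq⟩ := hD'
  have hcov : ∀ U ∈ dirs P, ∃ U' ∈ D', R U U' := by
    intro U hU
    by_contra hcon
    push Not at hcon
    have hUD : U ∉ D' := fun h => hcon U h (by
      show N.1 (w U) / N.1 (w U) ∈ F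
      rw [div_self (hNpos U hU).ne']; exact F.one_mem)
    have := hmax (insert U D') ⟨Finset.insert_subset hU hsub, fun h => Finset.mem_insert_of_mem (hU0 h), by
      intro a ha b hb hab
      rcases Finset.mem_insert.mp ha with rfl | ha1 <;> rcases Finset.mem_insert.mp hb with rfl | hb1
      · exact (hab rfl).elim
      · exact hcon b hb1
      · exact fun h => hcon a ha1 (hRsymm _ _ h)
      · exact hineq a ha1 b hb1 hab⟩
    rw [Finset.card_insert_of_notMem hUD] at this
    omega
  have hcard : (dirs P).card ≤ X.card + D'.card := by
    have := good_dirs hN (dirs P) w (fun U hU => (hw U hU).1) (fun U hU => (hw U hU).2.1)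
      (X ∪ D'.image (fun U => N.1 (w U))) (by
        intro U hU
        have hle : F ≤ Subfield.closure ((X ∪ D'.image (fun U => N.1 (w U)) : Finset ℝ) : Set ℝ) :=
          Subfield.closure_mono (by intro x hx; simp at hx ⊢; exact Or.inl hx)
        refine ⟨fun j => hle ((hw U hU).2.2 j), ?_⟩
        obtain ⟨U', hU', hR⟩ := hcov U hU
        have h1 : N.1 (w U') ∈ Subfield.closure ((X ∪ D'.image (fun U => N.1 (w U)) : Finset ℝ) : Set ℝ) :=
          Subfield.subset_closure (Finset.mem_coe.mpr (Finset.mem_union_right _ (Finset.mem_image_of_mem _ hU')))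
        have h2 := Subfield.mul_mem _ (hle hR) h1
        rwa [div_mul_cancel₀ _ (hNpos U' (hsub hU')).ne'] at h2)
    refine this.trans ((Finset.card_union_le _ _).trans ?_)
    gcongr
    exact Finset.card_image_le
  have hscal : ∀ U ∈ dirs P, ∀ r ∈ lset N P U, r ≠ 0 ∧ ∃ t ∈ F, r = t * N.1 (w U) := by
    intro U hU r hr
    obtain ⟨p, hp, q, hq, hne, h, rfl⟩ := mem_lset.mp hr
    refine ⟨(N.pos (sub_ne_zero.mpr hne)).ne', ?_⟩
    obtain ⟨t, ht, hpq⟩ := span_eq_iff ((hw U hU).2.1.trans h.symm)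
    refine ⟨|t|, abs_memF F (scalar_mem F _ _ (hw U hU).1 (hw U hU).2.2 (hX p hp q hq) t hpq), ?_⟩
    rw [hpq, N_abs]
  have hdisj : ∀ U ∈ D', ∀ U' ∈ D', U ≠ U' → Disjoint (lset N P U) (lset N P U') := by
    intro U hU U' hU' hne
    rw [Finset.disjoint_left]
    intro r hr hr'
    obtain ⟨h0, t, ht, h1⟩ := hscal U (hsub hU) r hr
    obtain ⟨-, t', ht', h2⟩ := hscal U' (hsub hU') r hr'
    apply hineq U hU U' hU' hne
    show N.1 (w U) / N.1 (w U') ∈ F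
    have hn := (hNpos U (hsub hU)).ne'
    have hn' := (hNpos U' (hsub hU')).ne'
    have ht0 : t ≠ 0 := by rintro rfl; apply h0; rw [h1, zero_mul]
    have : N.1 (w U) / N.1 (w U') = t' / t := by
      field_simp
      linarith
    rw [this]; exact F.div_mem ht' ht
  have h1 : ∑ U ∈ D', f U ≤ (dsts N P).card := by
    calc ∑ U ∈ D', f U ≤ ∑ U ∈ D', (lset N P U).card := Finset.sum_le_sum fun U hU => hf U (hsub hU)
      _ = (D'.biUnion (fun U => lset N P U)).card := (Finset.card_biUnion hdisj).symm
      _ ≤ _ := Finset.card_le_card (Finset.biUnion_subset.mpr fun U _ => lset_subset)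
  have h2 : ∑ U ∈ dirs P \ D', f U ≤ B * X.card := by
    calc ∑ U ∈ dirs P \ D', f U ≤ ∑ U ∈ dirs P \ D', B := by
          apply Finset.sum_le_sum
          intro U hU
          rw [Finset.mem_sdiff] at hU
          exact hB U hU.1 (by rintro rfl; exact hU.2 (hU0 hU.1))
      _ = B * (dirs P \ D').card := by rw [Finset.sum_const, smul_eq_mul, mul_comm]
      _ ≤ B * X.card := by
          gcongr
          rw [Finset.card_sdiff_of_subset hsub]; omega
  rw [← Finset.sum_sdiff hsub]
  omega
end

section
open scoped Classical

/-- coordinates of a finite set of vectors -/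
noncomputable def coords (A : Finset E3) : Finset ℝ := (A ×ˢ (Finset.univ : Finset (Fin 3))).image (fun z => z.1 z.2)

theorem coords_card (A : Finset E3) : (coords A).card ≤ 3 * A.card := by
  refine Finset.card_image_le.trans ?_
  rw [Finset.card_product, Finset.card_univ, Fintype.card_fin, mul_comm]

theorem mem_coords {A : Finset E3} {w : E3} (hw : w ∈ A) (j) : w j ∈ coords A :=
  Finset.mem_image.mpr ⟨(w, j), by simp [hw], rfl⟩

/-- `P` is generated from `R` using edges with directions in `S` -/
def Reach (P : Finset E3) (S : Finset (Submodule ℝ E3)) (R : Finset E3) : Prop :=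
  ∀ Q ⊆ P, R ⊆ Q → (∀ q ∈ Q, ∀ p ∈ P, p ≠ q → Submodule.span ℝ {p - q} ∈ S → p ∈ Q) → P ⊆ Q

theorem BL_core {N : NormOn3} (hN : GoodN N) (P : Finset E3) (S : Finset (Submodule ℝ E3)) (R : Finset E3)
    (hS : S ⊆ dirs P) (hR : Reach P S R) (hRP : R ⊆ P) :
    (dirs P).card ≤ (dsts N P).card + 3 * S.card + 3 * R.card := by
  have hex : ∀ U : Submodule ℝ E3, ∃ w : E3, U ∈ dirs P → ∃ p ∈ P, ∃ q ∈ P, p ≠ q ∧ Submodule.span ℝ {p - q} = U ∧ w = p - q := by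
    intro U
    by_cases hU : U ∈ dirs P
    · obtain ⟨p, hp, q, hq, hne, h⟩ := mem_dirs.mp hU
      exact ⟨p - q, fun _ => ⟨p, hp, q, hq, hne, h, rfl⟩⟩
    · exact ⟨0, fun h => (hU h).elim⟩
  choose w hw using hex
  have hw0 : ∀ U ∈ dirs P, w U ≠ 0 := by
    intro U hU
    obtain ⟨p, hp, q, hq, hne, h, hpq⟩ := hw U hU
    rw [hpq]; exact sub_ne_zero.mpr hne
  have hwU : ∀ U ∈ dirs P, Submodule.span ℝ {w U} = U := by
    intro U hU
    obtain ⟨p, hp, q, hq, hne, h, hpq⟩ := hw U hU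
    rw [hpq, h]
  have hwd : ∀ U ∈ dirs P, N.1 (w U) ∈ dsts N P := by
    intro U hU
    obtain ⟨p, hp, q, hq, hne, h, hpq⟩ := hw U hU
    rw [hpq]; exact mem_dsts.mpr ⟨p, hp, q, hq, hne, rfl⟩
  set X : Finset ℝ := (dsts N P ∪ coords (S.image w)) ∪ coords R with hX
  set F := Subfield.closure (X : Set ℝ) with hF
  have hsub : ∀ x ∈ X, x ∈ F := fun x hx => Subfield.subset_closure (Finset.mem_coe.mpr hx)
  have hdF : ∀ x ∈ dsts N P, x ∈ F := fun x hx => hsub x (Finset.mem_union_left _ (Finset.mem_union_left _ hx))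
  have hSF : ∀ U ∈ S, ∀ j, w U j ∈ F := fun U hU j =>
    hsub _ (Finset.mem_union_left _ (Finset.mem_union_right _ (mem_coords (Finset.mem_image_of_mem _ hU) j)))
  have hRF : ∀ p ∈ R, ∀ j, p j ∈ F := fun p hp j => hsub _ (Finset.mem_union_right _ (mem_coords hp j))
  have hPF : ∀ p ∈ P, ∀ j, p j ∈ F := by
    have := hR (P.filter (fun p => ∀ j, p j ∈ F)) (Finset.filter_subset _ _)
      (fun p hp => Finset.mem_filter.mpr ⟨hRP hp, hRF p hp⟩) (by
        intro q hq p hp hne hpq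
        rw [Finset.mem_filter] at hq ⊢
        refine ⟨hp, ?_⟩
        set U := Submodule.span ℝ {p - q} with hUdef
        obtain ⟨t, ht, h⟩ := span_eq_iff (hwU U (hS hpq))
        have hNw := N.pos (hw0 U (hS hpq))
        have habs : |t| ∈ F := by
          have h1 : N.1 (p - q) = |t| * N.1 (w U) := by rw [h, N_abs]
          have h2 : |t| = N.1 (p - q) / N.1 (w U) := by rw [h1]; field_simp
          rw [h2]
          exact F.div_mem (hdF _ (mem_dsts.mpr ⟨p, hp, q, hq.1, hne, rfl⟩)) (hdF _ (hwd U (hS hpq)))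
        have htF : t ∈ F := by
          rcases abs_choice t with h' | h' <;> rw [h'] at habs
          · exact habs
          · have := F.neg_mem habs
            rwa [neg_neg] at this
        intro j
        have : p j = q j + t * w U j := by
          have h3 : p = q + t • w U := by rw [← h]; abel
          rw [h3]; simp
        rw [this]
        exact F.add_mem (hq.2 j) (F.mul_mem htF (hSF U hpq j)))
    intro p hp
    exact (Finset.mem_filter.mp (this hp)).2
  have hcard := good_dirs hN (dirs P) w hw0 hwU X (by
    intro U hU
    refine ⟨fun j => ?_, hdF _ (hwd U hU)⟩
    obtain ⟨p, hp, q, hq, hne, h, hpq⟩ := hw U hU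
    rw [hpq]
    exact F.sub_mem (hPF p hp j) (hPF q hq j))
  have c1 := Finset.card_union_le (dsts N P ∪ coords (S.image w)) (coords R)
  have c2 := Finset.card_union_le (dsts N P) (coords (S.image w))
  have c3 := coords_card R
  have c4 := coords_card (S.image w)
  have c5 : (S.image w).card ≤ S.card := Finset.card_image_le
  rw [← hX] at c1
  omega

theorem dirs_le {N : NormOn3} (hN : GoodN N) (P : Finset E3) :
    (dirs P).card ≤ (dsts N P).card + 3 * P.card := by
  have := BL_core hN P ∅ P (Finset.empty_subset _) (fun Q _ h _ => h) (subset_refl _)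
  simpa using this

theorem pairs_le {α β : Type*} (A : Finset α) (φ : α → β) (b : ℕ) (h : A.card ≤ (A.image φ).card + b) :
    (A.offDiag.filter (fun z => φ z.1 = φ z.2)).card ≤ b * (b + 1) := by
  have h1 : A.card = ∑ y ∈ A.image φ, (A.filter (fun x => φ x = y)).card :=
    Finset.card_eq_sum_card_image φ A
  have hpos : ∀ y ∈ A.image φ, 1 ≤ (A.filter (fun x => φ x = y)).card := by
    intro y hy
    obtain ⟨x, hx, rfl⟩ := Finset.mem_image.mp hy
    exact Finset.card_pos.mpr ⟨x, by simp [hx]⟩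
  have h2 : ∑ y ∈ A.image φ, ((A.filter (fun x => φ x = y)).card - 1) ≤ b := by
    have : ∑ y ∈ A.image φ, ((A.filter (fun x => φ x = y)).card - 1) + (A.image φ).card = A.card := by
      rw [h1, Finset.card_eq_sum_ones, ← Finset.sum_add_distrib]
      apply Finset.sum_congr rfl
      intro y hy
      have := hpos y hy
      omega
    omega
  have h3 : (A.offDiag.filter (fun z => φ z.1 = φ z.2)) ⊆ (A.image φ).biUnion (fun y => (A.filter (fun x => φ x = y)).offDiag) := by
    rintro ⟨x, y⟩ hz
    simp only [Finset.mem_filter, Finset.mem_offDiag, Finset.mem_biUnion, Finset.mem_image] at hz ⊢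
    exact ⟨φ x, ⟨x, hz.1.1, rfl⟩, ⟨hz.1.1, rfl⟩, ⟨hz.1.2.1, hz.2.symm⟩, hz.1.2.2⟩
  calc _ ≤ _ := Finset.card_le_card h3
    _ ≤ ∑ y ∈ A.image φ, ((A.filter (fun x => φ x = y)).offDiag).card := Finset.card_biUnion_le
    _ ≤ ∑ y ∈ A.image φ, ((A.filter (fun x => φ x = y)).card - 1) * (b + 1) := by
        apply Finset.sum_le_sum
        intro y hy
        rw [Finset.offDiag_card]
        have e1 := hpos y hy
        have e2 : (A.filter (fun x => φ x = y)).card - 1 ≤ b :=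
          (Finset.single_le_sum (f := fun y => (A.filter (fun x => φ x = y)).card - 1) (fun _ _ => Nat.zero_le _) hy).trans h2
        obtain ⟨c, hc⟩ : ∃ c, (A.filter (fun x => φ x = y)).card = c + 1 := ⟨_, (Nat.sub_add_cancel e1).symm⟩
        rw [hc] at e2 ⊢
        have : (c + 1) * (c + 1) - (c + 1) = c * (c + 1) := by
          rw [show (c + 1) * (c + 1) = c * (c + 1) + (c + 1) by ring, Nat.add_sub_cancel]
        rw [this]
        simp only [Nat.add_sub_cancel] at e2 ⊢
        gcongr
    _ = (∑ y ∈ A.image φ, ((A.filter (fun x => φ x = y)).card - 1)) * (b + 1) := by rw [Finset.sum_mul]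
    _ ≤ b * (b + 1) := by gcongr

theorem pick_reps {α β : Type*} (A : Finset α) (φ : α → β) :
    ∃ u ⊆ A, Set.InjOn φ u ∧ u.image φ = A.image φ := by
  obtain ⟨u, hu, h1, h2⟩ := Finset.exists_subset_injOn_image_eq_of_surjOn (f := φ) (A : Set α) (A.image φ) (by
    intro y hy
    obtain ⟨x, hx, rfl⟩ := Finset.mem_image.mp (Finset.mem_coe.mp hy)
    exact ⟨x, hx, rfl⟩)
  exact ⟨u, fun x hx => hu hx, h1, h2⟩

theorem BL {N : NormOn3} (hN : GoodN N) (P : Finset E3) (b : ℕ) (hb : 0 < b) (hn : 11 * b ^ 4 ≤ P.card)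
    (hm : (dsts N P).card ≤ 2 * P.card) :
    b * (dirs P).card ≤ b * (dsts N P).card + 6 * P.card := by
  let fam := ((dirs P).powerset ×ˢ P.powerset).filter (fun z => Reach P z.1 z.2)
  have hfam : ((∅ : Finset (Submodule ℝ E3)), P) ∈ fam := by
    simp only [fam, Finset.mem_filter, Finset.mem_product, Finset.mem_powerset]
    exact ⟨⟨Finset.empty_subset _, subset_refl _⟩, fun Q _ h _ => h⟩
  obtain ⟨⟨S, R⟩, hSR, hmin⟩ := Finset.exists_min_image fam (fun z => b * z.1.card + z.2.card) ⟨_, hfam⟩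
  have hle := hmin _ hfam
  simp only [Finset.card_empty, mul_zero, zero_add] at hle
  simp only [fam, Finset.mem_filter, Finset.mem_product, Finset.mem_powerset] at hSR hmin
  obtain ⟨⟨hS, hRP⟩, hreach⟩ := hSR
  have hk := BL_core hN P S R hS hreach hRP
  have hk5 := dirs_le hN P
  -- pairs per direction
  have hdir : ∀ U ∈ dirs P, (R.offDiag.filter (fun z => Submodule.span ℝ {z.1 - z.2} = U)).card ≤ b * (b + 1) := by
    intro U hU
    have key : R.card ≤ (R.image U.mkQ).card + b := by
      obtain ⟨R', hR'sub, hR'inj, hR'im⟩ := (pick_reps R U.mkQ : ∃ u ⊆ R, Set.InjOn U.mkQ u ∧ u.image U.mkQ = R.image U.mkQ)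
      have hc := hmin (insert U S, R') ⟨⟨Finset.insert_subset hU hS, hR'sub.trans hRP⟩, by
        intro Q hQ hRQ hcl
        apply hreach Q hQ
        · intro r hr
          have : U.mkQ r ∈ R'.image U.mkQ := by rw [hR'im]; exact Finset.mem_image_of_mem _ hr
          obtain ⟨r', hr', he⟩ := Finset.mem_image.mp this
          by_cases hrr : r = r'
          · rw [hrr]; exact hRQ hr'
          · apply hcl r' (hRQ hr') r (hRP hr) hrr
            apply Finset.mem_insert.mpr; left
            obtain ⟨p, hp, q, hq, hne, h⟩ := mem_dirs.mp hU
            have hmem : r - r' ∈ U := by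
              exact (Submodule.Quotient.eq U).mp he.symm
            rw [← h] at hmem ⊢
            obtain ⟨t, ht⟩ := Submodule.mem_span_singleton.mp hmem
            have ht0 : t ≠ 0 := by
              rintro rfl
              rw [zero_smul] at ht
              exact hrr (sub_eq_zero.mp ht.symm)
            rw [← ht, span_smul_eq ht0]
        · intro q hq p hp hne hpq
          exact hcl q hq p hp hne (Finset.mem_insert_of_mem hpq)⟩
      simp only at hc
      have h1 : (insert U S).card ≤ S.card + 1 := Finset.card_insert_le _ _
      have h2 : R'.card = (R.image U.mkQ).card := by rw [← hR'im, Finset.card_image_of_injOn hR'inj]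
      have h3 : b * (insert U S).card ≤ b * S.card + b := by
        calc b * (insert U S).card ≤ b * (S.card + 1) := by gcongr
          _ = _ := by ring
      omega
    refine le_trans (Finset.card_le_card ?_) (pairs_le R U.mkQ b key)
    intro z hz
    rw [Finset.mem_filter] at hz ⊢
    refine ⟨hz.1, ?_⟩
    apply (Submodule.Quotient.eq U).mpr
    rw [← hz.2]
    exact Submodule.mem_span_singleton_self _
  have hpairs : R.card * (R.card - 1) ≤ b * (b + 1) * (dirs P).card := by
    have h1 : R.offDiag.card ≤ ∑ U ∈ dirs P, (R.offDiag.filter (fun z => Submodule.span ℝ {z.1 - z.2} = U)).card := by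
      apply le_of_eq
      apply Finset.card_eq_sum_card_fiberwise
      intro z hz
      have hz' := Finset.mem_offDiag.mp (Finset.mem_coe.mp hz)
      exact Finset.mem_coe.mpr (mem_dirs.mpr ⟨z.1, hRP hz'.1, z.2, hRP hz'.2.1, hz'.2.2, rfl⟩)
    have h2 := Finset.sum_le_card_nsmul _ _ _ hdir
    rw [Finset.offDiag_card] at h1
    rw [smul_eq_mul] at h2
    have h3 : R.card * (R.card - 1) = R.card * R.card - R.card := by rw [Nat.mul_sub, mul_one]
    rw [h3]
    refine h1.trans (h2.trans (le_of_eq ?_))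
    ring
  have hRb : b * R.card ≤ P.card := by
    by_contra hcon
    push Not at hcon
    have hb1 : b * (b + 1) ≤ 2 * b ^ 2 := by nlinarith
    have h1 : R.card * (R.card - 1) ≤ 10 * b ^ 2 * P.card := by
      calc _ ≤ b * (b + 1) * (dirs P).card := hpairs
        _ ≤ 2 * b ^ 2 * (5 * P.card) := by gcongr; omega
        _ = _ := by ring
    have hPpos : 0 < P.card := lt_of_lt_of_le (by positivity) hn
    have h2 : P.card * (b * (R.card - 1)) < 10 * b ^ 4 * P.card + 1 := by
      calc P.card * (b * (R.card - 1)) ≤ (b * R.card) * (b * (R.card - 1)) := by gcongr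
        _ = b ^ 2 * (R.card * (R.card - 1)) := by ring
        _ ≤ b ^ 2 * (10 * b ^ 2 * P.card) := by gcongr
        _ = 10 * b ^ 4 * P.card := by ring
        _ < _ := Nat.lt_succ_self _
    have h3 : b * (R.card - 1) ≤ 10 * b ^ 4 := by
      by_contra h; push Not at h
      have : P.card * (10 * b ^ 4 + 1) ≤ P.card * (b * (R.card - 1)) := by gcongr; omega
      nlinarith
    have h4 : b * (R.card - 1) + b = b * R.card := by
      have : 1 ≤ R.card := by
        by_contra h
        have : R.card = 0 := by omega
        rw [this] at hcon; omega
      obtain ⟨c, hc⟩ : ∃ c, R.card = c + 1 := ⟨_, (Nat.sub_add_cancel this).symm⟩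
      rw [hc]; simp; ring
    have h5 : b ≤ b ^ 4 := Nat.le_self_pow (by norm_num) b
    omega
  have hSb : b * S.card + b * R.card ≤ 2 * P.card := by omega
  calc b * (dirs P).card ≤ b * ((dsts N P).card + 3 * S.card + 3 * R.card) := by gcongr
    _ = b * (dsts N P).card + 3 * (b * S.card + b * R.card) := by ring
    _ ≤ _ := by omega
end

section
open scoped Classical

theorem ungar_lab {ι β : Type*} (A : Finset ι) (x y : ι → ℝ)
    (hinj : ∀ p ∈ A, ∀ q ∈ A, x p = x q → y p = y q → p = q)
    (hnc : ∀ a b c : ℝ, (a ≠ 0 ∨ b ≠ 0) → ∃ p ∈ A, a * x p + b * y p ≠ c) (lab : ι → ι → β)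
    (hlab : ∀ p ∈ A, ∀ q ∈ A, p ≠ q → ∀ p' ∈ A, ∀ q' ∈ A, p' ≠ q' → lab p q = lab p' q' →
      (x p - x q) * (y p' - y q') = (x p' - x q') * (y p - y q))
    (Dset : Finset β) (hD : ∀ p ∈ A, ∀ q ∈ A, p ≠ q → lab p q ∈ Dset) : A.card ≤ Dset.card + 1 := by
  obtain ⟨t, ht⟩ := Infinite.exists_notMem_finset (A.offDiag.image (fun z => -(x z.1 - x z.2) / (y z.1 - y z.2)))
  have hne : ∀ p ∈ A, ∀ q ∈ A, p ≠ q → (x p - x q) + t * (y p - y q) ≠ 0 := by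
    intro p hp q hq hpq h
    by_cases hy : y p = y q
    · rw [hy] at h
      exact hpq (hinj p hp q hq (by linarith) hy)
    · apply ht
      refine Finset.mem_image.mpr ⟨(p, q), Finset.mem_offDiag.mpr ⟨hp, hq, hpq⟩, ?_⟩
      have : y p - y q ≠ 0 := sub_ne_zero.mpr hy
      simp only
      field_simp
      linarith
  have hex : ∀ d : β, ∃ s : ℝ, ∀ p ∈ A, ∀ q ∈ A, p ≠ q → lab p q = d →
      (y p - y q) / ((x p + t * y p) - (x q + t * y q)) = s := by
    intro d
    by_cases h : ∃ p ∈ A, ∃ q ∈ A, p ≠ q ∧ lab p q = d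
    · obtain ⟨p, hp, q, hq, hpq, hd⟩ := h
      refine ⟨(y p - y q) / ((x p + t * y p) - (x q + t * y q)), ?_⟩
      intro p' hp' q' hq' hpq' hd'
      have h1 := hlab p hp q hq hpq p' hp' q' hq' hpq' (hd.trans hd'.symm)
      have h2 := hne p hp q hq hpq
      have h3 := hne p' hp' q' hq' hpq'
      rw [div_eq_div_iff]
      · linear_combination h1
      · intro h; apply h3; linarith
      · intro h; apply h2; linarith
    · push Not at h
      exact ⟨0, fun p hp q hq hpq hd => (h p hp q hq hpq hd).elim⟩
  choose s hs using hex
  have := ungar A (fun p => x p + t * y p) y (by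
    intro p hp q hq h
    by_contra hpq
    apply hne p hp q hq hpq
    simp only at h
    linarith) (by
    intro a c
    obtain ⟨p, hp, h⟩ := hnc (-a) (1 - a * t) c (by
      by_cases ha : a = 0
      · right; rw [ha]; simp
      · left; simpa using ha)
    refine ⟨p, hp, fun h' => h ?_⟩
    linear_combination h') (Dset.image s) (by
    intro p hp q hq hpq
    exact Finset.mem_image.mpr ⟨lab p q, hD p hp q hq hpq, (hs _ p hp q hq hpq rfl).symm⟩)
  have h2 : (Dset.image s).card ≤ Dset.card := Finset.card_image_le
  omega

theorem coords_exist (u : E3) (hu : u ≠ 0) (Wf : Finset E3) : ∃ a b c : E3 →ₗ[ℝ] ℝ,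
    (∀ w, a w = 0 → b w = 0 → w = (c w) • u) ∧ a u = 0 ∧ b u = 0 ∧ c u = 1 ∧
    (∀ w ∈ Wf, a w = 0 → b w = 0) ∧ ∃ w, a w = 0 ∧ b w = 1 := by
  obtain ⟨e, he⟩ := SeparatingDual.exists_continuousLinearEquiv_apply_eq (R := ℝ) hu
    (show (EuclideanSpace.single (2 : Fin 3) (1 : ℝ)) ≠ 0 by
      intro h
      have := congrArg (fun v : E3 => v 2) h
      simp at this)
  let pr : Fin 3 → E3 →ₗ[ℝ] ℝ := fun i => (EuclideanSpace.proj (𝕜 := ℝ) i : E3 →L[ℝ] ℝ).toLinearMap ∘ₗ e.toLinearMap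
  have hpr : ∀ i w, pr i w = e w i := fun i w => rfl
  obtain ⟨t, ht⟩ := Infinite.exists_notMem_finset (Wf.image (fun w => -(pr 0 w) / (pr 1 w)))
  refine ⟨pr 0 + t • pr 1, pr 1, pr 2, ?_, ?_, ?_, ?_, ?_, ?_⟩
  · intro w h0 h1
    have h0' : pr 0 w = 0 := by
      have : pr 0 w + t * pr 1 w = 0 := h0
      rw [h1] at this; linarith
    apply e.injective
    rw [map_smul, he]
    ext i
    rw [hpr] at h0' h1 ⊢
    fin_cases i <;> simp [h0', h1]
  · simp [hpr, he]
  · simp [hpr, he]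
  · simp [hpr, he]
  · intro w hw h0
    by_contra h1
    apply ht
    refine Finset.mem_image.mpr ⟨w, hw, ?_⟩
    have : pr 0 w + t * pr 1 w = 0 := h0
    field_simp
    linarith
  · refine ⟨e.symm (EuclideanSpace.single (1 : Fin 3) (1 : ℝ) - t • EuclideanSpace.single (0 : Fin 3) (1 : ℝ)), ?_, ?_⟩
    · simp [hpr]
    · simp [hpr]
end

section
open scoped Classical

/-- points of `P` on the line through `q` in direction `u` -/
noncomputable def linePts (P : Finset E3) (q u : E3) : Finset E3 := P.filter (fun p => ∃ t : ℝ, p = q + t • u)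

/-- `P` is not contained in a plane -/
def Spans (P : Finset E3) : Prop := ∀ (f : E3 →ₗ[ℝ] ℝ) (c : ℝ), f ≠ 0 → ∃ p ∈ P, f p ≠ c

theorem caseB_dirs (P : Finset E3) (hP : Spans P) (o u : E3) (hu : u ≠ 0) (l : ℕ) (hoP : o ∈ P)
    (hl : (linePts P o u).card = l) (hl2 : 2 ≤ l) (hmax : ∀ q ∈ P, (linePts P q u).card ≤ l) :
    ∃ s : ℕ, 2 * P.card ≤ (dirs P).card + 2 * s + 2 * l ∧ s * l ≤ (dirs P).card + 2 * s := by
  obtain ⟨a, b, c, hker, hau, hbu, hcu, hgen, w1, hw1a, hw1b⟩ := coords_exist u hu (P.offDiag.image (fun z => z.1 - z.2))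
  set A : E3 → ℝ := fun p => a (p - o) with hA
  set B : E3 → ℝ := fun p => b (p - o) with hB
  have hAs : ∀ p q, a (p - q) = A p - A q := fun p q => by simp [hA]
  have hBs : ∀ p q, b (p - q) = B p - B q := fun p q => by simp [hB]
  have hAo : A o = 0 := by simp [hA]
  have hBo : B o = 0 := by simp [hB]
  have hAB : ∀ p ∈ P, ∀ q ∈ P, A p = A q → B p = B q := by
    intro p hp q hq h
    by_cases hpq : p = q
    · rw [hpq]
    have := hgen (p - q) (Finset.mem_image.mpr ⟨(p, q), Finset.mem_offDiag.mpr ⟨hp, hq, hpq⟩, rfl⟩) (by rw [hAs, h, sub_self])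
    rw [hBs] at this; linarith
  have hcol : ∀ p ∈ P, ∀ q ∈ P, A p = A q → p = q + (c (p - q)) • u := by
    intro p hp q hq h
    have := hker (p - q) (by rw [hAs, h, sub_self]) (by rw [hBs, hAB p hp q hq h, sub_self])
    rw [← this]; abel
  have hline : ∀ q ∈ P, linePts P q u = P.filter (fun p => A p = A q) := by
    intro q hq
    ext p
    simp only [linePts, Finset.mem_filter]
    refine and_congr_right fun hp => ⟨?_, fun h => ⟨_, hcol p hp q hq h⟩⟩
    rintro ⟨t, rfl⟩
    simp [hA, hau]
  have hparam : ∀ p ∈ P, ∀ q ∈ P, p ≠ q → A p = A q → Submodule.span ℝ {p - q} = Submodule.span ℝ {u} := by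
    intro p hp q hq hpq h
    have h1 := hker (p - q) (by rw [hAs, h, sub_self]) (by rw [hBs, hAB p hp q hq h, sub_self])
    rw [h1]
    apply span_smul_eq
    intro h0
    rw [h0, zero_smul] at h1
    exact hpq (sub_eq_zero.mp h1)
  -- weights
  set w : ℝ → ℕ := fun z => (P.filter (fun p => A p = z)).card with hw
  have hwl : ∀ z, w z ≤ l := by
    intro z
    by_cases h : ∃ q ∈ P, A q = z
    · obtain ⟨q, hq, rfl⟩ := h
      rw [hw]; simp only
      rw [← hline q hq]; exact hmax q hq
    · have : P.filter (fun p => A p = z) = ∅ := by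
        rw [Finset.filter_eq_empty_iff]; intro q hq hz; exact h ⟨q, hq, hz⟩
      simp [hw, this]
  have hw0 : w 0 = l := by rw [← hl, hline o hoP, hAo]
  have hβ : ∀ z : ℝ, ∃ y : ℝ, ∀ p ∈ P, A p = z → B p = y := by
    intro z
    by_cases h : ∃ q ∈ P, A q = z
    · obtain ⟨q, hq, rfl⟩ := h
      exact ⟨B q, fun p hp h => hAB p hp q hq h⟩
    · exact ⟨0, fun p hp hz => (h ⟨p, hp, hz⟩).elim⟩
  choose β hβ using hβ
  have hβ' : ∀ p ∈ P, β (A p) = B p := fun p hp => (hβ _ p hp rfl).symm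
  -- angle of a direction
  have hθ : ∀ U : Submodule ℝ E3, ∃ y : ℝ, ∀ v, a v ≠ 0 → Submodule.span ℝ {v} = U → b v / a v = y := by
    intro U
    by_cases h : ∃ v, a v ≠ 0 ∧ Submodule.span ℝ {v} = U
    · obtain ⟨v, hv, rfl⟩ := h
      refine ⟨b v / a v, fun v' hv' h' => ?_⟩
      obtain ⟨t, ht, rfl⟩ := span_eq_iff h'.symm
      simp only [map_smul, smul_eq_mul]
      field_simp
    · exact ⟨0, fun v hv hU => (h ⟨v, hv, hU⟩).elim⟩
  choose θ hθ using hθ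
  have hθs : ∀ p q, A p ≠ A q → θ (Submodule.span ℝ {p - q}) = (B p - B q) / (A p - A q) := by
    intro p q h
    rw [← hAs, ← hBs, hθ _ (p - q) (by rw [hAs]; exact sub_ne_zero.mpr h) rfl]
  set D' := (dirs P).filter (fun U => U ≠ Submodule.span ℝ {u}) with hD'
  have hmemD : ∀ p ∈ P, ∀ q ∈ P, A p ≠ A q → Submodule.span ℝ {p - q} ∈ D' := by
    intro p hp q hq h
    rw [hD', Finset.mem_filter]
    refine ⟨mem_dirs.mpr ⟨p, hp, q, hq, fun e => h (by rw [e]), rfl⟩, fun e => ?_⟩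
    obtain ⟨t, ht, h1⟩ := span_eq_iff e.symm
    apply h
    have := congrArg a h1
    rw [hAs, map_smul, hau] at this
    simp at this; linarith
  set Θ := D'.image θ with hΘ
  set K : ℝ → ℕ := fun y => (D'.filter (fun U => θ U = y)).card with hK
  have hKsum : D'.card = ∑ y ∈ Θ, K y := Finset.card_eq_sum_card_image θ D'
  set P0 := P.filter (fun p => A p ≠ 0) with hP0
  set ΘL := P0.image (fun p => B p / A p) with hΘL
  have hP0card : P0.card + l = P.card := by
    have := Finset.card_filter_add_card_filter_not (s := P) (fun p => A p = 0)
    have h2 : (P.filter (fun p => A p = 0)).card = l := hw0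
    have h3 : (P.filter (fun p => ¬ A p = 0)).card = P0.card := rfl
    omega
  have hΘLsub : ΘL ⊆ Θ := by
    intro y hy
    obtain ⟨p, hp, rfl⟩ := Finset.mem_image.mp hy
    rw [Finset.mem_filter] at hp
    have hne : A p ≠ A o := by rw [hAo]; exact hp.2
    refine Finset.mem_image.mpr ⟨_, hmemD p hp.1 o hoP hne, ?_⟩
    rw [hθs p o hne, hAo, hBo, sub_zero, sub_zero]
  -- in-plane count
  have hin : ∀ y ∈ ΘL, (P0.filter (fun p => B p / A p = y)).card + l ≤ K y + 2 := by
    intro y hy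
    set As := P.filter (fun p => B p = y * A p) with hAsdef
    have hsplit : As.card = (P0.filter (fun p => B p / A p = y)).card + l := by
      have := Finset.card_filter_add_card_filter_not (s := As) (fun p => A p = 0)
      have e1 : As.filter (fun p => A p = 0) = P.filter (fun p => A p = 0) := by
        ext p
        simp only [hAsdef, Finset.mem_filter]
        constructor
        · rintro ⟨⟨h1, h2⟩, h3⟩; exact ⟨h1, h3⟩
        · rintro ⟨h1, h2⟩
          refine ⟨⟨h1, ?_⟩, h2⟩
          rw [h2, mul_zero, ← hBo]
          exact hAB p h1 o hoP (by rw [h2, hAo])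
      have e2 : As.filter (fun p => ¬ A p = 0) = P0.filter (fun p => B p / A p = y) := by
        ext p
        simp only [hAsdef, hP0, Finset.mem_filter]
        constructor
        · rintro ⟨⟨h1, h2⟩, h3⟩
          exact ⟨⟨h1, h3⟩, by rw [h2]; field_simp⟩
        · rintro ⟨⟨h1, h2⟩, h3⟩
          refine ⟨⟨h1, ?_⟩, h2⟩
          rw [← h3]; field_simp
      rw [e1, e2] at this
      have h2 : (P.filter (fun p => A p = 0)).card = l := hw0
      omega
    have hung := ungar_lab As A (fun p => c (p - o)) (by
      intro p hp q hq h1 h2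
      rw [Finset.mem_filter] at hp hq
      have h3 := hcol p hp.1 q hq.1 h1
      have h4 : c (p - q) = 0 := by
        have : p - q = (p - o) - (q - o) := by abel
        rw [this, map_sub, h2, sub_self]
      rw [h4, zero_smul, add_zero] at h3
      exact h3) (by
      intro a' b' c' hab
      by_contra hcon
      push Not at hcon
      have hoA : o ∈ As := by rw [Finset.mem_filter]; exact ⟨hoP, by rw [hAo, hBo, mul_zero]⟩
      have h0 := hcon o hoA
      simp only [hAo, sub_self, map_zero, mul_zero, add_zero] at h0
      obtain ⟨p1, hp1, hne⟩ : ∃ p1 ∈ linePts P o u, p1 ≠ o := Finset.exists_mem_ne (by omega) o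
      rw [hline o hoP, Finset.mem_filter, hAo] at hp1
      have hp1A : p1 ∈ As := by
        rw [Finset.mem_filter]; refine ⟨hp1.1, ?_⟩
        rw [hp1.2, mul_zero, ← hBo]; exact hAB _ hp1.1 _ hoP (by rw [hp1.2, hAo])
      have h1 := hcon p1 hp1A
      rw [hp1.2, ← h0, mul_zero, zero_add] at h1
      have hcne : c (p1 - o) ≠ 0 := by
        intro h
        have := hcol p1 hp1.1 o hoP (by rw [hp1.2, hAo])
        rw [h, zero_smul, add_zero] at this
        exact hne this
      have hb0 : b' = 0 := by
        rcases mul_eq_zero.mp h1 with h | h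
        · exact h
        · exact (hcne h).elim
      obtain ⟨p2, hp2, he⟩ := Finset.mem_image.mp hy
      rw [Finset.mem_filter] at hp2
      have h2 := hcon p2 (by
        rw [Finset.mem_filter]
        have := hp2.2
        exact ⟨hp2.1, by rw [← he]; field_simp⟩)
      rw [hb0, ← h0, zero_mul, add_zero] at h2
      rcases mul_eq_zero.mp h2 with h | h
      · rcases hab with h' | h'
        · exact h' h
        · exact h' hb0
      · exact hp2.2 h) (fun p q => Submodule.span ℝ {p - q}) (by
      intro p _ q _ _ p' _ q' _ _ h
      obtain ⟨t, ht, h1⟩ := span_eq_iff h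
      have e1 : A p' - A q' = t * (A p - A q) := by rw [← hAs, ← hAs, h1, map_smul, smul_eq_mul]
      have e2 : c (p' - o) - c (q' - o) = t * (c (p - o) - c (q - o)) := by
        rw [← map_sub, ← map_sub, sub_sub_sub_cancel_right, sub_sub_sub_cancel_right, h1, map_smul, smul_eq_mul]
      rw [e1, e2]; ring) (insert (Submodule.span ℝ {u}) (D'.filter (fun U => θ U = y))) (by
      intro p hp q hq hpq
      rw [Finset.mem_filter] at hp hq
      by_cases h : A p = A q
      · exact Finset.mem_insert.mpr (Or.inl (hparam p hp.1 q hq.1 hpq h))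
      · apply Finset.mem_insert_of_mem
        rw [Finset.mem_filter]
        refine ⟨hmemD p hp.1 q hq.1 h, ?_⟩
        rw [hθs p q h, hp.2, hq.2]
        have : A p - A q ≠ 0 := sub_ne_zero.mpr h
        field_simp)
    have hins := Finset.card_insert_le (Submodule.span ℝ {u}) (D'.filter (fun U => θ U = y))
    have : (D'.filter (fun U => θ U = y)).card = K y := rfl
    omega
  have hinsum : P0.card + ΘL.card * l ≤ ∑ y ∈ ΘL, K y + 2 * ΘL.card := by
    have h1 : P0.card = ∑ y ∈ ΘL, (P0.filter (fun p => B p / A p = y)).card := Finset.card_eq_sum_card_image _ _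
    have h2 := Finset.sum_le_sum hin
    rw [Finset.sum_add_distrib, Finset.sum_add_distrib, ← h1] at h2
    simp only [Finset.sum_const, smul_eq_mul] at h2
    linarith
  -- many directions over an angle
  have hKt : ∀ z : ℝ, ∀ q ∈ P, A q ≠ z → 1 ≤ w z →
      (β z - B q) / (z - A q) ∈ Θ ∧ w z ≤ K ((β z - B q) / (z - A q)) := by
    intro z q hq hqz hwz
    have hθz : ∀ p ∈ P, A p = z → Submodule.span ℝ {p - q} ∈ D'.filter (fun U => θ U = (β z - B q) / (z - A q)) := by
      intro p hp hpz
      have hne : A p ≠ A q := by rw [hpz]; exact hqz.symm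
      rw [Finset.mem_filter]
      refine ⟨hmemD p hp q hq hne, ?_⟩
      rw [hθs p q hne, ← hpz, hβ' p hp]
    constructor
    · obtain ⟨p, hp⟩ := Finset.card_pos.mp hwz
      rw [Finset.mem_filter] at hp
      have := Finset.mem_filter.mp (hθz p hp.1 hp.2)
      exact Finset.mem_image.mpr ⟨_, this.1, this.2⟩
    · apply Finset.card_le_card_of_injOn (fun p => Submodule.span ℝ {p - q})
      · intro p hp
        rw [Finset.mem_coe, Finset.mem_filter] at hp
        exact hθz p hp.1 hp.2
      · intro p hp p' hp' h
        rw [Finset.mem_coe, Finset.mem_filter] at hp hp'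
        obtain ⟨t, ht, h1⟩ := span_eq_iff h
        have e1 : A p' - A q = t * (A p - A q) := by rw [← hAs, ← hAs, h1, map_smul, smul_eq_mul]
        rw [hp.2, hp'.2] at e1
        have : t = 1 := by
          have hz : z - A q ≠ 0 := sub_ne_zero.mpr hqz.symm
          have : (t - 1) * (z - A q) = 0 := by linarith
          rcases mul_eq_zero.mp this with h | h
          · linarith
          · exact (hz h).elim
        rw [this, one_smul] at h1
        exact (sub_left_injective h1).symm
  set Z := (P.image A).erase 0 with hZ
  have hQ : ∀ t ∈ Finset.Icc 1 l, (Z.filter (fun z => t ≤ w z)).card ≤ (Θ.filter (fun y => t ≤ K y)).card := by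
    intro t ht
    rw [Finset.mem_Icc] at ht
    set Q := Z.filter (fun z => t ≤ w z) with hQdef
    have hQP : ∀ z ∈ Q, ∃ p ∈ P, A p = z := by
      intro z hz
      obtain ⟨p, hp, h⟩ := Finset.mem_image.mp (Finset.mem_of_mem_erase (Finset.mem_filter.mp hz).1)
      exact ⟨p, hp, h⟩
    have hQ0 : ∀ z ∈ Q, z ≠ 0 := fun z hz => (Finset.mem_erase.mp (Finset.mem_filter.mp hz).1).1
    have hβ0 : β 0 = 0 := by
      have h := hβ' o hoP
      rw [hAo, hBo] at h; exact h
    have hQw : ∀ z ∈ Q, t ≤ w z := fun z hz => (Finset.mem_filter.mp hz).2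
    have hslope : ∀ z ∈ Q, ∀ q ∈ P, A q ≠ z → (β z - B q) / (z - A q) ∈ Θ.filter (fun y => t ≤ K y) := by
      intro z hz q hq hne
      have := hKt z q hq hne (ht.1.trans (hQw z hz))
      exact Finset.mem_filter.mpr ⟨this.1, (hQw z hz).trans this.2⟩
    by_cases hcl : ∀ a' c', ∃ z ∈ insert 0 Q, β z ≠ c' + a' * z
    · have := ungar (insert 0 Q) (fun z => z) β (fun _ _ _ _ h => h) hcl (Θ.filter (fun y => t ≤ K y)) (by
        have hins : ∀ z ∈ insert 0 Q, ∃ p ∈ P, A p = z := by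
          intro z hz
          rcases Finset.mem_insert.mp hz with rfl | h
          · exact ⟨o, hoP, hAo⟩
          · exact hQP z h
        have hone : ∀ z ∈ Q, ∀ z' ∈ insert 0 Q, z ≠ z' → (β z - β z') / (z - z') ∈ Θ.filter (fun y => t ≤ K y) := by
          intro z hz z' hz' hne
          obtain ⟨q, hq, rfl⟩ := hins z' hz'
          rw [hβ' q hq]
          exact hslope z hz q hq hne.symm
        intro z hz z' hz' hne
        rcases Finset.mem_insert.mp hz with h | h
        · rcases Finset.mem_insert.mp hz' with h' | h'
          · exact (hne (h.trans h'.symm)).elim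
          · have := hone z' h' z hz hne.symm
            rwa [← neg_sub (β z), ← neg_sub z, neg_div_neg_eq] at this
        · exact hone z h z' hz' hne)
      rw [Finset.card_insert_of_notMem (fun h => hQ0 0 h rfl)] at this
      omega
    · push Not at hcl
      obtain ⟨a', c', hline'⟩ := hcl
      have hc0 : c' = 0 := by
        have := hline' 0 (Finset.mem_insert_self _ _)
        rw [hβ0] at this; linarith
      have hl' : ∀ z ∈ Q, β z = a' * z := by
        intro z hz
        rw [hline' z (Finset.mem_insert_of_mem hz), hc0, zero_add]
      obtain ⟨χ, hχ, hχne⟩ := hP (b - a' • a) (b o - a' * a o) (by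
        intro h
        have := congrArg (fun f : E3 →ₗ[ℝ] ℝ => f w1) h
        simp [hw1a, hw1b] at this)
      have hχ' : B χ ≠ a' * A χ := by
        intro h
        apply hχne
        simp only [hA, hB, map_sub] at h
        simp only [LinearMap.sub_apply, LinearMap.smul_apply, smul_eq_mul]
        linarith
      have hχz : ∀ z ∈ Q, A χ ≠ z := by
        intro z hz h
        apply hχ'
        rw [← hβ' χ hχ, h, hl' z hz]
      apply Finset.card_le_card_of_injOn (fun z => (β z - B χ) / (z - A χ))
      · intro z hz
        exact hslope z hz χ hχ (hχz z hz)
      · intro z hz z' hz' h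
        simp only at h
        rw [hl' z hz, hl' z' hz', div_eq_div_iff (sub_ne_zero.mpr (hχz z hz).symm) (sub_ne_zero.mpr (hχz z' hz').symm)] at h
        have : (z - z') * (B χ - a' * A χ) = 0 := by linear_combination h
        rcases mul_eq_zero.mp this with h | h
        · linarith
        · exact (hχ' (by linarith)).elim
  have hlayer : ∑ t ∈ Finset.Icc 1 l, (Z.filter (fun z => t ≤ w z)).card = P0.card := by
    have h1 : P0.card = ∑ z ∈ Z, w z := by
      have : P0.image A ⊆ Z := by
        intro z hz
        obtain ⟨p, hp, rfl⟩ := Finset.mem_image.mp hz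
        rw [Finset.mem_filter] at hp
        exact Finset.mem_erase.mpr ⟨hp.2, Finset.mem_image_of_mem _ hp.1⟩
      rw [Finset.card_eq_sum_card_fiberwise (f := A) (t := Z) (fun p hp => this (Finset.mem_image_of_mem _ hp))]
      apply Finset.sum_congr rfl
      intro z hz
      rw [hw]; simp only
      congr 1
      ext p
      simp only [hP0, Finset.mem_filter]
      have := (Finset.mem_erase.mp hz).1
      constructor
      · rintro ⟨⟨h1, h2⟩, h3⟩; exact ⟨h1, h3⟩
      · rintro ⟨h1, h3⟩; exact ⟨⟨h1, by rw [h3]; exact this⟩, h3⟩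
    rw [h1]
    simp only [Finset.card_filter]
    rw [Finset.sum_comm]
    apply Finset.sum_congr rfl
    intro z _
    rw [← Finset.card_filter]
    have : (Finset.Icc 1 l).filter (fun t => t ≤ w z) = Finset.Icc 1 (w z) := by
      ext t
      simp only [Finset.mem_filter, Finset.mem_Icc]
      have := hwl z
      omega
    rw [this, Nat.card_Icc]; omega
  have hout : P0.card ≤ ∑ y ∈ Θ \ ΘL, K y + ΘL.card * l := by
    have h1 : ∀ t ∈ Finset.Icc 1 l, (Z.filter (fun z => t ≤ w z)).card ≤ ((Θ \ ΘL).filter (fun y => t ≤ K y)).card + ΘL.card := by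
      intro t ht
      refine (hQ t ht).trans ((Finset.card_le_card ?_).trans (Finset.card_union_le _ _))
      intro y hy
      rw [Finset.mem_filter] at hy
      by_cases h : y ∈ ΘL
      · exact Finset.mem_union_right _ h
      · exact Finset.mem_union_left _ (Finset.mem_filter.mpr ⟨Finset.mem_sdiff.mpr ⟨hy.1, h⟩, hy.2⟩)
    have h2 := Finset.sum_le_sum h1
    rw [hlayer, Finset.sum_add_distrib, Finset.sum_const, Nat.card_Icc, smul_eq_mul] at h2
    have h3 : ∑ t ∈ Finset.Icc 1 l, ((Θ \ ΘL).filter (fun y => t ≤ K y)).card ≤ ∑ y ∈ Θ \ ΘL, K y := by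
      simp only [Finset.card_filter]
      rw [Finset.sum_comm]
      apply Finset.sum_le_sum
      intro y _
      rw [← Finset.card_filter]
      calc _ ≤ (Finset.Icc 1 (K y)).card := by
            apply Finset.card_le_card
            intro t ht
            simp only [Finset.mem_filter, Finset.mem_Icc] at ht ⊢
            omega
        _ = K y := by rw [Nat.card_Icc]; omega
    have h4 : l + 1 - 1 = l := by omega
    rw [h4, mul_comm l] at h2
    omega
  have hDle : D'.card ≤ (dirs P).card := Finset.card_filter_le _ _
  have hΘsum := Finset.sum_sdiff (f := K) hΘLsub
  refine ⟨ΘL.card, ?_, ?_⟩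
  · omega
  · omega
end

section
open scoped Classical

theorem caseB {N : NormOn3} (hN : GoodN N) (P : Finset E3) (hP : Spans P) (o u : E3) (hu : u ≠ 0) (l : ℕ) (hoP : o ∈ P)
    (hl : (linePts P o u).card = l) (hmax : ∀ q ∈ P, (linePts P q u).card ≤ l) (E : ℕ) (hE : 1 ≤ E)
    (hn : 11 * (24 * E) ^ 4 ≤ P.card) (hl1 : 40 * E + 2 ≤ l) (hl2 : 8 * E * l ≤ P.card) :
    2 * E * P.card < E * (dsts N P).card + P.card := by
  by_contra hcon
  push Not at hcon
  have hn0 : 0 < P.card := by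
    have : 0 < 11 * (24 * E) ^ 4 := by positivity
    omega
  have hm : (dsts N P).card ≤ 2 * P.card := by
    have : E * (dsts N P).card ≤ E * (2 * P.card) := by nlinarith
    exact Nat.le_of_mul_le_mul_left this (by omega)
  have hk := dirs_le hN P
  have hBL := BL hN P (24 * E) (by omega) hn hm
  obtain ⟨s, h1, h2⟩ := caseB_dirs P hP o u hu l hoP hl (by omega) hmax
  generalize (dirs P).card = k at *
  generalize (dsts N P).card = m at *
  generalize P.card = n at *
  have h3 : s * (40 * E) ≤ 5 * n := by
    obtain ⟨j, rfl⟩ := Nat.exists_eq_add_of_le hl1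
    nlinarith
  have h4 : 24 * E * (2 * n) ≤ 24 * E * (k + 2 * s + 2 * l) := Nat.mul_le_mul_left _ h1
  nlinarith
end

section
open scoped Classical

theorem hitg {ι α : Type*} (I : Finset ι) (X : Finset α) (F : ι → Finset α) (a s : ℕ)
    (hF : ∀ i ∈ I, F i ⊆ X) (g : ℕ) (ha : ∀ i ∈ I, X.card + a * (g * s) < a * (F i).card) :
    ∃ S : Finset α, S ⊆ X ∧ S.card ≤ g * s ∧
      (I.filter (fun i => (F i ∩ S).card < g)).card * (a + s) ≤ g * (I.card * a) := by
  induction g with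
  | zero => exact ⟨∅, by simp, by simp, by simp⟩
  | succ g ih =>
    obtain ⟨S, hS, hSc, hu⟩ := ih (fun i hi => by
      have := ha i hi
      have h2 : a * (g * s) ≤ a * ((g + 1) * s) := by gcongr; omega
      omega)
    have hc : ∀ i ∈ I, X.card < a * (F i \ S).card := by
      intro i hi
      have h1 := ha i hi
      have h2 : (F i).card ≤ (F i \ S).card + S.card := by
        have := Finset.card_le_card_sdiff_add_card (s := F i) (t := S)
        omega
      have h3 : a * (F i).card ≤ a * ((F i \ S).card + g * s) := by gcongr; omega
      have h4 : a * (g * s) ≤ a * ((g + 1) * s) := by gcongr; omega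
      rw [mul_add] at h3
      omega
    obtain ⟨S', hS', hSc', hu'⟩ := hit_lemma I X (fun i => F i \ S) a
      (fun i hi => Finset.sdiff_subset.trans (hF i hi)) (fun i hi => by
        rw [Finset.nonempty_iff_ne_empty]
        intro h
        have h0 := hc i hi
        rw [h] at h0; simp at h0) (fun i hi => (hc i hi).le) s
    refine ⟨S ∪ S', Finset.union_subset hS hS', (Finset.card_union_le _ _).trans (by rw [add_mul]; omega), ?_⟩
    have hsub : I.filter (fun i => (F i ∩ (S ∪ S')).card < g + 1) ⊆
        I.filter (fun i => (F i ∩ S).card < g) ∪ I.filter (fun i => Disjoint (F i \ S) S') := by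
      intro i hi
      rw [Finset.mem_filter] at hi
      rw [Finset.mem_union, Finset.mem_filter, Finset.mem_filter]
      by_contra hcon
      push Not at hcon
      have h1 := hcon.1 hi.1
      have h2 := hcon.2 hi.1
      rw [Finset.not_disjoint_iff] at h2
      obtain ⟨x, hx, hx'⟩ := h2
      rw [Finset.mem_sdiff] at hx
      have : insert x (F i ∩ S) ⊆ F i ∩ (S ∪ S') := by
        intro y hy
        rcases Finset.mem_insert.mp hy with rfl | h
        · exact Finset.mem_inter.mpr ⟨hx.1, Finset.mem_union_right _ hx'⟩
        · rw [Finset.mem_inter] at h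
          exact Finset.mem_inter.mpr ⟨h.1, Finset.mem_union_left _ h.2⟩
      have h3 := Finset.card_le_card this
      rw [Finset.card_insert_of_notMem (fun h => hx.2 (Finset.mem_inter.mp h).2)] at h3
      omega
    have h5 := (Finset.card_le_card hsub).trans (Finset.card_union_le _ _)
    calc _ ≤ ((I.filter (fun i => (F i ∩ S).card < g)).card + (I.filter (fun i => Disjoint (F i \ S) S')).card) * (a + s) := by gcongr
      _ ≤ _ := by rw [add_mul, add_mul]; linarith

theorem inter_mem (F : Subfield ℝ) (w1 w2 r1 r2 p : E3) (hw1 : w1 ≠ 0) (hw2 : w2 ≠ 0)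
    (hne : Submodule.span ℝ {w1} ≠ Submodule.span ℝ {w2}) (h1 : ∀ j, w1 j ∈ F) (h2 : ∀ j, w2 j ∈ F)
    (hr1 : ∀ j, r1 j ∈ F) (hr2 : ∀ j, r2 j ∈ F) (t1 t2 : ℝ) (hp1 : p = r1 + t1 • w1) (hp2 : p = r2 + t2 • w2) :
    ∀ j, p j ∈ F := by
  have hmin : ∃ i j, w1 i * w2 j - w1 j * w2 i ≠ 0 := by
    by_contra hcon
    push Not at hcon
    obtain ⟨i, hi⟩ : ∃ i, w1 i ≠ 0 := by
      by_contra hc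
      push Not at hc
      exact hw1 (by ext j; exact hc j)
    have h : w2 = (w2 i / w1 i) • w1 := by
      ext j
      simp only [PiLp.smul_apply, smul_eq_mul]
      have := hcon i j
      field_simp
      linarith
    have h0 : w2 i / w1 i ≠ 0 := by
      intro h0
      rw [h0, zero_smul] at h
      exact hw2 h
    apply hne
    rw [h, span_smul_eq h0]
  obtain ⟨i, j, hij⟩ := hmin
  have hc : ∀ k, r1 k + t1 * w1 k = r2 k + t2 * w2 k := by
    intro k
    have := congrArg (fun v : E3 => v k) (hp1.symm.trans hp2)
    simpa using this
  have ht1 : t1 = ((r2 i - r1 i) * w2 j - (r2 j - r1 j) * w2 i) / (w1 i * w2 j - w1 j * w2 i) := by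
    rw [eq_div_iff hij]
    linear_combination w2 j * hc i - w2 i * hc j
  have ht1F : t1 ∈ F := by
    rw [ht1]
    exact F.div_mem (F.sub_mem (F.mul_mem (F.sub_mem (hr2 i) (hr1 i)) (h2 j)) (F.mul_mem (F.sub_mem (hr2 j) (hr1 j)) (h2 i)))
      (F.sub_mem (F.mul_mem (h1 i) (h2 j)) (F.mul_mem (h1 j) (h2 i)))
  intro k
  rw [hp1]
  simp only [PiLp.add_apply, PiLp.smul_apply, smul_eq_mul]
  exact F.add_mem (hr1 k) (F.mul_mem ht1F (h1 k))

/-- directions from `p` to the points of `Q` -/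
noncomputable def dirsFrom (Q : Finset E3) (p : E3) : Finset (Submodule ℝ E3) :=
  (Q.erase p).image (fun q => Submodule.span ℝ {q - p})

theorem dirsFrom_sub {P : Finset E3} {p} (hp : p ∈ P) : dirsFrom P p ⊆ dirs P := by
  intro U hU
  obtain ⟨q, hq, rfl⟩ := Finset.mem_image.mp hU
  rw [Finset.mem_erase] at hq
  exact mem_dirs.mpr ⟨q, hq.2, p, hp, hq.1, rfl⟩

theorem dirsFrom_card {P : Finset E3} {p} (hp : p ∈ P) (K : ℕ)
    (hK : ∀ q ∈ P, ∀ u : E3, u ≠ 0 → (linePts P q u).card ≤ K) : P.card ≤ K * (dirsFrom P p).card + 1 := by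
  have h1 : (P.erase p).card ≤ K * (dirsFrom P p).card := by
    apply Finset.card_le_mul_card_image
    intro U hU
    obtain ⟨q, hq, rfl⟩ := Finset.mem_image.mp hU
    rw [Finset.mem_erase] at hq
    refine (Finset.card_le_card ?_).trans (hK p hp (q - p) (sub_ne_zero.mpr hq.1))
    intro q' hq'
    rw [Finset.mem_filter, Finset.mem_erase] at hq'
    obtain ⟨t, -, ht⟩ := span_eq_iff hq'.2.symm
    refine Finset.mem_filter.mpr ⟨hq'.1.2, t, ?_⟩
    rw [← ht]; abel
  rw [Finset.card_erase_of_mem hp] at h1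
  omega

/-- nonzero representative vector for each member of `dirs P` -/
theorem exists_reps (P : Finset E3) : ∃ w : Submodule ℝ E3 → E3, ∀ U ∈ dirs P, w U ≠ 0 ∧ Submodule.span ℝ {w U} = U := by
  have : ∀ U : Submodule ℝ E3, ∃ w : E3, U ∈ dirs P → w ≠ 0 ∧ Submodule.span ℝ {w} = U := by
    intro U
    by_cases hU : U ∈ dirs P
    · obtain ⟨p, hp, q, hq, hne, h⟩ := mem_dirs.mp hU
      exact ⟨p - q, fun _ => ⟨sub_ne_zero.mpr hne, h⟩⟩
    · exact ⟨0, fun h => (hU h).elim⟩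
  choose w hw using this
  exact ⟨w, hw⟩

theorem inter_dirs (F : Subfield ℝ) (w : Submodule ℝ E3 → E3) (U1 U2 : Submodule ℝ E3) (hU : U1 ≠ U2)
    (h1 : w U1 ≠ 0 ∧ Submodule.span ℝ {w U1} = U1) (h2 : w U2 ≠ 0 ∧ Submodule.span ℝ {w U2} = U2)
    (h1F : ∀ j, w U1 j ∈ F) (h2F : ∀ j, w U2 j ∈ F) (r1 r2 p : E3)
    (hr1 : ∀ j, r1 j ∈ F) (hr2 : ∀ j, r2 j ∈ F) (hp1 : Submodule.span ℝ {r1 - p} = U1) (hp2 : Submodule.span ℝ {r2 - p} = U2) :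
    ∀ j, p j ∈ F := by
  obtain ⟨t1, -, e1⟩ := span_eq_iff (h1.2.trans hp1.symm)
  obtain ⟨t2, -, e2⟩ := span_eq_iff (h2.2.trans hp2.symm)
  refine inter_mem F (w U1) (w U2) r1 r2 p h1.1 h2.1 (by rw [h1.2, h2.2]; exact hU) h1F h2F hr1 hr2 (-t1) (-t2) ?_ ?_
  · rw [neg_smul, ← e1]; abel
  · rw [neg_smul, ← e2]; abel
end

section
open scoped Classical

theorem fieldA (K B : ℕ) (hK : 1 ≤ K) (hB : 1 ≤ B) : ∃ n0 : ℕ, ∀ P : Finset E3, n0 ≤ P.card → (dirs P).card ≤ 5 * P.card →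
    (∀ q ∈ P, ∀ u : E3, u ≠ 0 → (linePts P q u).card ≤ K) →
    ∃ X : Finset ℝ, B * X.card ≤ P.card ∧ ∀ p ∈ P, ∀ j, p j ∈ Subfield.closure (X : Set ℝ) := by
  obtain ⟨c, hc⟩ : ∃ c, c = 100 * B := ⟨_, rfl⟩
  obtain ⟨h, hh⟩ : ∃ h, h = 400 * B * c := ⟨_, rfl⟩
  obtain ⟨a0, ha0⟩ : ∃ a0, a0 = 10 * K := ⟨_, rfl⟩
  obtain ⟨s0, hs0⟩ : ∃ s0, s0 = 2 * h * a0 * (100 * B) := ⟨_, rfl⟩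
  have hc0 : 0 < c := by omega
  have hh0 : 0 < h := by rw [hh]; positivity
  have hs00 : 0 < s0 := by rw [hs0]; have : 0 < a0 := by omega
                           positivity
  refine ⟨10 + a0 * (2 * h * s0) + h + 2 * c + 12 * B * h * s0 , fun P hn hk hlines => ?_⟩
  obtain ⟨n, hnP⟩ : ∃ n, n = P.card := ⟨_, rfl⟩
  rw [← hnP] at hn hk ⊢
  -- choice of S
  obtain ⟨S, hSsub, hScard, hSexc⟩ := hitg P (dirs P) (fun p => dirsFrom P p) a0 s0 (fun p hp => dirsFrom_sub hp) (2 * h) (by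
    intro p hp
    have h1 := dirsFrom_card hp K hlines
    rw [← hnP] at h1
    have h2 : a0 * (dirsFrom P p).card = 10 * (K * (dirsFrom P p).card) := by rw [ha0]; ring
    rw [h2]
    omega)
  set E0 := P.filter (fun p => (dirsFrom P p ∩ S).card < 2 * h) with hE0
  have hT : ∀ p : E3, ∃ T1 T2 : Finset (Submodule ℝ E3), p ∈ P \ E0 → T1 ⊆ dirsFrom P p ∩ S ∧ T2 ⊆ dirsFrom P p ∩ S ∧
      h ≤ T1.card ∧ h ≤ T2.card ∧ Disjoint T1 T2 := by
    intro p
    by_cases hp : p ∈ P \ E0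
    · rw [Finset.mem_sdiff, hE0, Finset.mem_filter] at hp
      have hcard : 2 * h ≤ (dirsFrom P p ∩ S).card := by
        by_contra hcon
        exact hp.2 ⟨hp.1, by omega⟩
      obtain ⟨T1, hT1, hT1c⟩ := Finset.exists_subset_card_eq (s := dirsFrom P p ∩ S) (n := h) (by omega)
      refine ⟨T1, (dirsFrom P p ∩ S) \ T1, fun _ => ⟨hT1, Finset.sdiff_subset, hT1c.ge, ?_, Finset.disjoint_sdiff⟩⟩
      rw [Finset.card_sdiff_of_subset hT1]; omega
    · exact ⟨∅, ∅, fun h => (hp h).elim⟩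
  choose T1 T2 hT using hT
  have hnb : ∀ (T : E3 → Finset (Submodule ℝ E3)), (∀ p ∈ P \ E0, T p ⊆ dirsFrom P p ∩ S ∧ h ≤ (T p).card) →
      ∃ R ⊆ P, R.card ≤ n / c ∧ 100 * B * ((P \ E0).filter (fun p => ¬ ∃ r ∈ R, r ≠ p ∧ Submodule.span ℝ {r - p} ∈ T p)).card ≤ n := by
    intro T hTT
    have hge : ∀ p ∈ P \ E0, h ≤ (P.filter (fun q => q ≠ p ∧ Submodule.span ℝ {q - p} ∈ T p)).card := by
      intro p hp
      refine (hTT p hp).2.trans ?_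
      refine le_trans (Finset.card_le_card ?_) (Finset.card_image_le (f := fun q => Submodule.span ℝ {q - p}))
      intro U hU
      have := (Finset.mem_inter.mp ((hTT p hp).1 hU)).1
      obtain ⟨q, hq, rfl⟩ := Finset.mem_image.mp this
      rw [Finset.mem_erase] at hq
      exact Finset.mem_image.mpr ⟨q, Finset.mem_filter.mpr ⟨hq.2, hq.1, hU⟩, rfl⟩
    obtain ⟨R, hR, hRc, hRe⟩ := hit_lemma (P \ E0) P (fun p => P.filter (fun q => q ≠ p ∧ Submodule.span ℝ {q - p} ∈ T p)) (n / h + 1)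
      (fun p _ => Finset.filter_subset _ _) (fun p hp => Finset.card_pos.mp (lt_of_lt_of_le hh0 (hge p hp))) (by
        intro p hp
        rw [← hnP]
        calc n ≤ (n / h + 1) * h := by
              have := Nat.lt_div_mul_add (a := n) hh0
              rw [add_mul]; omega
          _ ≤ _ := Nat.mul_le_mul_left _ (hge p hp)) (n / c)
    refine ⟨R, hR, hRc, ?_⟩
    have hcard : ((P \ E0).filter (fun p => ¬ ∃ r ∈ R, r ≠ p ∧ Submodule.span ℝ {r - p} ∈ T p)).card * (n / h + 1 + n / c) ≤ n * (n / h + 1) := by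
      refine le_trans (Nat.mul_le_mul_right _ (Finset.card_le_card ?_)) (hRe.trans (Nat.mul_le_mul_right _ ?_))
      · intro p hp
        rw [Finset.mem_filter] at hp ⊢
        refine ⟨hp.1, ?_⟩
        rw [Finset.disjoint_left]
        intro r hr hrR
        rw [Finset.mem_filter] at hr
        exact hp.2 ⟨r, hrR, hr.2⟩
      · rw [hnP]; exact Finset.card_le_card Finset.sdiff_subset
    generalize ((P \ E0).filter (fun p => ¬ ∃ r ∈ R, r ≠ p ∧ Submodule.span ℝ {r - p} ∈ T p)).card = x at hcard ⊢
    have h1 : n ≤ 2 * c * (n / c) := by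
      have := Nat.lt_div_mul_add (a := n) hc0
      have h2 : c ≤ n / c * c := by
        have : 1 ≤ n / c := by rw [Nat.one_le_div_iff hc0]; omega
        nlinarith
      nlinarith
    have h2 : (n / h + 1) * h ≤ 2 * n := by
      have := Nat.div_mul_le_self n h
      rw [add_mul]; omega
    -- x * (n/c) ≤ n * (n/h+1)
    have h3 : x * (n / c) ≤ n * (n / h + 1) := le_trans (Nat.mul_le_mul_left _ (Nat.le_add_left _ _)) hcard
    have h4 : x * n * h ≤ 4 * c * n * n := by
      calc x * n * h ≤ x * (2 * c * (n / c)) * h := by gcongr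
        _ = 2 * c * h * (x * (n / c)) := by ring
        _ ≤ 2 * c * h * (n * (n / h + 1)) := by gcongr
        _ = 2 * c * n * ((n / h + 1) * h) := by ring
        _ ≤ 2 * c * n * (2 * n) := by gcongr
        _ = _ := by ring
    have hn0 : 0 < n := by omega
    have h5 : (4 * c * n) * (100 * B * x) ≤ (4 * c * n) * n := by
      calc _ = x * n * h := by rw [hh]; ring
        _ ≤ _ := h4
    exact Nat.le_of_mul_le_mul_left h5 (by positivity)
  obtain ⟨R1, hR1, hR1c, hR1e⟩ := hnb T1 (fun p hp => ⟨(hT p hp).1, (hT p hp).2.2.1⟩)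
  obtain ⟨R2, hR2, hR2c, hR2e⟩ := hnb T2 (fun p hp => ⟨(hT p hp).2.1, (hT p hp).2.2.2.1⟩)
  set E1 := (P \ E0).filter (fun p => ¬ ∃ r ∈ R1, r ≠ p ∧ Submodule.span ℝ {r - p} ∈ T1 p) with hE1
  set E2 := (P \ E0).filter (fun p => ¬ ∃ r ∈ R2, r ≠ p ∧ Submodule.span ℝ {r - p} ∈ T2 p) with hE2
  have hE0c : 100 * B * E0.card ≤ n := by
    rw [← hnP] at hSexc
    have h1 : E0.card * s0 ≤ 2 * h * (n * a0) := le_trans (Nat.mul_le_mul_left _ (by omega)) hSexc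
    have h2 : (2 * h * a0) * (100 * B * E0.card) ≤ (2 * h * a0) * n := by
      calc _ = E0.card * s0 := by rw [hs0]; ring
        _ ≤ _ := h1
        _ = _ := by ring
    have : 0 < a0 := by omega
    exact Nat.le_of_mul_le_mul_left h2 (by positivity)
  obtain ⟨w, hw⟩ := exists_reps P
  set A := S.image w ∪ (R1 ∪ R2 ∪ (E0 ∪ E1 ∪ E2)) with hA
  refine ⟨coords A, ?_, ?_⟩
  · have h1 : A.card ≤ S.card + (R1.card + R2.card + (E0.card + E1.card + E2.card)) := by
      refine (Finset.card_union_le _ _).trans (add_le_add Finset.card_image_le ?_)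
      refine (Finset.card_union_le _ _).trans (add_le_add (Finset.card_union_le _ _) ?_)
      refine (Finset.card_union_le _ _).trans (add_le_add (Finset.card_union_le _ _) le_rfl)
    have h2 := coords_card A
    have h3 : 100 * B * (n / c) ≤ n := by rw [← hc]; exact Nat.mul_div_le n c
    have h4 : 100 * B * R1.card ≤ n := le_trans (Nat.mul_le_mul_left _ hR1c) h3
    have h5 : 100 * B * R2.card ≤ n := le_trans (Nat.mul_le_mul_left _ hR2c) h3
    have h6 : 100 * B * S.card ≤ 100 * (B * (2 * h * s0)) := by
      calc 100 * B * S.card ≤ 100 * B * (2 * h * s0) := Nat.mul_le_mul_left _ hScard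
        _ = _ := by ring
    have h7 : 12 * B * h * s0 = 6 * (B * (2 * h * s0)) := by ring
    have h8 : 100 * B * (coords A).card ≤ 3 * (100 * B * S.card + (100 * B * R1.card + 100 * B * R2.card + (100 * B * E0.card + 100 * B * E1.card + 100 * B * E2.card))) := by
      calc _ ≤ 100 * B * (3 * (S.card + (R1.card + R2.card + (E0.card + E1.card + E2.card)))) := by
            apply Nat.mul_le_mul_left; omega
        _ = _ := by ring
    have h9 : 100 * B * (coords A).card = 100 * (B * (coords A).card) := by ring
    omega
  · have hmemA : ∀ x ∈ A, ∀ j, x j ∈ Subfield.closure ((coords A : Finset ℝ) : Set ℝ) := fun x hx j =>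
      Subfield.subset_closure (mem_coords hx j)
    intro p hp
    by_cases hpe : p ∈ E0 ∪ E1 ∪ E2
    · exact hmemA p (by rw [hA]; simp only [Finset.mem_union] at hpe ⊢; tauto)
    simp only [Finset.mem_union, not_or] at hpe
    have hp0 : p ∈ P \ E0 := Finset.mem_sdiff.mpr ⟨hp, hpe.1.1⟩
    have g1 : ∃ r ∈ R1, r ≠ p ∧ Submodule.span ℝ {r - p} ∈ T1 p := by
      by_contra hcon
      exact hpe.1.2 (Finset.mem_filter.mpr ⟨hp0, hcon⟩)
    have g2 : ∃ r ∈ R2, r ≠ p ∧ Submodule.span ℝ {r - p} ∈ T2 p := by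
      by_contra hcon
      exact hpe.2 (Finset.mem_filter.mpr ⟨hp0, hcon⟩)
    obtain ⟨r1, hr1, -, hr1T⟩ := g1
    obtain ⟨r2, hr2, -, hr2T⟩ := g2
    obtain ⟨hTs1, hTs2, -, -, hdis⟩ := hT p hp0
    have hS1 := (Finset.mem_inter.mp (hTs1 hr1T)).2
    have hS2 := (Finset.mem_inter.mp (hTs2 hr2T)).2
    refine inter_dirs _ w _ _ (fun e => ?_) (hw _ (hSsub hS1)) (hw _ (hSsub hS2)) (hmemA _ ?_) (hmemA _ ?_) r1 r2 p (hmemA _ ?_) (hmemA _ ?_) rfl rfl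
    · exact Finset.disjoint_left.mp hdis hr1T (e ▸ hr2T)
    · exact Finset.mem_union_left _ (Finset.mem_image_of_mem _ hS1)
    · exact Finset.mem_union_left _ (Finset.mem_image_of_mem _ hS2)
    · simp only [hA, Finset.mem_union]; tauto
    · simp only [hA, Finset.mem_union]; tauto
end

section
open scoped Classical
open scoped Pointwise

theorem pm_of_eq {N : NormOn3} {v v' : E3} (hv : v ≠ 0) (h : Submodule.span ℝ {v} = Submodule.span ℝ {v'}) (hn : N.1 v = N.1 v') :
    v' = v ∨ v' = -v := by
  obtain ⟨t, ht, rfl⟩ := span_eq_iff h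
  rw [N_abs] at hn
  have hp := N.pos hv
  have : |t| = 1 := by
    have : (|t| - 1) * N.1 v = 0 := by linarith
    rcases mul_eq_zero.mp this with h | h
    · linarith
    · exact (hp.ne' h).elim
  rcases abs_eq (by norm_num : (0:ℝ) ≤ 1) |>.mp this with h | h
  · left; rw [h, one_smul]
  · right; rw [h, neg_smul, one_smul]

theorem vec_le {N : NormOn3} {P : Finset E3} (D : Finset (Submodule ℝ E3)) (V : Finset E3)
    (hV : ∀ v ∈ V, v ≠ 0 ∧ Submodule.span ℝ {v} ∈ D ∧ N.1 v ∈ lset N P (Submodule.span ℝ {v})) :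
    V.card ≤ 2 * ∑ U ∈ D, (lset N P U).card := by
  have h1 : V.card ≤ 2 * (D.sigma (fun U => lset N P U)).card := by
    apply Finset.card_le_mul_card_image_of_maps_to (f := fun v => (⟨Submodule.span ℝ {v}, N.1 v⟩ : Σ _ : Submodule ℝ E3, ℝ))
    · intro v hv
      exact Finset.mem_sigma.mpr (hV v hv).2
    · rintro ⟨U, r⟩ -
      by_cases he : V.filter (fun v => (⟨Submodule.span ℝ {v}, N.1 v⟩ : Σ _ : Submodule ℝ E3, ℝ) = ⟨U, r⟩) = ∅
      · rw [he]; simp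
      obtain ⟨v, hv⟩ := Finset.nonempty_iff_ne_empty.mpr he
      rw [Finset.mem_filter] at hv
      refine (Finset.card_le_card (t := {v, -v}) ?_).trans Finset.card_le_two
      intro v' hv'
      rw [Finset.mem_filter] at hv'
      have e := hv.2.trans hv'.2.symm
      simp only [Sigma.mk.injEq, heq_eq_eq] at e
      have := pm_of_eq (hV v hv.1).1 e.1 e.2
      simpa using this
  rwa [Finset.card_sigma] at h1

theorem caseA (K : ℕ) (hK : 1 ≤ K) : ∃ n0 : ℕ, ∀ (N : NormOn3), GoodN N → ∀ P : Finset E3, n0 ≤ P.card →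
    (dsts N P).card ≤ 2 * P.card → (∀ q ∈ P, ∀ u : E3, u ≠ 0 → (linePts P q u).card ≤ K) → False := by
  obtain ⟨B, hB⟩ : ∃ B, B = 300 * K := ⟨_, rfl⟩
  obtain ⟨n1, hn1⟩ := fieldA K B hK (by omega)
  obtain ⟨M, hM⟩ := lemmaZ 98 K
  refine ⟨n1 + 2 * M + 1, fun N hN P hn hm hlines => ?_⟩
  have hk := dirs_le hN P
  obtain ⟨X, hXc, hX⟩ := hn1 P (by omega) (by omega) hlines
  obtain ⟨n, hnP⟩ : ∃ n, n = P.card := ⟨_, rfl⟩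
  rw [← hnP] at hn hm hXc hk
  have hGP := GP hN P X (fun p hp q hq j => by
    rw [PiLp.sub_apply]; exact Subfield.sub_mem _ (hX p hp j) (hX q hq j)) (fun U => min (lset N P U).card B) B ⊥
    (fun U _ => min_le_left _ _) (fun U _ _ => min_le_right _ _)
  have hsum : ∑ U ∈ dirs P, min (lset N P U).card B ≤ 3 * n := by omega
  set big := (dirs P).filter (fun U => B ≤ (lset N P U).card) with hbig
  set sml := (dirs P).filter (fun U => ¬ B ≤ (lset N P U).card) with hsml
  have hsplit : ∑ U ∈ big, min (lset N P U).card B + ∑ U ∈ sml, min (lset N P U).card B = ∑ U ∈ dirs P, min (lset N P U).card B := Finset.sum_filter_add_sum_filter_not (dirs P) (fun U => B ≤ (lset N P U).card) (fun U => min (lset N P U).card B)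
  have hbigc : big.card * B ≤ 3 * n := by
    have : ∑ U ∈ big, min (lset N P U).card B = big.card * B := by
      rw [← smul_eq_mul, ← Finset.sum_const]
      apply Finset.sum_congr rfl
      intro U hU
      exact min_eq_right (Finset.mem_filter.mp hU).2
    rw [← this]; omega
  have hsmlc : ∑ U ∈ sml, (lset N P U).card ≤ 3 * n := by
    have : ∑ U ∈ sml, min (lset N P U).card B = ∑ U ∈ sml, (lset N P U).card := by
      apply Finset.sum_congr rfl
      intro U hU
      have := (Finset.mem_filter.mp hU).2
      exact min_eq_left (by omega)
    rw [← this]; omega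
  -- vectors in small directions
  set V := (P.offDiag.filter (fun z => Submodule.span ℝ {z.1 - z.2} ∈ sml)).image (fun z => z.1 - z.2) with hV
  have hVc : V.card ≤ 6 * n := by
    have := vec_le (N := N) (P := P) sml V (by
      intro v hv
      obtain ⟨z, hz, rfl⟩ := Finset.mem_image.mp hv
      rw [Finset.mem_filter, Finset.mem_offDiag] at hz
      exact ⟨sub_ne_zero.mpr hz.1.2.2, hz.2, mem_lset.mpr ⟨z.1, hz.1.1, z.2, hz.1.2.1, hz.1.2.2, rfl, rfl⟩⟩)
    omega
  set V0 := insert 0 V with hV0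
  have hV0c : V0.card ≤ 7 * n := by
    have := Finset.card_insert_le (0 : E3) V
    rw [hV0]
    omega
  -- big partners
  set bp : E3 → Finset E3 := fun p => P.filter (fun q => p ≠ q ∧ Submodule.span ℝ {p - q} ∈ big) with hbp
  have hbpc : ∀ p ∈ P, (bp p).card ≤ K * big.card := by
    intro p hp
    apply Finset.card_le_mul_card_image_of_maps_to (f := fun q => Submodule.span ℝ {p - q})
    · intro q hq
      exact (Finset.mem_filter.mp hq).2.2
    · intro U hU
      by_cases he : (bp p).filter (fun q => Submodule.span ℝ {p - q} = U) = ∅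
      · rw [he]; simp
      obtain ⟨q, hq⟩ := Finset.nonempty_iff_ne_empty.mpr he
      rw [Finset.mem_filter, Finset.mem_filter] at hq
      refine (Finset.card_le_card ?_).trans (hlines p hp (p - q) (sub_ne_zero.mpr hq.1.2.1))
      intro q' hq'
      rw [Finset.mem_filter, Finset.mem_filter] at hq'
      obtain ⟨t, -, ht⟩ := span_eq_iff (hq.2.trans hq'.2.symm)
      refine Finset.mem_filter.mpr ⟨hq'.1.1, -t, ?_⟩
      rw [neg_smul, ← ht]; abel
  have hbpn : ∀ p ∈ P, 100 * (bp p).card ≤ n := by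
    intro p hp
    have h1 := hbpc p hp
    have h2 : big.card * B = 300 * (K * big.card) := by rw [hB]; ring
    omega
  have hrep : ∀ x ∈ P - P, n ≤ 2 * ((V0 ×ˢ V0).filter (fun z => z.1 - z.2 = x)).card := by
    intro x hx
    obtain ⟨p, hp, p', hp', rfl⟩ := Finset.mem_sub.mp hx
    have h1 : (P \ (bp p ∪ bp p')).card ≤ ((V0 ×ˢ V0).filter (fun z => z.1 - z.2 = p - p')).card := by
      apply Finset.card_le_card_of_injOn (fun q => (p - q, p' - q))
      · intro q hq
        rw [Finset.mem_coe, Finset.mem_sdiff, Finset.mem_union, not_or] at hq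
        have hgood : ∀ p ∈ P, q ∉ bp p → p - q ∈ V0 := by
          intro p hp hqp
          by_cases e : p = q
          · rw [e, sub_self]; exact Finset.mem_insert_self _ _
          apply Finset.mem_insert_of_mem
          refine Finset.mem_image.mpr ⟨(p, q), ?_, rfl⟩
          rw [Finset.mem_filter, Finset.mem_offDiag]
          refine ⟨⟨hp, hq.1, e⟩, ?_⟩
          rw [hsml, Finset.mem_filter]
          have hd : Submodule.span ℝ {p - q} ∈ dirs P := mem_dirs.mpr ⟨p, hp, q, hq.1, e, rfl⟩
          refine ⟨hd, fun hb => hqp ?_⟩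
          exact Finset.mem_filter.mpr ⟨hq.1, e, Finset.mem_filter.mpr ⟨hd, hb⟩⟩
        rw [Finset.mem_coe, Finset.mem_filter, Finset.mem_product]
        exact ⟨⟨hgood p hp hq.2.1, hgood p' hp' hq.2.2⟩, by simp⟩
      · intro q _ q' _ h
        simp only [Prod.mk.injEq] at h
        exact sub_right_injective h.1
    have h2 := Finset.card_le_card_sdiff_add_card (s := P) (t := bp p ∪ bp p')
    have h3 := Finset.card_union_le (bp p) (bp p')
    have h4 := hbpn p hp
    have h5 := hbpn p' hp'
    omega
  have hdiff : (P - P).card * n ≤ 2 * (49 * n * n) := by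
    have h1 : ∑ x ∈ P - P, ((V0 ×ˢ V0).filter (fun z => z.1 - z.2 = x)).card ≤ (V0 ×ˢ V0).card := by
      rw [← Finset.card_biUnion]
      · apply Finset.card_le_card
        intro z hz
        obtain ⟨x, -, h⟩ := Finset.mem_biUnion.mp hz
        exact (Finset.mem_filter.mp h).1
      · intro x _ y _ hxy
        rw [Function.onFun, Finset.disjoint_left]
        intro z hz hz'
        exact hxy ((Finset.mem_filter.mp hz).2.symm.trans (Finset.mem_filter.mp hz').2)
    have h2 : ∑ x ∈ P - P, n ≤ ∑ x ∈ P - P, 2 * ((V0 ×ˢ V0).filter (fun z => z.1 - z.2 = x)).card := Finset.sum_le_sum hrep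
    rw [Finset.sum_const, smul_eq_mul, ← Finset.mul_sum] at h2
    rw [Finset.card_product] at h1
    have h3 : V0.card * V0.card ≤ (7 * n) * (7 * n) := Nat.mul_le_mul hV0c hV0c
    nlinarith
  have hdiff2 : (P - P).card ≤ 98 * n := by
    have : (P - P).card * n ≤ 98 * n * n := by linarith
    exact Nat.le_of_mul_le_mul_right this (by omega)
  have hfin := hM E3 P (by rw [← hnP]; convert hdiff2) (by
    intro v b hb B' hB' hline
    rcases B'.eq_empty_or_nonempty with rfl | ⟨q, hq⟩
    · simp
    refine (Finset.card_le_card ?_).trans (hlines q (hB' hq) b hb)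
    intro q' hq'
    obtain ⟨t, ht⟩ := hline q hq
    obtain ⟨t', ht'⟩ := hline q' hq'
    refine Finset.mem_filter.mpr ⟨hB' hq', t' - t, ?_⟩
    rw [ht, ht', sub_smul]; abel)
  omega
end

section
open scoped Classical
open scoped Pointwise

theorem diff_card {G : Type*} [AddCommGroup G] [Module ℝ G] (A : Finset G) (φ : G →ₗ[ℝ] ℝ) (hφ : Set.InjOn φ A) (o : G) (ho : o ∈ A) :
    2 * A.card ≤ (A - A).card + 1 ∧ ((∀ e : G, ∃ z ∈ A, ∀ s : ℝ, z ≠ o + s • e) → 2 * A.card + 1 ≤ (A - A).card) := by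
  set Dp := (A - A).filter (fun d => 0 < φ d) with hDp
  have hD : 2 * Dp.card + 1 ≤ (A - A).card := by
    have hsub : insert 0 (Dp ∪ -Dp) ⊆ A - A := by
      intro d hd
      rw [Finset.mem_insert, Finset.mem_union, Finset.mem_neg] at hd
      rcases hd with rfl | h | ⟨d', h, rfl⟩
      · exact Finset.mem_sub.mpr ⟨o, ho, o, ho, sub_self _⟩
      · exact (Finset.mem_filter.mp h).1
      · obtain ⟨x, hx, y, hy, rfl⟩ := Finset.mem_sub.mp (Finset.mem_filter.mp h).1
        exact Finset.mem_sub.mpr ⟨y, hy, x, hx, by abel⟩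
    have h1 := Finset.card_le_card hsub
    rw [Finset.card_insert_of_notMem, Finset.card_union_of_disjoint, Finset.card_neg] at h1
    · omega
    · rw [Finset.disjoint_left]
      intro d hd hd'
      obtain ⟨d', h, rfl⟩ := Finset.mem_neg.mp hd'
      have h2 := (Finset.mem_filter.mp h).2
      have h3 := (Finset.mem_filter.mp hd).2
      rw [map_neg] at h3; linarith
    · rw [Finset.mem_union, Finset.mem_neg]
      rintro (h | ⟨d', h, h0⟩)
      · have := (Finset.mem_filter.mp h).2; simp at this
      · have := (Finset.mem_filter.mp h).2
        rw [neg_eq_zero] at h0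
        rw [h0] at this; simp at this
  obtain ⟨z0, hz0, hmin⟩ := Finset.exists_min_image A φ ⟨o, ho⟩
  have hpos : ∀ z ∈ A, z ≠ z0 → φ z0 < φ z := by
    intro z hz hne
    rcases (hmin z hz).lt_or_eq with h | h
    · exact h
    · exact (hne (hφ hz0 hz h).symm).elim
  have hsub0 : (A.erase z0).image (fun z => z - z0) ⊆ Dp := by
    intro d hd
    obtain ⟨z, hz, rfl⟩ := Finset.mem_image.mp hd
    rw [Finset.mem_erase] at hz
    refine Finset.mem_filter.mpr ⟨Finset.sub_mem_sub hz.2 hz0, ?_⟩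
    have := hpos z hz.2 hz.1
    rw [map_sub]; linarith
  have hcard0 : ((A.erase z0).image (fun z => z - z0)).card = A.card - 1 := by
    rw [Finset.card_image_of_injective _ (sub_left_injective), Finset.card_erase_of_mem hz0]
  have hApos : 0 < A.card := Finset.card_pos.mpr ⟨o, ho⟩
  have hle := Finset.card_le_card hsub0
  refine ⟨by omega, fun hnc => ?_⟩
  by_contra hcon
  have heq : (A.erase z0).image (fun z => z - z0) = Dp := Finset.eq_of_subset_of_card_le hsub0 (by omega)
  have hne : (A.erase z0).Nonempty := by
    obtain ⟨z, hz, h⟩ := hnc 0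
    have hzo : z ≠ o := by simpa using h 0
    by_cases hh : z = z0
    · exact ⟨o, Finset.mem_erase.mpr ⟨fun h' => hzo (hh.trans h'.symm), ho⟩⟩
    · exact ⟨z, Finset.mem_erase.mpr ⟨hh, hz⟩⟩
  obtain ⟨z1, hz1, hmin1⟩ := Finset.exists_min_image (A.erase z0) φ hne
  rw [Finset.mem_erase] at hz1
  have hstep : ∀ z ∈ A, z ≠ z0 → z - (z1 - z0) ∈ A := by
    intro z hz hzne
    by_cases hzz : z = z1
    · rw [hzz]; simpa using hz0
    have h1 : φ z1 < φ z := by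
      rcases (hmin1 z (Finset.mem_erase.mpr ⟨hzne, hz⟩)).lt_or_eq with h | h
      · exact h
      · exact (hzz (hφ hz1.2 hz h).symm).elim
    have h2 : z - z1 ∈ Dp := Finset.mem_filter.mpr ⟨Finset.sub_mem_sub hz hz1.2, by rw [map_sub]; linarith⟩
    rw [← heq] at h2
    obtain ⟨y, hy, hyz⟩ := Finset.mem_image.mp h2
    have : z - (z1 - z0) = y := by
      have h3 : y = (y - z0) + z0 := by abel
      rw [h3, hyz]; abel
    rw [this]
    exact (Finset.mem_erase.mp hy).2
  have hd : 0 < φ (z1 - z0) := by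
    have := hpos z1 hz1.2 hz1.1
    rw [map_sub]; linarith
  have hall : ∀ k : ℕ, ∀ z ∈ A, (A.filter (fun y => φ y < φ z)).card ≤ k → ∃ s : ℝ, z = z0 + s • (z1 - z0) := by
    intro k
    induction k with
    | zero =>
      intro z hz hk
      by_cases h : z = z0
      · exact ⟨0, by simp [h]⟩
      · have : z0 ∈ A.filter (fun y => φ y < φ z) := Finset.mem_filter.mpr ⟨hz0, hpos z hz h⟩
        have := Finset.card_pos.mpr ⟨_, this⟩
        omega
    | succ k ih =>
      intro z hz hk
      by_cases h : z = z0
      · exact ⟨0, by simp [h]⟩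
      have h1 := hstep z hz h
      have hlt : φ (z - (z1 - z0)) < φ z := by rw [map_sub φ z]; linarith
      obtain ⟨s, hs⟩ := ih _ h1 (by
        have hss : A.filter (fun y => φ y < φ (z - (z1 - z0))) ⊂ A.filter (fun y => φ y < φ z) := by
          rw [Finset.ssubset_iff_of_subset]
          · exact ⟨z - (z1 - z0), Finset.mem_filter.mpr ⟨h1, hlt⟩, fun h => lt_irrefl _ (Finset.mem_filter.mp h).2⟩
          · intro y hy
            rw [Finset.mem_filter] at hy ⊢
            exact ⟨hy.1, hy.2.trans hlt⟩
        have := Finset.card_lt_card hss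
        omega)
      refine ⟨s + 1, ?_⟩
      rw [sub_eq_iff_eq_add] at hs
      rw [hs, add_smul, one_smul]; abel
  obtain ⟨s0, hs0⟩ := hall _ o ho le_rfl
  obtain ⟨z, hz, hzn⟩ := hnc (z1 - z0)
  obtain ⟨s, hs⟩ := hall _ z hz le_rfl
  apply hzn (s - s0)
  rw [hs, hs0, sub_smul]; abel

theorem dbl {α β : Type*} (D : Finset α) (T : Finset β) (S : β → Finset α) (hS : ∀ t ∈ T, S t ⊆ D) :
    ∑ d ∈ D, (T.filter (fun t => d ∈ S t)).card = ∑ t ∈ T, (S t).card := by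
  simp only [Finset.card_filter]
  rw [Finset.sum_comm]
  apply Finset.sum_congr rfl
  intro t ht
  rw [← Finset.card_filter]
  congr 1
  ext d
  rw [Finset.mem_filter]
  exact ⟨fun h => h.2, fun h => ⟨hS t ht h, h⟩⟩

theorem layers {G : Type*} [AddCommGroup G] [Module ℝ G] (Z : Finset G) (w : G → ℕ) (l : ℕ) (hl : 1 ≤ l)
    (hw : ∀ z ∈ Z, w z ≤ l) (o : G) (ho : o ∈ Z) (hwo : w o = l) (φ : G →ₗ[ℝ] ℝ) (hφ : Set.InjOn φ Z)
    (hnc : ∀ e : G, ∃ z ∈ Z, 1 ≤ w z ∧ ∀ s : ℝ, z ≠ o + s • e) (α : G → ℕ) (hα : ∀ q ∈ Z, ∀ r ∈ Z, w q + w r ≤ α (q - r)) :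
    4 * ∑ z ∈ Z, w z ≤ ∑ d ∈ Z - Z, α d := by
  set Zt : ℕ → Finset G := fun t => Z.filter (fun z => t ≤ w z) with hZt
  have hZs : ∀ t, Zt t ⊆ Z := fun t => Finset.filter_subset _ _
  have hanti : ∀ {t t'}, t ≤ t' → Zt t' ⊆ Zt t := by
    intro t t' h z hz
    rw [Finset.mem_filter] at hz ⊢
    exact ⟨hz.1, h.trans hz.2⟩
  have hoZ : ∀ t, t ≤ l → o ∈ Zt t := fun t ht => Finset.mem_filter.mpr ⟨ho, by omega⟩
  let NC : Finset G → Prop := fun A => ∀ e : G, ∃ z ∈ A, ∀ s : ℝ, z ≠ o + s • e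
  have hNC1 : NC (Zt 1) := by
    intro e
    obtain ⟨z, hz, h1, h2⟩ := hnc e
    exact ⟨z, Finset.mem_filter.mpr ⟨hz, h1⟩, h2⟩
  obtain ⟨t1, χ, e, ht1, ht1l, hNCt, hχ, hcol, hχe⟩ : ∃ (t1 : ℕ) (χ e : G), 1 ≤ t1 ∧ t1 ≤ l ∧ (∀ t ≤ t1, NC (Zt t)) ∧ χ ∈ Zt t1 ∧
      (∀ t, t1 < t → t ≤ l → ∀ z ∈ Zt t, ∃ s : ℝ, z = o + s • e) ∧ (t1 < l → ∀ s : ℝ, χ ≠ o + s • e) := by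
    obtain ⟨t1, ht1, hmax⟩ := Finset.exists_max_image ((Finset.Icc 1 l).filter (fun t => NC (Zt t))) (fun t => t)
      ⟨1, Finset.mem_filter.mpr ⟨Finset.mem_Icc.mpr ⟨le_rfl, hl⟩, hNC1⟩⟩
    rw [Finset.mem_filter, Finset.mem_Icc] at ht1
    have hmono : ∀ t ≤ t1, NC (Zt t) := by
      intro t ht e
      obtain ⟨z, hz, h⟩ := ht1.2 e
      exact ⟨z, hanti ht hz, h⟩
    by_cases h : t1 < l
    · have hn : ¬ NC (Zt (t1 + 1)) := by
        intro hcon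
        have := hmax (t1 + 1) (Finset.mem_filter.mpr ⟨Finset.mem_Icc.mpr ⟨by omega, by omega⟩, hcon⟩)
        omega
      simp only [NC] at hn
      push Not at hn
      obtain ⟨e, he⟩ := hn
      obtain ⟨χ, hχ, hχe⟩ := ht1.2 e
      exact ⟨t1, χ, e, ht1.1.1, ht1.1.2, hmono, hχ, fun t h1 _ z hz => he z (hanti h1 hz), fun _ => hχe⟩
    · exact ⟨t1, o, 0, ht1.1.1, ht1.1.2, hmono, hoZ _ ht1.1.2, fun t h1 h2 => by omega, fun h' => (h h').elim⟩
  have hχZ : χ ∈ Z := hZs _ hχ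
  have hχw : t1 ≤ w χ := (Finset.mem_filter.mp hχ).2
  set S2 : ℕ → Finset G := fun t => (Zt t).image (fun z => χ - z) ∪ (Zt t).image (fun z => z - χ) with hS2
  have hcredit : ∀ d ∈ Z - Z, 2 * ((Finset.Icc 1 l).filter (fun t => d ∈ Zt t - Zt t)).card +
      ((Finset.Ioc t1 l).filter (fun t => d ∈ S2 t)).card ≤ α d := by
    intro d hd
    set T1 := (Finset.Icc 1 l).filter (fun t => d ∈ Zt t - Zt t) with hT1
    set T2 := (Finset.Ioc t1 l).filter (fun t => d ∈ S2 t) with hT2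
    rcases T2.eq_empty_or_nonempty with h2 | h2
    · rw [h2, Finset.card_empty, add_zero]
      rcases T1.eq_empty_or_nonempty with h1 | h1
      · rw [h1]; simp
      obtain ⟨τ, hτ, hmax⟩ := Finset.exists_max_image T1 (fun t => t) h1
      have hc : T1.card ≤ τ := by
        have : T1 ⊆ Finset.Icc 1 τ := by
          intro t ht
          exact Finset.mem_Icc.mpr ⟨(Finset.mem_Icc.mp (Finset.mem_filter.mp ht).1).1, hmax t ht⟩
        have := Finset.card_le_card this
        rw [Nat.card_Icc] at this; omega
      obtain ⟨q, hq, r, hr, rfl⟩ := Finset.mem_sub.mp (Finset.mem_filter.mp hτ).2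
      have h3 := hα q (hZs _ hq) r (hZs _ hr)
      have h4 := (Finset.mem_filter.mp hq).2
      have h5 := (Finset.mem_filter.mp hr).2
      omega
    · obtain ⟨σ, hσ, hmax⟩ := Finset.exists_max_image T2 (fun t => t) h2
      rw [Finset.mem_filter, Finset.mem_Ioc] at hσ
      have hc2 : T2.card ≤ σ - t1 := by
        have : T2 ⊆ Finset.Ioc t1 σ := by
          intro t ht
          exact Finset.mem_Ioc.mpr ⟨(Finset.mem_Ioc.mp (Finset.mem_filter.mp ht).1).1, hmax t ht⟩
        have := Finset.card_le_card this
        rwa [Nat.card_Ioc] at this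
      obtain ⟨z, hz, hzd⟩ : ∃ z ∈ Zt σ, d = χ - z ∨ d = z - χ := by
        rcases Finset.mem_union.mp hσ.2 with h | h
        · obtain ⟨z, hz, rfl⟩ := Finset.mem_image.mp h; exact ⟨z, hz, Or.inl rfl⟩
        · obtain ⟨z, hz, rfl⟩ := Finset.mem_image.mp h; exact ⟨z, hz, Or.inr rfl⟩
      have hzw := (Finset.mem_filter.mp hz).2
      have hαd : t1 + σ ≤ α d := by
        rcases hzd with rfl | rfl
        · have := hα χ hχZ z (hZs _ hz); omega
        · have := hα z (hZs _ hz) χ hχZ; omega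
      have hc1 : T1.card ≤ t1 := by
        have : T1 ⊆ Finset.Icc 1 t1 := by
          intro t ht
          rw [Finset.mem_filter, Finset.mem_Icc] at ht
          refine Finset.mem_Icc.mpr ⟨ht.1.1, ?_⟩
          by_contra hcon
          push Not at hcon
          obtain ⟨q, hq, r, hr, hqr⟩ := Finset.mem_sub.mp ht.2
          obtain ⟨s1, hs1⟩ := hcol t hcon ht.1.2 q hq
          obtain ⟨s2, hs2⟩ := hcol t hcon ht.1.2 r hr
          obtain ⟨s3, hs3⟩ := hcol σ hσ.1.1 hσ.1.2 z hz
          rcases hzd with h | h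
          · apply hχe (by omega) (s3 + s1 - s2)
            have : χ = z + (q - r) := by rw [hqr, h]; abel
            rw [this, hs1, hs2, hs3, sub_smul, add_smul]; abel
          · apply hχe (by omega) (s3 - s1 + s2)
            have : χ = z - (q - r) := by rw [hqr, h]; abel
            rw [this, hs1, hs2, hs3, add_smul, sub_smul]; abel
        have := Finset.card_le_card this
        rw [Nat.card_Icc] at this; omega
      omega
  have hsum := Finset.sum_le_sum hcredit
  rw [Finset.sum_add_distrib, ← Finset.mul_sum, dbl (Z - Z) (Finset.Icc 1 l) (fun t => Zt t - Zt t) (fun t _ => Finset.sub_subset_sub (hZs t) (hZs t)),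
    dbl (Z - Z) (Finset.Ioc t1 l) S2 (by
      intro t _ d hd
      rcases Finset.mem_union.mp hd with h | h
      · obtain ⟨z, hz, rfl⟩ := Finset.mem_image.mp h; exact Finset.sub_mem_sub hχZ (hZs _ hz)
      · obtain ⟨z, hz, rfl⟩ := Finset.mem_image.mp h; exact Finset.sub_mem_sub (hZs _ hz) hχZ)] at hsum
  have hS2c : ∀ t ∈ Finset.Ioc t1 l, (S2 t).card = 2 * (Zt t).card := by
    intro t ht
    rw [Finset.mem_Ioc] at ht
    rw [hS2]
    simp only
    rw [Finset.card_union_of_disjoint, Finset.card_image_of_injective _ sub_right_injective, Finset.card_image_of_injective _ sub_left_injective]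
    · ring
    · rw [Finset.disjoint_left]
      intro d hd hd'
      obtain ⟨z, hz, rfl⟩ := Finset.mem_image.mp hd
      obtain ⟨z', hz', h⟩ := Finset.mem_image.mp hd'
      obtain ⟨s1, hs1⟩ := hcol t ht.1 ht.2 z hz
      obtain ⟨s2, hs2⟩ := hcol t ht.1 ht.2 z' hz'
      apply hχe (by omega) ((1 / 2) * (s1 + s2))
      have h2 : (2 : ℝ) • χ = z + z' := by
        rw [two_smul]
        have : χ + χ = χ - z + z + χ := by abel
        rw [this, ← h]; abel
      have h3 : χ = (1 / 2 : ℝ) • ((2 : ℝ) • χ) := by rw [smul_smul]; norm_num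
      rw [h3, h2, hs1, hs2]
      module
  have hlayer : ∑ t ∈ Finset.Icc 1 l, (Zt t).card = ∑ z ∈ Z, w z := by
    simp only [hZt, Finset.card_filter]
    rw [Finset.sum_comm]
    apply Finset.sum_congr rfl
    intro z hz
    rw [← Finset.card_filter]
    have : (Finset.Icc 1 l).filter (fun t => t ≤ w z) = Finset.Icc 1 (w z) := by
      ext t
      simp only [Finset.mem_filter, Finset.mem_Icc]
      have := hw z hz
      omega
    rw [this, Nat.card_Icc]; omega
  have hIcc : Finset.Icc 1 l = Finset.Icc 1 t1 ∪ Finset.Ioc t1 l := by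
    ext t; simp only [Finset.mem_union, Finset.mem_Icc, Finset.mem_Ioc]; omega
  have hdis : Disjoint (Finset.Icc 1 t1) (Finset.Ioc t1 l) := by
    rw [Finset.disjoint_left]; intro t h h'
    rw [Finset.mem_Icc] at h; rw [Finset.mem_Ioc] at h'; omega
  refine le_trans ?_ hsum
  rw [← hlayer, hIcc, Finset.sum_union hdis, Finset.sum_union hdis]
  have hA : ∑ t ∈ Finset.Icc 1 t1, 2 * (Zt t).card ≤ ∑ t ∈ Finset.Icc 1 t1, (Zt t - Zt t).card := by
    apply Finset.sum_le_sum
    intro t ht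
    rw [Finset.mem_Icc] at ht
    have := (diff_card (Zt t) φ (hφ.mono (Finset.coe_subset.mpr (hZs t))) o (hoZ t (by omega))).2 (hNCt t ht.2)
    omega
  have hB : ∑ t ∈ Finset.Ioc t1 l, 4 * (Zt t).card ≤ ∑ t ∈ Finset.Ioc t1 l, (2 * (Zt t - Zt t).card + (S2 t).card) := by
    apply Finset.sum_le_sum
    intro t ht
    have h1 := hS2c t ht
    rw [Finset.mem_Ioc] at ht
    have := (diff_card (Zt t) φ (hφ.mono (Finset.coe_subset.mpr (hZs t))) o (hoZ t (by omega))).1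
    have h3 : 0 < (Zt t).card := Finset.card_pos.mpr ⟨o, hoZ t ht.2⟩
    omega
  rw [Finset.sum_add_distrib, ← Finset.mul_sum, ← Finset.mul_sum] at hB
  rw [← Finset.mul_sum] at hA
  linarith
end

section
open scoped Classical
open scoped Pointwise

theorem span_rat_mem (X : Set ℝ) (F : Subfield ℝ) (hX : X ⊆ F) {a : ℝ} (ha : a ∈ Submodule.span ℚ X) : a ∈ F := by
  induction ha using Submodule.span_induction with
  | mem x h => exact hX h
  | zero => exact F.zero_mem
  | add x y _ _ hx hy => exact F.add_mem hx hy
  | smul q x _ hx =>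
    rw [Rat.smul_def]
    exact F.mul_mem (SubfieldClass.ratCast_mem F q) hx

theorem fieldC (H c : ℕ) (hH : 1 ≤ H) (hc : 1 ≤ c) : ∃ n0 : ℕ, ∀ (N : NormOn3), GoodN N → ∀ (P : Finset E3) (o u : E3), u ≠ 0 → o ∈ P → n0 ≤ P.card →
    P.card ≤ H * (linePts P o u).card → (dsts N P).card ≤ 2 * P.card →
    ∃ X : Finset ℝ, c * X.card ≤ P.card ∧ ∀ p ∈ P, ∀ j, p j ∈ Subfield.closure (X : Set ℝ) := by
  obtain ⟨a, ha⟩ : ∃ a, a = 10 * H := ⟨_, rfl⟩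
  obtain ⟨s, hs⟩ : ∃ s, s = 200 * c * a := ⟨_, rfl⟩
  refine ⟨1 + 4 * s * H + 2 * (c * ((5 * H) ^ 5 + 6 + 6 * s)), fun N hN P o u hu ho hn hl hm => ?_⟩
  obtain ⟨n, hnP⟩ : ∃ n, n = P.card := ⟨_, rfl⟩
  have hk := dirs_le hN P
  rw [← hnP] at hn hl hm hk ⊢
  set L := linePts P o u with hL
  have hLP : L ⊆ P := Finset.filter_subset _ _
  have hoL : o ∈ L := Finset.mem_filter.mpr ⟨ho, 0, by simp⟩
  have hpos : ∀ p : E3, ∃ t : ℝ, p ∈ L → p = o + t • u := by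
    intro p
    by_cases h : p ∈ L
    · obtain ⟨t, ht⟩ := (Finset.mem_filter.mp h).2
      exact ⟨t, fun _ => ht⟩
    · exact ⟨0, fun h' => (h h').elim⟩
  choose pos hpos using hpos
  have hposo : pos o = 0 := by
    have := hpos o hoL
    have h2 : pos o • u = 0 := by
      rw [left_eq_add] at this; exact this
    exact (smul_eq_zero.mp h2).resolve_right hu
  set A := L.image pos with hA
  have hAc : A.card = L.card := by
    apply Finset.card_image_of_injOn
    intro p hp q hq h
    rw [hpos p hp, hpos q hq, h]
  have hNu := N.pos hu
  have hAA : (A - A).card ≤ (5 * H) * A.card := by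
    have hsub : A - A ⊆ insert 0 ((dsts N P).image (fun d => d / N.1 u) ∪ (dsts N P).image (fun d => -(d / N.1 u))) := by
      intro x hx
      obtain ⟨s, hs, t, ht, rfl⟩ := Finset.mem_sub.mp hx
      obtain ⟨p, hp, rfl⟩ := Finset.mem_image.mp hs
      obtain ⟨q, hq, rfl⟩ := Finset.mem_image.mp ht
      by_cases hpq : p = q
      · rw [hpq, sub_self]; exact Finset.mem_insert_self _ _
      apply Finset.mem_insert_of_mem
      have hd : |pos p - pos q| * N.1 u ∈ dsts N P := by
        refine mem_dsts.mpr ⟨p, hLP hp, q, hLP hq, hpq, ?_⟩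
        rw [← N_abs]
        congr 1
        nth_rewrite 1 [hpos p hp, hpos q hq]
        rw [sub_smul]; abel
      rw [Finset.mem_union, Finset.mem_image, Finset.mem_image]
      rcases abs_choice (pos p - pos q) with h | h
      · left; exact ⟨_, hd, by rw [h]; field_simp⟩
      · right; exact ⟨_, hd, by rw [h]; field_simp⟩
    have h1 := Finset.card_le_card hsub
    have h2 := Finset.card_insert_le (0:ℝ) ((dsts N P).image (fun d => d / N.1 u) ∪ (dsts N P).image (fun d => -(d / N.1 u)))
    have h3 := Finset.card_union_le ((dsts N P).image (fun d => d / N.1 u)) ((dsts N P).image (fun d => -(d / N.1 u)))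
    have h4 := Finset.card_image_le (s := dsts N P) (f := fun d => d / N.1 u)
    have h5 := Finset.card_image_le (s := dsts N P) (f := fun d => -(d / N.1 u))
    rw [hAc, mul_assoc]
    omega
  obtain ⟨X0, hX0c, hX0⟩ := rank_lemma (A := A) ⟨pos o, Finset.mem_image_of_mem _ hoL⟩ (5 * H) (by convert hAA)
  have hdf : ∀ p ∈ P \ L, (dirsFrom L p).card = L.card := by
    intro p hp
    rw [Finset.mem_sdiff] at hp
    rw [dirsFrom, Finset.erase_eq_of_notMem hp.2]
    apply Finset.card_image_of_injOn
    intro q hq q' hq' h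
    by_contra hne
    obtain ⟨t, -, ht⟩ := span_eq_iff h
    apply hp.2
    have hq1 := hpos q hq
    have hq1' := hpos q' hq'
    have ht1 : t ≠ 1 := by
      rintro rfl
      rw [one_smul] at ht
      exact hne (sub_left_injective ht).symm
    refine Finset.mem_filter.mpr ⟨hp.1, (pos q' - t * pos q) / (1 - t), ?_⟩
    have h1t : (1 - t) ≠ 0 := sub_ne_zero.mpr (Ne.symm ht1)
    have e : (1 - t) • p = (1 - t) • o + (pos q' - t * pos q) • u := by
      have : (1 - t) • p = q' - t • q := by
        rw [sub_smul, one_smul]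
        have : q' = p + t • (q - p) := by rw [← ht]; abel
        rw [this, smul_sub]; abel
      rw [this]
      nth_rewrite 1 [hq1, hq1']
      module
    have : p = (1 - t)⁻¹ • ((1 - t) • p) := by rw [smul_smul, inv_mul_cancel₀ h1t, one_smul]
    rw [this, e, smul_add, smul_smul, inv_mul_cancel₀ h1t, one_smul, smul_smul, div_eq_inv_mul]
  have hsl : 4 * s < L.card := by
    by_contra hcon
    push Not at hcon
    have : H * L.card ≤ H * (4 * s) := Nat.mul_le_mul_left _ hcon
    have h2 : H * (4 * s) = 4 * s * H := by ring
    omega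
  obtain ⟨S, hSsub, hSc, hSe⟩ := hitg (P \ L) (dirs P) (fun p => dirsFrom L p) a s (by
    intro p hp U hU
    refine dirsFrom_sub (Finset.mem_sdiff.mp hp).1 ?_
    obtain ⟨q, hq, rfl⟩ := Finset.mem_image.mp hU
    rw [Finset.mem_erase] at hq
    exact Finset.mem_image.mpr ⟨q, Finset.mem_erase.mpr ⟨hq.1, hLP hq.2⟩, rfl⟩) 2 (by
    intro p hp
    rw [hdf p hp, ha]
    have h1 : 10 * H * (4 * s) < 10 * H * L.card := Nat.mul_lt_mul_of_pos_left hsl (by omega)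
    have e1 : 10 * H * (4 * s) = 40 * (H * s) := by ring
    have e2 : 10 * H * L.card = 10 * (H * L.card) := by ring
    have e3 : 10 * H * (2 * s) = 20 * (H * s) := by ring
    omega)
  set E0 := (P \ L).filter (fun p => (dirsFrom L p ∩ S).card < 2) with hE0
  have hE0c : 100 * c * E0.card ≤ n := by
    have h1 : E0.card * s ≤ 2 * (n * a) := by
      calc E0.card * s ≤ E0.card * (a + s) := Nat.mul_le_mul_left _ (by omega)
        _ ≤ _ := hSe
        _ ≤ 2 * (n * a) := by
            gcongr
            rw [hnP]; exact Finset.card_le_card Finset.sdiff_subset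
    have h2 : (2 * a) * (100 * c * E0.card) ≤ (2 * a) * n := by
      calc _ = E0.card * s := by rw [hs]; ring
        _ ≤ _ := h1
        _ = _ := by ring
    exact Nat.le_of_mul_le_mul_left h2 (by omega)
  obtain ⟨w, hw⟩ := exists_reps P
  set C := S.image w ∪ E0 ∪ {o, u} with hC
  refine ⟨X0 ∪ coords C, ?_, ?_⟩
  · have h1 := Finset.card_union_le X0 (coords C)
    have h2 := coords_card C
    have h3 : C.card ≤ S.card + E0.card + 2 := by
      refine (Finset.card_union_le _ _).trans (add_le_add ((Finset.card_union_le _ _).trans (add_le_add Finset.card_image_le le_rfl)) Finset.card_le_two)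
    have h4 : c * (X0 ∪ coords C).card ≤ c * ((5 * H) ^ 5 + 6 + 6 * s) + 3 * (c * E0.card) := by
      calc _ ≤ c * (((5 * H) ^ 5 + 6 + 6 * s) + 3 * E0.card) := by
            apply Nat.mul_le_mul_left
            omega
        _ = _ := by ring
    have h5 : 100 * c * E0.card = 100 * (c * E0.card) := by ring
    omega
  · set F := Subfield.closure ((X0 ∪ coords C : Finset ℝ) : Set ℝ) with hF
    have hCF : ∀ x ∈ C, ∀ j, x j ∈ F := fun x hx j =>
      Subfield.subset_closure (Finset.mem_coe.mpr (Finset.mem_union_right _ (mem_coords hx j)))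
    have hX0F : (X0 : Set ℝ) ⊆ F := fun x hx => Subfield.subset_closure (Finset.mem_coe.mpr (Finset.mem_union_left _ hx))
    have hLF : ∀ p ∈ L, ∀ j, p j ∈ F := by
      intro p hp j
      have h1 := hX0 (pos p) (Finset.mem_image_of_mem _ hp) (pos o) (Finset.mem_image_of_mem _ hoL)
      rw [hposo, sub_zero] at h1
      have h2 := span_rat_mem _ F hX0F h1
      rw [hpos p hp]
      simp only [PiLp.add_apply, PiLp.smul_apply, smul_eq_mul]
      exact F.add_mem (hCF o (by simp [hC]) j) (F.mul_mem h2 (hCF u (by simp [hC]) j))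
    intro p hp
    by_cases hpL : p ∈ L
    · exact hLF p hpL
    by_cases hpE : p ∈ E0
    · exact hCF p (by simp only [hC, Finset.mem_union]; tauto)
    have h2 : 1 < (dirsFrom L p ∩ S).card := by
      by_contra hcon
      exact hpE (Finset.mem_filter.mpr ⟨Finset.mem_sdiff.mpr ⟨hp, hpL⟩, by omega⟩)
    obtain ⟨U1, hU1, U2, hU2, hne⟩ := Finset.one_lt_card.mp h2
    rw [Finset.mem_inter] at hU1 hU2
    obtain ⟨r1, hr1, e1⟩ := Finset.mem_image.mp hU1.1
    obtain ⟨r2, hr2, e2⟩ := Finset.mem_image.mp hU2.1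
    have hCS : ∀ U ∈ S, ∀ j, w U j ∈ F := fun U hU => hCF _ (by
      simp only [hC, Finset.mem_union]; exact Or.inl (Or.inl (Finset.mem_image_of_mem _ hU)))
    exact inter_dirs F w U1 U2 hne (hw _ (hSsub hU1.2)) (hw _ (hSsub hU2.2)) (hCS _ hU1.2) (hCS _ hU2.2) r1 r2 p
      (hLF r1 (Finset.mem_erase.mp hr1).2) (hLF r2 (Finset.mem_erase.mp hr2).2) e1 e2
end

section
open scoped Classical
open scoped Pointwise

theorem vec_le2 {N : NormOn3} (G : Submodule ℝ E3 → Finset ℝ) (D : Finset (Submodule ℝ E3)) (V : Finset E3)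
    (hV : ∀ v ∈ V, v ≠ 0 ∧ Submodule.span ℝ {v} ∈ D ∧ N.1 v ∈ G (Submodule.span ℝ {v})) :
    V.card ≤ 2 * ∑ U ∈ D, (G U).card := by
  have h1 : V.card ≤ 2 * (D.sigma (fun U => G U)).card := by
    apply Finset.card_le_mul_card_image_of_maps_to (f := fun v => (⟨Submodule.span ℝ {v}, N.1 v⟩ : Σ _ : Submodule ℝ E3, ℝ))
    · intro v hv
      exact Finset.mem_sigma.mpr (hV v hv).2
    · rintro ⟨U, r⟩ -
      by_cases he : V.filter (fun v => (⟨Submodule.span ℝ {v}, N.1 v⟩ : Σ _ : Submodule ℝ E3, ℝ) = ⟨U, r⟩) = ∅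
      · rw [he]; simp
      obtain ⟨v, hv⟩ := Finset.nonempty_iff_ne_empty.mpr he
      rw [Finset.mem_filter] at hv
      refine (Finset.card_le_card (t := {v, -v}) ?_).trans Finset.card_le_two
      intro v' hv'
      rw [Finset.mem_filter] at hv'
      have e := hv.2.trans hv'.2.symm
      simp only [Sigma.mk.injEq, heq_eq_eq] at e
      have := pm_of_eq (hV v hv.1).1 e.1 e.2
      simpa using this
  rwa [Finset.card_sigma] at h1

/-- many columns give many distances -/
theorem caseC_cols {N : NormOn3} (hN : GoodN N) (P : Finset E3) (o u : E3) (X : Finset ℝ)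
    (hX : ∀ p ∈ P, ∀ j, p j ∈ Subfield.closure (X : Set ℝ)) (C : Finset E3) (hCP : C ⊆ P)
    (hC : ∀ c ∈ C, ∀ c' ∈ C, c ≠ c' → ∀ t : ℝ, c - c' ≠ t • u) (hCo : ∀ c ∈ C, ∀ t : ℝ, c ≠ o + t • u) :
    (linePts P o u).card * C.card ≤ 2 * ((dsts N P).card + C.card * X.card) := by
  set L := linePts P o u with hL
  have hLm : ∀ x ∈ L, x ∈ P ∧ ∃ t : ℝ, x = o + t • u := fun x hx => Finset.mem_filter.mp hx
  have hne : ∀ x ∈ L, ∀ c ∈ C, x ≠ c := by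
    intro x hx c hc h
    obtain ⟨-, t, ht⟩ := hLm x hx
    exact hCo c hc t (h ▸ ht)
  set V := (L ×ˢ C).image (fun z => z.1 - z.2) with hV
  have hVc : V.card = L.card * C.card := by
    rw [hV, Finset.card_image_of_injOn, Finset.card_product]
    rintro ⟨x, c⟩ h ⟨x', c'⟩ h' e
    simp only [Finset.coe_product, Set.mem_prod, Finset.mem_coe] at h h'
    simp only at e
    obtain ⟨-, t, ht⟩ := hLm x h.1
    obtain ⟨-, t', ht'⟩ := hLm x' h'.1
    have hcc : c = c' := by
      by_contra hcc
      apply hC c h.2 c' h'.2 hcc (t - t')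
      have : c - c' = x - x' := by
        have : c - c' = (x - x') - ((x - c) - (x' - c')) := by abel
        rw [this, e]; simp
      rw [this, ht, ht', sub_smul]; abel
    subst hcc
    have := sub_left_injective e
    rw [this]
  set G : Submodule ℝ E3 → Finset ℝ := fun U => (V.filter (fun v => Submodule.span ℝ {v} = U)).image (fun v => N.1 v) with hG
  have hGP := GP hN P X (fun p hp q hq j => by
    rw [PiLp.sub_apply]; exact Subfield.sub_mem _ (hX p hp j) (hX q hq j)) (fun U => (G U).card) C.card ⊥ (by
      intro U _
      apply Finset.card_le_card
      intro r hr
      obtain ⟨v, hv, rfl⟩ := Finset.mem_image.mp hr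
      rw [Finset.mem_filter] at hv
      obtain ⟨z, hz, rfl⟩ := Finset.mem_image.mp hv.1
      rw [Finset.mem_product] at hz
      exact mem_lset.mpr ⟨z.1, (hLm _ hz.1).1, z.2, hCP hz.2, hne _ hz.1 _ hz.2, hv.2, rfl⟩) (by
      intro U _ _
      refine Finset.card_image_le.trans ?_
      have : V.filter (fun v => Submodule.span ℝ {v} = U) ⊆ ((L ×ˢ C).filter (fun z => Submodule.span ℝ {z.1 - z.2} = U)).image (fun z => z.1 - z.2) := by
        intro v hv
        rw [Finset.mem_filter] at hv
        obtain ⟨z, hz, rfl⟩ := Finset.mem_image.mp hv.1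
        exact Finset.mem_image_of_mem _ (Finset.mem_filter.mpr ⟨hz, hv.2⟩)
      refine (Finset.card_le_card this).trans (Finset.card_image_le.trans ?_)
      apply Finset.card_le_card_of_injOn Prod.snd
      · intro z hz
        exact (Finset.mem_product.mp (Finset.mem_filter.mp hz).1).2
      · rintro ⟨x, c⟩ h ⟨x', c'⟩ h' e
        simp only at e
        subst e
        rw [Finset.mem_coe, Finset.mem_filter, Finset.mem_product] at h h'
        simp only at h h'
        obtain ⟨-, t, ht⟩ := hLm x h.1.1
        obtain ⟨-, t', ht'⟩ := hLm x' h'.1.1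
        obtain ⟨k, -, hk⟩ := span_eq_iff (h.2.trans h'.2.symm)
        by_cases hk1 : k = 1
        · rw [hk1, one_smul] at hk
          rw [sub_left_injective hk]
        · exfalso
          apply hCo c h.1.2 (t - (t' - t) / (k - 1))
          have hk0 : k - 1 ≠ 0 := sub_ne_zero.mpr hk1
          have e1 : (k - 1) • (x - c) = (t' - t) • u := by
            have : (k - 1) • (x - c) = (x' - c) - (x - c) := by rw [hk, sub_smul, one_smul]
            rw [this, ht, ht', sub_smul]; abel
          have e2 : x - c = ((t' - t) / (k - 1)) • u := by
            rw [div_eq_inv_mul, mul_smul, ← e1, smul_smul, inv_mul_cancel₀ hk0, one_smul]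
          have : c = x - (x - c) := by abel
          rw [this, e2, ht, sub_smul]; abel)
  have hv := vec_le2 (N := N) G (dirs P) V (by
    intro v hv
    refine ⟨?_, ?_, Finset.mem_image.mpr ⟨v, Finset.mem_filter.mpr ⟨hv, rfl⟩, rfl⟩⟩ <;>
    obtain ⟨z, hz, rfl⟩ := Finset.mem_image.mp hv <;> rw [Finset.mem_product] at hz
    · exact sub_ne_zero.mpr (hne _ hz.1 _ hz.2)
    · exact mem_dirs.mpr ⟨z.1, (hLm _ hz.1).1, z.2, hCP hz.2, hne _ hz.1 _ hz.2, rfl⟩)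
  rw [hVc] at hv
  omega

/-- few columns -/
theorem caseC_few {N : NormOn3} (hN : GoodN N) (P : Finset E3) (hP : Spans P) (o u : E3) (hu : u ≠ 0) (l : ℕ) (hoP : o ∈ P)
    (hl : (linePts P o u).card = l) (hmax : ∀ q ∈ P, (linePts P q u).card ≤ l) (X : Finset ℝ)
    (hX : ∀ p ∈ P, ∀ j, p j ∈ Subfield.closure (X : Set ℝ)) (Bc : ℕ)
    (hcols : ∀ C ⊆ P, (∀ c ∈ C, ∀ c' ∈ C, c ≠ c' → ∀ t : ℝ, c - c' ≠ t • u) → C.card ≤ Bc) :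
    4 * P.card ≤ 2 * ((dsts N P).card + Bc ^ 2 * X.card) + Bc ^ 2 + 1 := by
  obtain ⟨a, b, c, hker, hau, hbu, hcu, hgen, w1, hw1a, hw1b⟩ := coords_exist u hu (P.offDiag.image (fun z => z.1 - z.2))
  set π : E3 →ₗ[ℝ] E3 := LinearMap.id - c.smulRight u with hπ
  have hπv : ∀ v, π v = v - (c v) • u := fun v => by simp [hπ]
  have hπu : ∀ t : ℝ, π (t • u) = 0 := fun t => by rw [hπv]; simp [hcu]
  have haπ : ∀ v, a (π v) = a v := fun v => by rw [hπv]; simp [hau]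
  have hpi0 : ∀ v, π v = 0 → v = (c v) • u := fun v h => by rw [hπv, sub_eq_zero] at h; exact h
  have hcol : ∀ p ∈ P, ∀ q ∈ P, a p = a q → π p = π q := by
    intro p hp q hq h
    by_cases hpq : p = q
    · rw [hpq]
    have h0 : a (p - q) = 0 := by rw [map_sub, h, sub_self]
    have := hgen (p - q) (Finset.mem_image.mpr ⟨(p, q), Finset.mem_offDiag.mpr ⟨hp, hq, hpq⟩, rfl⟩) h0
    have h2 := hker _ h0 this
    have : π (p - q) = 0 := by rw [h2, hπu]
    rw [map_sub, sub_eq_zero] at this; exact this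
  have hline : ∀ q, linePts P q u = P.filter (fun p => π p = π q) := by
    intro q
    ext p
    simp only [linePts, Finset.mem_filter]
    refine and_congr_right fun _ => ⟨?_, ?_⟩
    · rintro ⟨t, rfl⟩; rw [map_add, hπu, add_zero]
    · intro h
      have : π (p - q) = 0 := by rw [map_sub, h, sub_self]
      refine ⟨c (p - q), ?_⟩
      rw [← hpi0 _ this]; abel
  set Z := P.image π with hZ
  have hZc : Z.card ≤ Bc := by
    obtain ⟨C, hCP, hCc⟩ : ∃ C ⊆ P, Set.InjOn π C ∧ C.image π = Z := by
      obtain ⟨C, h1, h2, h3⟩ := (Set.SurjOn.exists_subset_injOn_image_eq (f := π) (s := (P : Set E3)) (t := (Z : Set E3)) (by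
        rw [hZ, Finset.coe_image]; exact Set.surjOn_image _ _))
      have hfin : C.Finite := P.finite_toSet.subset h1
      refine ⟨hfin.toFinset, ?_, ?_, ?_⟩
      · intro x hx; exact h1 (hfin.mem_toFinset.mp hx)
      · rw [hfin.coe_toFinset]; exact h2
      · apply Finset.coe_injective
        rw [Finset.coe_image, hfin.coe_toFinset, h3]
    have := hcols C hCP (by
      intro x hx y hy hxy t h
      apply hxy
      apply hCc.1 hx hy
      rw [← sub_eq_zero, ← map_sub, h, hπu])
    rw [← hCc.2]
    exact Finset.card_image_le.trans this
  set w : E3 → ℕ := fun z => (P.filter (fun p => π p = z)).card with hw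
  set α : E3 → ℕ := fun d => ((P - P).filter (fun v => π v = d)).card + 1 with hα
  have hl1 : 1 ≤ l := by
    rw [← hl]
    exact Finset.card_pos.mpr ⟨o, Finset.mem_filter.mpr ⟨hoP, 0, by simp⟩⟩
  have hlay := layers Z w l hl1 (by
      intro z hz
      obtain ⟨q, hq, rfl⟩ := Finset.mem_image.mp hz
      have := hmax q hq
      rwa [hline] at this) (π o) (Finset.mem_image_of_mem _ hoP) (by rw [hw, ← hl, hline]) a (by
      intro z hz z' hz' h
      obtain ⟨p, hp, rfl⟩ := Finset.mem_image.mp hz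
      obtain ⟨q, hq, rfl⟩ := Finset.mem_image.mp hz'
      rw [haπ, haπ] at h
      exact hcol p hp q hq h) (by
      intro e
      by_contra hcon
      push Not at hcon
      have hall : ∀ p ∈ P, ∃ s t : ℝ, p - o = s • e + t • u := by
        intro p hp
        obtain ⟨s, hs⟩ := hcon (π p) (Finset.mem_image_of_mem _ hp) (Finset.card_pos.mpr ⟨p, Finset.mem_filter.mpr ⟨hp, rfl⟩⟩)
        refine ⟨s, c p - c o, ?_⟩
        rw [hπv, hπv] at hs
        have h1 : p - o = ((p - c p • u) - (o - c o • u)) + (c p - c o) • u := by rw [sub_smul]; abel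
        rw [h1, hs]; abel
      have key : ∀ f : E3 →ₗ[ℝ] ℝ, f e = 0 → f u = 0 → f = 0 := by
        intro f hfe hfu
        by_contra hf
        obtain ⟨p, hp, hne⟩ := hP f (f o) hf
        obtain ⟨s, t, hst⟩ := hall p hp
        apply hne
        rw [← sub_eq_zero, ← map_sub, hst]
        simp [hfe, hfu]
      have hb0 : b ≠ 0 := by intro h; rw [h] at hw1b; simp at hw1b
      by_cases hae : a e = 0
      · have ha0 := key a hae hau
        obtain ⟨p, hp, hne⟩ := hP b (b o) hb0
        apply hne
        have hpo : p ≠ o := by rintro rfl; exact hne rfl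
        have := hgen (p - o) (Finset.mem_image.mpr ⟨(p, o), Finset.mem_offDiag.mpr ⟨hp, hoP, hpo⟩, rfl⟩) (by rw [ha0]; simp)
        rw [map_sub] at this; linarith
      · have h := key ((b e) • a - (a e) • b) (by simp; ring) (by simp [hau, hbu])
        have := congrArg (fun f : E3 →ₗ[ℝ] ℝ => f w1) h
        simp [hw1a, hw1b] at this
        exact hae this) α (by
      intro q hq r hr
      obtain ⟨q, hq1, rfl⟩ := Finset.mem_image.mp hq
      obtain ⟨r, hr1, rfl⟩ := Finset.mem_image.mp hr
      set Q := P.filter (fun p => π p = π q) with hQ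
      set R := P.filter (fun p => π p = π r) with hR
      have hci : ∀ z, Set.InjOn c (P.filter (fun p => π p = z)) := by
        intro z x hx y hy h
        rw [Finset.mem_coe, Finset.mem_filter] at hx hy
        have h1 := hx.2.trans hy.2.symm
        rw [hπv, hπv, h] at h1
        exact sub_left_injective h1
      have hcd := cauchy_davenport_add_of_linearOrder_isCancelAdd (s := Q.image c) (t := (R.image c).image (fun x => -x))
        ⟨c q, Finset.mem_image_of_mem _ (Finset.mem_filter.mpr ⟨hq1, rfl⟩)⟩
        ⟨-c r, Finset.mem_image_of_mem _ (Finset.mem_image_of_mem _ (Finset.mem_filter.mpr ⟨hr1, rfl⟩))⟩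
      rw [Finset.card_image_of_injective _ neg_injective, Finset.card_image_of_injOn (hci _), Finset.card_image_of_injOn (hci _), ← hQ, ← hR] at hcd
      have hsub : Q.image c + (R.image c).image (fun x => -x) ⊆ ((P - P).filter (fun v => π v = π q - π r)).image c := by
        intro x hx
        obtain ⟨y, hy, z, hz, rfl⟩ := Finset.mem_add.mp hx
        obtain ⟨p, hp, rfl⟩ := Finset.mem_image.mp hy
        obtain ⟨z, hz1, rfl⟩ := Finset.mem_image.mp hz
        obtain ⟨p', hp', rfl⟩ := Finset.mem_image.mp hz1
        rw [Finset.mem_filter] at hp hp'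
        refine Finset.mem_image.mpr ⟨p - p', Finset.mem_filter.mpr ⟨Finset.sub_mem_sub hp.1 hp'.1, ?_⟩, ?_⟩
        · rw [map_sub, hp.2, hp'.2]
        · rw [map_sub, sub_eq_add_neg]
      have h2 := (Finset.card_le_card hsub).trans Finset.card_image_le
      show Q.card + R.card ≤ _ + 1
      omega)
  have hsumw : ∑ z ∈ Z, w z = P.card := (Finset.card_eq_sum_card_fiberwise (fun p hp => Finset.mem_image_of_mem _ hp)).symm
  have hsumα : ∑ d ∈ Z - Z, α d = (P - P).card + (Z - Z).card := by
    rw [hα, Finset.sum_add_distrib, ← Finset.card_eq_sum_card_fiberwise]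
    · simp
    · intro v hv
      obtain ⟨p, hp, q, hq, rfl⟩ := Finset.mem_sub.mp hv
      rw [map_sub]
      exact Finset.sub_mem_sub (Finset.mem_image_of_mem _ hp) (Finset.mem_image_of_mem _ hq)
  have hZ2 : Z.card * Z.card ≤ Bc ^ 2 := by rw [sq]; exact Nat.mul_le_mul hZc hZc
  have hZZ : (Z - Z).card ≤ Bc ^ 2 := Finset.card_sub_le.trans hZ2
  have hGP := GP hN P X (fun p hp q hq j => by
    rw [PiLp.sub_apply]; exact Subfield.sub_mem _ (hX p hp j) (hX q hq j)) (fun U => (lset N P U).card) (Bc ^ 2) (Submodule.span ℝ {u})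
    (fun U _ => le_rfl) (by
      intro U _ hU
      refine le_trans ?_ hZ2
      rw [← Finset.card_product]
      have hex : ∀ r, ∃ z : E3 × E3, r ∈ lset N P U → z.1 ∈ P ∧ z.2 ∈ P ∧ z.1 ≠ z.2 ∧ Submodule.span ℝ {z.1 - z.2} = U ∧ N.1 (z.1 - z.2) = r := by
        intro r
        by_cases hr : r ∈ lset N P U
        · obtain ⟨p, hp, q, hq, h⟩ := mem_lset.mp hr
          exact ⟨(p, q), fun _ => ⟨hp, hq, h⟩⟩
        · exact ⟨(0, 0), fun h => (hr h).elim⟩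
      choose g hg using hex
      apply Finset.card_le_card_of_injOn (fun r => (π (g r).1, π (g r).2))
      · intro r hr
        have := hg r hr
        exact Finset.mem_product.mpr ⟨Finset.mem_image_of_mem _ this.1, Finset.mem_image_of_mem _ this.2.1⟩
      · intro r hr r' hr' e
        simp only [Prod.mk.injEq] at e
        obtain ⟨-, -, h3, h4, h5⟩ := hg r hr
        obtain ⟨-, -, h3', h4', h5'⟩ := hg r' hr'
        obtain ⟨k, -, hk⟩ := span_eq_iff (h4.trans h4'.symm)
        have h6 : π ((g r').1 - (g r').2) = π ((g r).1 - (g r).2) := by rw [map_sub, map_sub, e.1, e.2]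
        have h7 : π ((g r).1 - (g r).2) ≠ 0 := by
          intro h
          apply hU
          have h8 := hpi0 _ h
          rw [← h4, h8]
          apply span_smul_eq
          intro h9
          rw [h9, zero_smul, sub_eq_zero] at h8
          exact h3 h8
        rw [hk, map_smul] at h6
        have hk1 : k = 1 := by
          by_contra hk1
          apply h7
          have : (k - 1) • π ((g r).1 - (g r).2) = 0 := by rw [sub_smul, h6, one_smul, sub_self]
          exact (smul_eq_zero.mp this).resolve_left (sub_ne_zero.mpr hk1)
        rw [← h5, ← h5', hk, hk1, one_smul])
  have hv := vec_le2 (N := N) (fun U => lset N P U) (dirs P) ((P - P).erase 0) (by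
    intro v hv
    rw [Finset.mem_erase] at hv
    obtain ⟨p, hp, q, hq, rfl⟩ := Finset.mem_sub.mp hv.2
    have hne := sub_ne_zero.mp hv.1
    exact ⟨hv.1, mem_dirs.mpr ⟨p, hp, q, hq, hne, rfl⟩, mem_lset.mpr ⟨p, hp, q, hq, hne, rfl, rfl⟩⟩)
  have he := Finset.pred_card_le_card_erase (s := P - P) (a := (0 : E3))
  have hlay2 : 4 * ∑ z ∈ Z, w z ≤ ∑ d ∈ Z - Z, α d := by convert hlay
  rw [hsumw, hsumα] at hlay2
  omega
end

section
open scoped Classical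

theorem caseC (E : ℕ) (hE : 1 ≤ E) : ∃ n0 : ℕ, ∀ (N : NormOn3), GoodN N → ∀ P : Finset E3, Spans P → ∀ (o u : E3),
    u ≠ 0 → o ∈ P → (∀ q ∈ P, (linePts P q u).card ≤ (linePts P o u).card) → n0 ≤ P.card →
    P.card ≤ 8 * E * (linePts P o u).card → E * (dsts N P).card + P.card ≤ 2 * E * P.card → False := by
  obtain ⟨H, hH⟩ : ∃ H, H = 8 * E := ⟨_, rfl⟩
  obtain ⟨Bc, hBc⟩ : ∃ Bc, Bc = 8 * H + 1 := ⟨_, rfl⟩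
  obtain ⟨n1, hn1⟩ := fieldC H (2 * E * Bc ^ 2 + 8 * H) (by omega) (by omega)
  refine ⟨n1 + E * (Bc ^ 2 + 1) + 1, fun N hN P hP o u hu ho hmax hn hl hm => ?_⟩
  have hm2 : (dsts N P).card ≤ 2 * P.card := by
    have : E * (dsts N P).card ≤ E * (2 * P.card) := by
      calc _ ≤ 2 * E * P.card := by omega
        _ = _ := by ring
    exact Nat.le_of_mul_le_mul_left this (by omega)
  rw [← hH] at hl
  obtain ⟨X, hXc, hX⟩ := hn1 N hN P o u hu ho (by omega) hl hm2
  rw [add_mul] at hXc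
  by_cases hcols : ∀ C ⊆ P, (∀ c ∈ C, ∀ c' ∈ C, c ≠ c' → ∀ t : ℝ, c - c' ≠ t • u) → C.card ≤ Bc
  · have h := caseC_few hN P hP o u hu _ ho rfl hmax X hX Bc hcols
    have h2 := Nat.mul_le_mul_left E h
    generalize (dsts N P).card = m at *
    generalize P.card = n at *
    generalize X.card = x at *
    have e1 : E * (4 * n) = 2 * (2 * E * n) := by ring
    have e2 : E * (2 * (m + Bc ^ 2 * x) + Bc ^ 2 + 1) = 2 * (E * m) + 2 * E * Bc ^ 2 * x + E * (Bc ^ 2 + 1) := by ring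
    rw [e1, e2] at h2
    omega
  · push Not at hcols
    obtain ⟨C, hCP, hC, hCc⟩ := hcols
    set C1 := C.filter (fun c => ∃ t : ℝ, c = o + t • u) with hC1
    set C2 := C.filter (fun c => ¬ ∃ t : ℝ, c = o + t • u) with hC2
    have hsp : C1.card + C2.card = C.card := Finset.card_filter_add_card_filter_not _
    have hC1c : C1.card ≤ 1 := by
      rw [Finset.card_le_one]
      intro x hx y hy
      rw [hC1, Finset.mem_filter] at hx hy
      obtain ⟨hxC, t, ht⟩ := hx
      obtain ⟨hyC, t', ht'⟩ := hy
      by_contra hxy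
      apply hC x hxC y hyC hxy (t - t')
      rw [ht, ht', sub_smul]; abel
    obtain ⟨C3, hC3, hC3c⟩ := Finset.exists_subset_card_eq (s := C2) (n := 8 * H) (by omega)
    have hC3C : C3 ⊆ C := hC3.trans (Finset.filter_subset _ _)
    have h := caseC_cols hN P o u X hX C3 (hC3C.trans hCP) (fun c hc c' hc' => hC c (hC3C hc) c' (hC3C hc'))
      (fun c hc t ht => (Finset.mem_filter.mp (hC3 hc)).2 ⟨t, ht⟩)
    rw [hC3c] at h
    have e : (linePts P o u).card * (8 * H) = 8 * (H * (linePts P o u).card) := by ring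
    rw [e] at h
    omega

theorem spans_of_top (P : Finset E3) (h : affineSpan ℝ (P : Set E3) = ⊤) : Spans P := by
  intro f c hf
  by_contra hcon
  push Not at hcon
  apply hf
  have h1 := AffineSubspace.vectorSpan_eq_top_of_affineSpan_eq_top ℝ E3 E3 h
  have h2 : vectorSpan ℝ (P : Set E3) ≤ LinearMap.ker f := by
    rw [vectorSpan_def, Submodule.span_le]
    rintro v ⟨p, hp, q, hq, rfl⟩
    have hp' := hcon p hp
    have hq' := hcon q hq
    simp [hp', hq']
  rw [h1, top_le_iff] at h2
  exact LinearMap.ker_eq_top.mp h2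

theorem exists_max (P : Finset E3) (hP : P.Nonempty) : ∃ o ∈ P, ∃ u : E3, u ≠ 0 ∧
    ∀ q ∈ P, ∀ v : E3, v ≠ 0 → (linePts P q v).card ≤ (linePts P o u).card := by
  set S : Set ℕ := {k | ∃ o ∈ P, ∃ u : E3, u ≠ 0 ∧ (linePts P o u).card = k} with hS
  have hb : BddAbove S := by
    refine ⟨P.card, ?_⟩
    rintro k ⟨o, -, u, -, rfl⟩
    exact Finset.card_filter_le _ _
  obtain ⟨p, hp⟩ := hP
  obtain ⟨e, he⟩ := exists_ne (0 : E3)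
  obtain ⟨o, ho, u, hu, h⟩ := Nat.sSup_mem (s := S) ⟨_, p, hp, e, he, rfl⟩ hb
  exact ⟨o, ho, u, hu, fun q hq v hv => h ▸ le_csSup hb ⟨q, hq, v, hv, rfl⟩⟩

theorem main_bound (E : ℕ) (hE : 1 ≤ E) : ∃ n0 : ℕ, ∀ (N : NormOn3), GoodN N → ∀ P : Finset E3, Spans P → n0 ≤ P.card →
    E * (dsts N P).card + P.card ≤ 2 * E * P.card → False := by
  obtain ⟨nA, hA⟩ := caseA (40 * E + 2) (by omega)
  obtain ⟨nC, hC⟩ := caseC E hE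
  refine ⟨nA + nC + 11 * (24 * E) ^ 4 + 1, fun N hN P hP hn hm => ?_⟩
  have hm2 : (dsts N P).card ≤ 2 * P.card := by
    have : E * (dsts N P).card ≤ E * (2 * P.card) := by
      calc _ ≤ 2 * E * P.card := by omega
        _ = _ := by ring
    exact Nat.le_of_mul_le_mul_left this (by omega)
  obtain ⟨o, ho, u, hu, hmax⟩ := exists_max P (Finset.card_pos.mp (by omega))
  by_cases h1 : (linePts P o u).card ≤ 40 * E + 2
  · exact hA N hN P (by omega) hm2 (fun q hq v hv => (hmax q hq v hv).trans h1)
  by_cases h2 : 8 * E * (linePts P o u).card ≤ P.card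
  · have := caseB hN P hP o u hu _ ho rfl (fun q hq => hmax q hq u hu) E hE (by omega) (by omega) h2
    omega
  · exact hC N hN P hP o u hu ho (fun q hq => hmax q hq u hu) (by omega) (by omega) hm
end

/-- For all norms on `ℝ^3` but a meagre set (in the topology of the Hausdorff
distance between unit balls) the following holds: for every `ε > 0` there is
`n₀` such that every set of `n > n₀` points affinely spanning `ℝ^3` determines
at least `(2 − ε)·n` distinct distances. -/
theorem typical_norms_R3_many_distances :
    IsMeagre {N : NormOn3 |
      ¬ (∀ ε : ℝ, 0 < ε → ∃ n₀ : ℕ, ∀ n : ℕ, n₀ < n →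
          ∀ P : Finset (EuclideanSpace ℝ (Fin 3)),
            P.card = n →
            affineSpan ℝ (P : Set (EuclideanSpace ℝ (Fin 3))) = ⊤ →
            ((2 : ℝ) - ε) * n ≤
              ({r : ℝ | ∃ p ∈ P, ∃ q ∈ P, p ≠ q ∧ N.1 (p - q) = r}).ncard)} := by
  refine goodN_meagre.mono ?_
  intro N hN hgood
  apply hN
  intro ε hε
  obtain ⟨E, hE⟩ := exists_nat_gt (1 / ε)
  have hE0 : (0 : ℝ) < E := lt_trans (by positivity) hE
  have hE1 : 1 ≤ E := by exact_mod_cast hE0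
  obtain ⟨n0, h0⟩ := main_bound E hE1
  refine ⟨n0, fun n hn P hPn hspan => ?_⟩
  by_contra hlt
  push Not at hlt
  have hset : ({r : ℝ | ∃ p ∈ P, ∃ q ∈ P, p ≠ q ∧ N.1 (p - q) = r}) = (dsts N P : Set ℝ) := by
    ext r
    rw [Finset.mem_coe, mem_dsts]
    rfl
  rw [hset, Set.ncard_coe_finset] at hlt
  apply h0 N hgood P (spans_of_top P hspan) (by omega)
  rw [hPn]
  have h1 : 1 ≤ E * ε := by
    rw [div_lt_iff₀ hε] at hE
    exact hE.le
  have hn0 : (0 : ℝ) ≤ n := Nat.cast_nonneg n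
  have : (E : ℝ) * (dsts N P).card + n ≤ 2 * E * n := by
    have h2 := mul_le_mul_of_nonneg_left hlt.le hE0.le
    nlinarith [mul_le_mul_of_nonneg_right h1 hn0]
  exact_mod_cast this
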